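/- arXiv:math/9811177 — 4 statements merged into one kernel-verified Lean document; each statement's English description precedes it below -/
import Mathlib

section
/- For every infinite cardinal λ there exists a Hausdorff topological space X whose topology has a basis consisting of clopen sets, with |X| = 2^(2^λ), such that every closed subset Y of X with |Y| < |X| satisfies |Y| < λ (equivalently, every closed subset with at least λ points has exactly |X| = 2^(2^λ) points). -/
section Aux
open Set Cardinal

/-- Good colourings of an index set. -/
def GoodCol (Q : Type) : Prop :=
  ∃ (R : Type) (_ : LinearOrder R) (ρ : Q → R) (c : R → Q), ∀ (τ : Q) (ι : Type) [Finite ι]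
    (B : ι → Set Q) (f : ι → Q → Q), (∀ i, InjOn (f i) (B i)) →
    (∀ i, ∀ a ∈ B i, ρ (f i a) < ρ a) → ∃ a, c (ρ a) = τ ∧ ∀ i, a ∉ B i

/-- Engelking–Karlowicz, finite version. -/
theorem ek (Q J : Type) (hQ : ℵ₀ ≤ #Q) (code : J → Set Q) (hc : Function.Injective code) :
    ∃ e : J → Q → Q, ∀ (J0 : Finset J) (ξ : J → Q),
      {τ | ∀ j ∈ J0, e j τ = ξ j}.Infinite := by
  classical
  have : Infinite Q := Cardinal.infinite_iff.2 hQ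
  have hcard : #(Finset Q × Finset (Finset Q × Q) × ℕ) = #Q := by
    simp only [mk_prod, lift_id, mk_finset_of_infinite, mk_nat]
    rw [Cardinal.mul_eq_self hQ, Cardinal.mul_eq_left hQ hQ aleph0_ne_zero, Cardinal.mul_eq_self hQ]
  obtain ⟨E⟩ := Cardinal.eq.1 hcard
  let tr : J → Finset Q → Finset Q := fun j s => s.filter (fun x => x ∈ code j)
  let e' : J → (Finset Q × Finset (Finset Q × Q) × ℕ) → Q := fun j t =>
    if h : ∃ x, (tr j t.1, x) ∈ t.2.1 then h.choose else Classical.arbitrary Q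
  refine ⟨fun j τ => e' j (E.symm τ), fun J0 ξ => ?_⟩
  have hsep : ∃ s : Finset Q, ∀ j ∈ J0, ∀ k ∈ J0, tr j s = tr k s → j = k := by
    have : ∀ p : J × J, ∃ x : Q, p.1 ≠ p.2 → ¬ (x ∈ code p.1 ↔ x ∈ code p.2) := by
      intro p
      by_cases h : p.1 = p.2
      · exact ⟨Classical.arbitrary Q, fun h' => (h' h).elim⟩
      · by_contra! hcon
        exact h (hc (Set.ext fun x => (hcon x).2))
    choose g hg using this
    refine ⟨(J0 ×ˢ J0).image g, fun j hj k hk h => ?_⟩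
    by_contra hne
    apply hg (j, k) hne
    have hm : g (j, k) ∈ (J0 ×ˢ J0).image g :=
      Finset.mem_image_of_mem _ (Finset.mk_mem_product hj hk)
    have h2 := Finset.ext_iff.1 h (g (j, k))
    simp only [tr, Finset.mem_filter, hm, true_and] at h2
    exact h2
  obtain ⟨s, hs⟩ := hsep
  let L : Finset (Finset Q × Q) := J0.image (fun j => (tr j s, ξ j))
  have key : ∀ n : ℕ, E (s, L, n) ∈ {τ | ∀ j ∈ J0, e' j (E.symm τ) = ξ j} := by
    intro n j hj
    simp only [Equiv.symm_apply_apply]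
    have hex : ∃ x, (tr j s, x) ∈ L := ⟨ξ j, Finset.mem_image.2 ⟨j, hj, rfl⟩⟩
    have : e' j (s, L, n) = hex.choose := by simp only [e']; rw [dif_pos hex]
    rw [this]
    obtain ⟨k, hk, hkk⟩ := Finset.mem_image.1 hex.choose_spec
    have h1 := (Prod.ext_iff.1 hkk).1
    have h2 := (Prod.ext_iff.1 hkk).2
    simp only at h1 h2
    rw [← h2, hs k hk j hj h1]
  refine Set.infinite_of_injective_forall_mem (f := fun n : ℕ => E (s, L, n)) ?_ key
  intro a b h
  simpa using h

theorem lemL (Q J : Type) (hQ : ℵ₀ ≤ #Q) (hG : GoodCol Q) (code : J → Set Q)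
    (hc : Function.Injective code) (h : J → Q → Q → Q)
    (hh : ∀ j ξ, Function.Injective (h j ξ)) :
    ∃ F : J → Q → Q, ∀ (J0 : Finset J) (ξ : J → Q),
      {a | ∀ j ∈ J0, F j (h j (ξ j) a) = ξ j}.Infinite := by
  classical
  obtain ⟨e, he⟩ := ek Q J hQ code hc
  obtain ⟨R, _, ρ, c, hP⟩ := hG
  let t : J → Q → Q := fun j a => h j (e j (c (ρ a))) a
  let bad : J → Set Q := fun j => {a | ∃ a', ρ a' < ρ a ∧ t j a' = t j a}
  let F : J → Q → Q := fun j x => if hx : ∃ a, a ∉ bad j ∧ t j a = x then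
    e j (c (ρ hx.choose)) else x
  have hF : ∀ j a, a ∉ bad j → F j (t j a) = e j (c (ρ a)) := by
    intro j a ha
    have hx : ∃ a', a' ∉ bad j ∧ t j a' = t j a := ⟨a, ha, rfl⟩
    have : F j (t j a) = e j (c (ρ hx.choose)) := by simp only [F]; rw [dif_pos hx]
    rw [this]
    obtain ⟨h1, h2⟩ := hx.choose_spec
    rcases lt_trichotomy (ρ hx.choose) (ρ a) with h3 | h3 | h3
    · exact (ha ⟨_, h3, h2⟩).elim
    · rw [h3]
    · exact (h1 ⟨_, h3, h2.symm⟩).elim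
  refine ⟨F, fun J0 ξ => ?_⟩
  have hf : ∀ j a, ∃ a', a ∈ bad j → ρ a' < ρ a ∧ t j a' = t j a := by
    intro j a
    by_cases hb : a ∈ bad j
    · obtain ⟨a', h'⟩ := hb
      exact ⟨a', fun _ => h'⟩
    · exact ⟨a, fun h => (hb h).elim⟩
  choose f hf using hf
  refine Set.Infinite.of_image (fun a => c (ρ a)) ((he J0 ξ).mono ?_)
  intro τ hτ
  obtain ⟨a, ha, hB⟩ := hP τ J0 (fun j => bad j ∩ {a | c (ρ a) = τ}) (fun j => f j)
    (by
      intro j a ha b hb hab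
      have h1 := (hf j a ha.1).2
      have h2 := (hf j b hb.1).2
      rw [hab, h2] at h1
      simp only [t] at h1
      rw [show c (ρ a) = τ from ha.2, show c (ρ b) = τ from hb.2] at h1
      exact (hh _ _ h1).symm)
    (fun j a ha => (hf j a ha.1).1)
  refine ⟨a, ?_, ha⟩
  intro j hj
  have hb : a ∉ bad j := fun hb => hB ⟨j, hj⟩ ⟨hb, ha⟩
  have := hF j a hb
  simp only [t, ha] at this
  rw [hτ j hj] at this
  exact this

theorem thmM (Q : Type) (hQ : ℵ₀ ≤ #Q) (hG : GoodCol Q) (hh : Set (Set Q) → Q → Set (Set Q))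
    (hinj : ∀ α, Function.Injective (hh α)) :
    ∃ r : Set (Set Q) → Ultrafilter Q, (∀ α, (r α : Filter Q) ≤ Filter.cofinite) ∧
      ∀ T : Set (Set (Set Q)), #T ≤ #Q → (∀ α ∈ T, ∀ a, hh α a ∈ T) →
        ∃ E : Set (Set Q) → Set (Set (Set Q)), (∀ α ∈ T, {a | hh α a ∈ E α} ∈ r α) ∧
          ∀ α ∈ T, ∀ β ∈ T, ∀ x, x ∈ E α → x ∈ E β → α = β := by
  classical
  have : Infinite Q := Cardinal.infinite_iff.2 hQ
  let J0 := (Q → Set Q) × (Q → Set Q) × (Q → Q → Q)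
  let J := {j : J0 // Function.Injective j.2.1 ∧ ∀ ξ, Function.Injective (j.2.2 ξ)}
  have hcard : #J ≤ #(Set Q) := by
    refine (Cardinal.mk_subtype_le _).trans ?_
    have h2 : #Q ^ #Q = 2 ^ #Q := Cardinal.power_self_eq hQ
    have h3 : ((2 : Cardinal) ^ #Q) ^ #Q = 2 ^ #Q := by
      rw [← Cardinal.power_mul, Cardinal.mul_eq_self hQ]
    have h4 : ℵ₀ ≤ (2 : Cardinal) ^ #Q := hQ.trans (Cardinal.cantor _).le
    simp only [J0, mk_prod, lift_id, mk_pi, prod_const, mk_set, h2, h3,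
      Cardinal.mul_eq_self h4, le_refl]
  obtain ⟨code⟩ := Cardinal.le_def _ _ |>.1 hcard
  obtain ⟨F, hF⟩ := lemL Q J hQ hG code code.injective (fun j => j.1.2.2) (fun j => j.2.2)
  let mt : J → Set (Set Q) → Q → Prop := fun j α ξ => j.1.1 ⁻¹' α = j.1.2.1 ξ ∧
    ∀ a, j.1.1 ⁻¹' (hh α a) = j.1.2.1 (j.1.2.2 ξ a)
  have hmt : ∀ j α ξ ξ', mt j α ξ → mt j α ξ' → ξ = ξ' := by
    intro j α ξ ξ' h1 h2
    exact j.2.1 (h1.1.symm.trans h2.1)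
  have hr : ∀ α, ∃ r : Ultrafilter Q, (r : Filter Q) ≤ Filter.cofinite ∧
      ∀ j ξ, mt j α ξ → {a | F j (j.1.2.2 ξ a) = ξ} ∈ r := by
    intro α
    let ξ : J → Q := fun j => if h : ∃ ξ, mt j α ξ then h.choose else Classical.arbitrary Q
    have hξ : ∀ j x, mt j α x → ξ j = x := by
      intro j x hx
      have h : ∃ ξ, mt j α ξ := ⟨x, hx⟩
      have h1 : ξ j = h.choose := by simp only [ξ]; rw [dif_pos h]
      rw [h1]
      exact hmt j α _ _ h.choose_spec hx
    let A : J → Set Q := fun j => {a | F j (j.1.2.2 (ξ j) a) = ξ j}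
    have hne : (Filter.cofinite ⊓ ⨅ j, Filter.principal (A j)).NeBot := by
      rw [Filter.inf_neBot_iff]
      intro s hs s' hs'
      rw [Filter.mem_iInf'] at hs'
      obtain ⟨I, hI, V, hV, -, hs'', -⟩ := hs'
      have h1 := hF hI.toFinset ξ
      rw [Filter.mem_cofinite] at hs
      obtain ⟨a, ha, ha2⟩ := (h1.sdiff hs).nonempty
      refine ⟨a, by simpa using ha2, ?_⟩
      rw [hs'']
      simp only [Set.mem_iInter]
      intro j hj
      have := hV j
      rw [Filter.mem_principal] at this
      exact this (ha j (by simpa using hj))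
    refine ⟨Ultrafilter.of (Filter.cofinite ⊓ ⨅ j, Filter.principal (A j)), (Ultrafilter.of_le _).trans inf_le_left, ?_⟩
    intro j x hx
    have h1 := (Ultrafilter.of_le (Filter.cofinite ⊓ ⨅ j, Filter.principal (A j))).trans
      (inf_le_right.trans (iInf_le _ j))
    have h2 := h1 (Filter.mem_principal_self _)
    simp only [A, hξ j x hx] at h2
    exact h2
  choose r hr1 hr2 using hr
  refine ⟨r, hr1, ?_⟩
  intro T hT hcl
  rcases T.eq_empty_or_nonempty with rfl | ⟨α0, hα0⟩
  · exact ⟨fun _ => ∅, by simp, by simp⟩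
  have hT' : #Q = #T := by
    refine le_antisymm ?_ hT
    exact Cardinal.mk_le_of_injective (f := fun a => (⟨hh α0 a, hcl _ hα0 a⟩ : T))
      (fun a b hab => hinj α0 (by simpa using hab))
  obtain ⟨u⟩ := Cardinal.eq.1 hT'
  obtain ⟨pr⟩ : Nonempty (Q ≃ Q × Q) := Cardinal.eq.1 (by simp [Cardinal.mul_eq_self hQ])
  have hsep : ∀ p : Q × Q, ∃ x : Set Q, p.1 ≠ p.2 →
      ¬ (x ∈ (u p.1 : Set (Set Q)) ↔ x ∈ (u p.2 : Set (Set Q))) := by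
    intro p
    by_cases h : p.1 = p.2
    · exact ⟨∅, fun h' => (h' h).elim⟩
    · by_contra! hcon
      exact h (u.injective (Subtype.ext (Set.ext fun x => (hcon x).2)))
  choose g hg using hsep
  let C : Q → Set Q := fun q => g (pr q)
  let w : Q → Set Q := fun ξ => C ⁻¹' (u ξ : Set (Set Q))
  have hw : Function.Injective w := by
    intro x y hxy
    by_contra hne
    apply hg (x, y) hne
    have := Set.ext_iff.1 hxy (pr.symm (x, y))
    simpa [w, C] using this
  let h : Q → Q → Q := fun ξ a => u.symm ⟨hh (u ξ) a, hcl _ (u ξ).2 a⟩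
  have hh' : ∀ ξ, Function.Injective (h ξ) := by
    intro ξ a b hab
    have := u.symm.injective hab
    exact hinj _ (by simpa using this)
  let j : J := ⟨(C, w, h), hw, hh'⟩
  have hmatch : ∀ ξ, mt j (u ξ) ξ := by
    intro ξ
    refine ⟨rfl, fun a => ?_⟩
    simp [j, w, h]
  refine ⟨fun α => {x | ∃ i, C ⁻¹' x = w i ∧ ∃ hα : α ∈ T, F j i = u.symm ⟨α, hα⟩}, ?_, ?_⟩
  · intro α hα
    have h1 := hr2 (u (u.symm ⟨α, hα⟩)) j _ (hmatch (u.symm ⟨α, hα⟩))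
    simp only [Equiv.apply_symm_apply] at h1
    refine Filter.mem_of_superset h1 ?_
    intro a ha
    refine ⟨h (u.symm ⟨α, hα⟩) a, ?_, hα, ha⟩
    simp [w, h]
  · rintro α hα β hβ x ⟨i, hi, _, hi2⟩ ⟨i', hi', _, hi2'⟩
    have : i = i' := hw (hi.symm.trans hi')
    subst this
    have := u.symm.injective (hi2.symm.trans hi2')
    simpa using this

theorem mainOfGood (Q : Type) (hQ : ℵ₀ ≤ #Q) (hG : GoodCol Q) :
    ∃ (X : Type) (t : TopologicalSpace X),
      @T2Space X t ∧
      (∃ B : Set (Set X),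
        @TopologicalSpace.IsTopologicalBasis X t B ∧ ∀ s ∈ B, @IsClopen X t s) ∧
      Cardinal.mk X = (2 : Cardinal) ^ ((2 : Cardinal) ^ #Q) ∧
      ∀ Y : Set X, @IsClosed X t Y → Cardinal.mk ↥Y < Cardinal.mk X →
        Cardinal.mk ↥Y < #Q := by
  classical
  have : Infinite Q := Cardinal.infinite_iff.2 hQ
  let X := Set (Set Q)
  have hX : #X = (2 : Cardinal) ^ ((2 : Cardinal) ^ #Q) := by simp [X]
  have hmu : ℵ₀ ≤ (2 : Cardinal) ^ #Q := hQ.trans (Cardinal.cantor _).le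
  have hXi : ℵ₀ ≤ #X := by rw [hX]; exact hmu.trans (Cardinal.cantor _).le
  have hQX : #Q ≤ #X := by
    rw [hX]; exact ((Cardinal.cantor _).trans (Cardinal.cantor _)).le
  have hcof : #Q < (#X).ord.cof := by
    rw [hX]
    exact (Cardinal.cantor _).trans (Cardinal.lt_cof_ord_power hmu (by norm_num))
  -- well-order on X
  obtain ⟨φ⟩ : Nonempty (X ≃ (#X).ord.ToType) := Cardinal.eq.1 (by simp)
  let lt : X → X → Prop := fun x y => φ x < φ y
  have hwf : WellFounded lt := InvImage.wf φ wellFounded_lt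
  have hIic : ∀ y : X, #{x | ¬ lt y x} < #X := by
    intro y
    have h1 : #{x | ¬ lt y x} = #(Iic (φ y)) := by
      refine Cardinal.mk_congr (φ.subtypeEquiv ?_)
      intro x
      simp [lt]
    have h2 : #(Iic (φ y)) ≤ #(Iio (φ y)) + 1 := by
      rw [← Set.Iio_insert]
      exact Cardinal.mk_insert_le
    rw [h1]
    refine h2.trans_lt ?_
    exact Cardinal.add_lt_of_lt hXi (Cardinal.mk_Iio_toType_ord_lt _)
      (one_lt_aleph0.trans_le hXi)
  -- enumeration of injections
  have henum : #X = #((Q ↪ X) × X) := by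
    have h1 : #(Q ↪ X) ≤ #X := by
      have h2 : #(Q ↪ X) ≤ #(Q → X) :=
        Cardinal.mk_le_of_injective (f := fun f => (f : Q → X)) DFunLike.coe_injective
      refine h2.trans ?_
      simp only [mk_pi, prod_const, lift_id]
      rw [hX, ← Cardinal.power_mul, Cardinal.mul_eq_left hmu (Cardinal.cantor _).le
        (by exact (aleph0_pos.trans_le hQ).ne')]
    have hne : #(Q ↪ X) ≠ 0 := by
      rw [Cardinal.mk_ne_zero_iff]
      exact (Cardinal.le_def _ _).1 hQX
    simp only [mk_prod, lift_id]
    rw [Cardinal.mul_eq_right hXi h1 hne]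
  obtain ⟨ψ⟩ := Cardinal.eq.1 henum
  let hh : X → Q → X := fun α => (ψ α).1
  obtain ⟨r, hr1, hr2⟩ := thmM Q hQ hG hh (fun α => (ψ α).1.injective)
  let Lim : Set X := {α | ∀ a, lt (hh α a) α}
  have hbig : ∀ g : Q ↪ X, #X ≤ #{α | α ∈ Lim ∧ (ψ α).1 = g} := by
    intro g
    by_contra! hlt
    have hfib : #X ≤ #{α | (ψ α).1 = g} := by
      refine Cardinal.mk_le_of_injective (f := fun x => ⟨ψ.symm (g, x), by simp⟩) ?_
      intro x y hxy
      simpa using hxy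
    have hsub : {α | (ψ α).1 = g} ⊆
        {α | α ∈ Lim ∧ (ψ α).1 = g} ∪ ⋃ a, {x | ¬ lt (g a) x} := by
      intro α hα
      by_cases hL : α ∈ Lim
      · exact Or.inl ⟨hL, hα⟩
      · right
        simp only [Lim, Set.mem_ofPred_eq, not_forall] at hL
        obtain ⟨a, ha⟩ := hL
        refine Set.mem_iUnion.2 ⟨a, ?_⟩
        have : hh α a = g a := by simp only [hh]; rw [hα]
        rw [← this]
        exact ha
    have hun : #(⋃ a, {x | ¬ lt (g a) x} : Set X) < #X := by
      refine (Cardinal.mk_iUnion_le _).trans_lt ?_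
      refine Cardinal.mul_lt_of_lt hXi (hcof.trans_le (Ordinal.cof_ord_le _)) ?_
      exact Cardinal.iSup_lt_of_lt_cof_ord hcof (fun a => hIic _)
    have := (hfib.trans (Cardinal.mk_le_mk_of_subset hsub)).trans (Cardinal.mk_union_le _ _)
    exact absurd this (not_le.2 (Cardinal.add_lt_of_lt hXi hlt hun))
  -- coherent sets
  let Coh : Set (Set X) := {U | ∀ α ∈ Lim, α ∈ U ↔ {a | hh α a ∈ U} ∈ r α}
  have hcompl : ∀ U ∈ Coh, Uᶜ ∈ Coh := by
    intro U hU α hα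
    rw [Set.mem_compl_iff, hU α hα, ← Ultrafilter.compl_mem_iff_notMem]
    rfl
  have hinter : ∀ U ∈ Coh, ∀ V ∈ Coh, U ∩ V ∈ Coh := by
    intro U hU V hV α hα
    rw [Set.mem_inter_iff, hU α hα, hV α hα]
    exact Filter.inter_mem_iff.symm
  let t : TopologicalSpace X := TopologicalSpace.generateFrom Coh
  have hsepar : ∀ α β : X, α ≠ β → ∃ U ∈ Coh, α ∈ U ∧ β ∉ U := by
    intro α β hne
    let T : Set X := Set.range
      (fun p : Bool × List Q => p.2.foldl hh (if p.1 then α else β))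
    have hTc : #T ≤ #Q := by
      refine Cardinal.mk_range_le.trans ?_
      simp only [mk_prod, lift_id, mk_list_eq_mk]
      refine (Cardinal.mul_le_max _ _).trans ?_
      simp only [Cardinal.mk_bool]
      exact max_le (max_le ((Cardinal.natCast_lt_aleph0 (n := 2)).le.trans hQ) le_rfl) hQ
    have hTcl : ∀ x ∈ T, ∀ a, hh x a ∈ T := by
      rintro x ⟨⟨b, l⟩, rfl⟩ a
      exact ⟨(b, l ++ [a]), by simp⟩
    have hαT : α ∈ T := ⟨(true, []), by simp⟩
    have hβT : β ∈ T := ⟨(false, []), by simp⟩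
    obtain ⟨E, hE1, hE2⟩ := hr2 T hTc hTcl
    let par : X → X → Prop := fun s x => x ∈ T ∧ s ∈ E x ∧ s ≠ α ∧ s ≠ β
    let U0 : X → Prop := fun s => Relation.ReflTransGen par s α
    have hpar : ∀ s x, par s x → (U0 s ↔ U0 x) := by
      intro s x hsx
      constructor
      · intro h
        rcases Relation.ReflTransGen.cases_head h with h | ⟨y, hy, hyα⟩
        · exact (hsx.2.2.1 h).elim
        · have : x = y := hE2 x hsx.1 y hy.1 s hsx.2.1 hy.2.1
          rw [this]; exact hyα
      · intro h
        exact Relation.ReflTransGen.head hsx h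
    let step : (x : X) → ((y : X) → lt y x → Prop) → Prop := fun x rec =>
      if x ∈ T then U0 x else {a | ∃ h : lt (hh x a) x, rec _ h} ∈ r x
    let U : X → Prop := hwf.fix step
    have hU : ∀ x, U x = step x (fun y _ => U y) := fun x => hwf.fix_eq step x
    have hUT : ∀ x ∈ T, U x = U0 x := by
      intro x hx
      rw [hU x]; simp only [step]; rw [if_pos hx]
    refine ⟨{x | U x}, ?_, ?_, ?_⟩
    · intro x hx
      by_cases hxT : x ∈ T
      · have h1 : {a | hh x a ∈ E x ∧ hh x a ≠ α ∧ hh x a ≠ β} ∈ r x := by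
          have h2 : ∀ z : X, {a | hh x a ≠ z} ∈ r x := by
            intro z
            apply hr1 x
            rw [Filter.mem_cofinite]
            refine Set.Subsingleton.finite ?_
            intro a ha b hb
            simp only [Set.mem_compl_iff, Set.mem_ofPred_eq, not_not] at ha hb
            exact (ψ x).1.injective (ha.trans hb.symm)
          exact Filter.inter_mem (hE1 x hxT) (Filter.inter_mem (h2 α) (h2 β))
        have h3 : ∀ a ∈ {a | hh x a ∈ E x ∧ hh x a ≠ α ∧ hh x a ≠ β},
            (U (hh x a) ↔ U x) := by
          intro a ha
          rw [hUT x hxT, hUT _ (hTcl x hxT a)]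
          exact hpar _ _ ⟨hxT, ha⟩
        constructor
        · intro hxU
          exact Filter.mem_of_superset h1 (fun a ha => (h3 a ha).2 hxU)
        · intro hm
          obtain ⟨a, ha, ha'⟩ := (r x).nonempty_of_mem (Filter.inter_mem h1 hm)
          exact (h3 a ha).1 ha'
      · have h1 : U x = ({a | ∃ h : lt (hh x a) x, U (hh x a)} ∈ r x) := by
          rw [hU x]; simp only [step]; rw [if_neg hxT]
        have h2 : {a | ∃ h : lt (hh x a) x, U (hh x a)} = {a | hh x a ∈ {x | U x}} := by
          ext a
          exact ⟨fun h => h.2, fun h => ⟨hx a, h⟩⟩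
        rw [h2] at h1
        exact iff_of_eq h1
    · change U α
      rw [hUT α hαT]
    · change ¬ U β
      rw [hUT β hβT]
      intro h
      rcases Relation.ReflTransGen.cases_head h with h | ⟨y, hy, _⟩
      · exact hne h.symm
      · exact hy.2.2.2 rfl
  have hopen : ∀ U ∈ Coh, IsOpen U := fun U hU => TopologicalSpace.isOpen_generateFrom_of_mem hU
  have hbasis : TopologicalSpace.IsTopologicalBasis Coh := by
    have hu : (Set.univ : Set X) ∈ Coh := by
      intro α _
      simp only [Set.mem_univ, true_iff]
      exact Filter.univ_mem
    have := TopologicalSpace.isTopologicalBasis_of_subbasis_of_inter (t := t) (r := Coh) rfl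
      (fun U hU V hV => hinter U hU V hV)
    rwa [Set.insert_eq_of_mem hu] at this
  refine ⟨X, t, ?_, ⟨Coh, hbasis, ?_⟩, hX, ?_⟩
  · refine ⟨fun α β hne => ?_⟩
    obtain ⟨U, hU, h1, h2⟩ := hsepar α β hne
    exact ⟨U, Uᶜ, hopen U hU, hopen _ (hcompl U hU), h1, h2, disjoint_compl_right⟩
  · intro U hU
    exact ⟨⟨hopen _ (hcompl U hU)⟩, hopen U hU⟩
  · intro Y hY hlt
    by_contra! hge
    obtain ⟨g⟩ := (Cardinal.le_def _ _).1 hge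
    let g' : Q ↪ X := g.trans (Function.Embedding.subtype _)
    refine absurd hlt (not_lt.2 ((hbig g').trans (Cardinal.mk_le_mk_of_subset ?_)))
    rintro α ⟨hL, hα⟩
    by_contra hαY
    obtain ⟨U, hU, hαU, hUY⟩ := hbasis.exists_subset_of_mem_open
      (show α ∈ Yᶜ from hαY) hY.isOpen_compl
    have h1 := (hU α hL).1 hαU
    obtain ⟨a, ha⟩ := (r α).nonempty_of_mem h1
    apply hUY ha
    have : hh α a = g' a := by simp only [hh]; rw [hα]
    rw [this]
    exact (g a).2

theorem goodNat : GoodCol ℕ := by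
  refine ⟨ℕ, inferInstance, fun a => Nat.log 2 (Nat.log 2 a), fun n => n.unpair.1, ?_⟩
  intro τ ι _ B f hinj hreg
  classical
  have := Fintype.ofFinite ι
  by_contra! hcon
  set j := Nat.pair τ (Fintype.card ι) with hj
  have hjk : Fintype.card ι ≤ j := Nat.right_le_pair _ _
  have hlog : ∀ i, Nat.log 2 (Nat.log 2 (2 ^ 2 ^ i)) = i := by
    intro i
    rw [Nat.log_pow (by norm_num), Nat.log_pow (by norm_num)]
  have hblock : ∀ a ∈ Finset.Ico (2 ^ 2 ^ j) (2 ^ 2 ^ (j + 1)), Nat.log 2 (Nat.log 2 a) = j := by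
    intro a ha
    rw [Finset.mem_Ico] at ha
    have h0 : a ≠ 0 := by
      have : 0 < 2 ^ 2 ^ j := by positivity
      omega
    have h1 : Nat.log 2 a < 2 ^ (j + 1) := (Nat.log_lt_iff_lt_pow (by norm_num) h0).2 ha.2
    have h2 : 2 ^ j ≤ Nat.log 2 a := (Nat.le_log_iff_pow_le (by norm_num) h0).2 ha.1
    have h3 : Nat.log 2 a ≠ 0 := by
      have : 0 < 2 ^ j := by positivity
      omega
    have h4 := (Nat.log_lt_iff_lt_pow (b := 2) (by norm_num) h3).2 h1
    have h5 := (Nat.le_log_iff_pow_le (b := 2) (by norm_num) h3).2 h2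
    omega
  have hex : ∀ a, ∃ i, a ∈ Finset.Ico (2 ^ 2 ^ j) (2 ^ 2 ^ (j + 1)) → a ∈ B i := by
    intro a
    by_cases ha : a ∈ Finset.Ico (2 ^ 2 ^ j) (2 ^ 2 ^ (j + 1))
    · obtain ⟨i, hi⟩ := hcon a (by rw [hblock a ha, hj, Nat.unpair_pair])
      exact ⟨i, fun _ => hi⟩
    · obtain ⟨i, hi⟩ := hcon (2 ^ 2 ^ j) (by rw [hlog, hj, Nat.unpair_pair])
      exact ⟨i, fun h => (ha h).elim⟩
  choose g hg using hex
  have hcard := Finset.card_le_card_of_injOn (s := Finset.Ico (2 ^ 2 ^ j) (2 ^ 2 ^ (j + 1)))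
    (t := (Finset.univ : Finset ι) ×ˢ Finset.range (2 ^ 2 ^ j)) (fun a => (g a, f (g a) a))
    (by
      intro a ha
      have h1 := hreg (g a) a (hg a ha)
      simp only at h1
      rw [hblock a ha] at h1
      simp only [Finset.coe_product, Set.mem_prod, Finset.coe_univ, Set.mem_univ, true_and,
        Finset.coe_range, Set.mem_Iio]
      by_contra! hge
      have h2 := Nat.log_mono_right (b := 2) (Nat.log_mono_right (b := 2) hge)
      rw [hlog] at h2
      omega)
    (by
      intro a ha b hb hab
      obtain ⟨h1, h2⟩ := Prod.ext_iff.1 hab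
      simp only at h1 h2
      rw [← h1] at h2
      exact hinj (g a) (hg a ha) (h1 ▸ hg b hb) h2)
  rw [Finset.card_product, Nat.card_Ico, Finset.card_range, Finset.card_univ] at hcard
  have hN : j + 2 ≤ 2 ^ 2 ^ j := by
    have h1 : j + 1 ≤ 2 ^ j := Nat.lt_two_pow_self
    have h2 : 2 ^ j + 1 ≤ 2 ^ 2 ^ j := Nat.lt_two_pow_self
    omega
  have hsq : 2 ^ 2 ^ (j + 1) = 2 ^ 2 ^ j * 2 ^ 2 ^ j := by
    rw [← pow_add]; congr 1; ring
  rw [hsq] at hcard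
  generalize 2 ^ 2 ^ j = N at *
  have h3 : (Fintype.card ι + 2) * N ≤ N * N := Nat.mul_le_mul_right _ (by omega)
  have h4 : (Fintype.card ι + 2) * N = Fintype.card ι * N + 2 * N := by ring
  omega

theorem ulam (W : Type) [LinearOrder W] [WellFoundedLT W] (ν : Cardinal.{0}) (hν : ℵ₀ ≤ ν)
    (hW : #W = Order.succ ν) (hI : ∀ a : W, #(Iio a) ≤ ν) :
    ∃ c : W → W, ∀ (τ : W) (ι : Type) [Finite ι] (B : ι → Set W) (f : ι → W → W),
      (∀ i, InjOn (f i) (B i)) → (∀ i, ∀ a ∈ B i, f i a < a) →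
      ∃ a, #(Iio a) = ν ∧ c a = τ ∧ ∀ i, a ∉ B i := by
  classical
  have hlt : ν < #W := by rw [hW]; exact Order.lt_succ ν
  have hIic : ∀ a : W, #(Iic a) ≤ ν := by
    intro a
    rw [← Set.Iio_insert]
    exact Cardinal.mk_insert_le.trans (Cardinal.add_le_of_le hν (hI a)
      (one_lt_aleph0.le.trans hν))
  have hUn : ∀ (Z : Set W) (A : W → Set W), #Z ≤ ν → (∀ z ∈ Z, #(A z) ≤ ν) →
      #(⋃ z ∈ Z, A z : Set W) ≤ ν := by
    intro Z A hZ hA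
    refine (Cardinal.mk_biUnion_le _ _).trans ?_
    refine Cardinal.mul_le_of_le hν hZ ?_
    exact ciSup_le' (fun z => hA z.1 z.2)
  have hbdd : ∀ Z : Set W, #Z ≤ ν → ∃ w, ∀ z ∈ Z, z < w := by
    intro Z hZ
    by_contra! hcon
    have h1 := hUn Z Iic hZ (fun z _ => hIic z)
    have h2 : (⋃ z ∈ Z, Iic z) = (Set.univ : Set W) := by
      ext w
      obtain ⟨z, hz, hwz⟩ := hcon w
      simp only [Set.mem_iUnion, Set.mem_univ, iff_true]
      exact ⟨z, hz, hwz⟩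
    rw [h2, Cardinal.mk_univ] at h1
    exact absurd hlt (not_lt.2 h1)
  have hfin : ∀ Z : Set W, Z.Countable → #Z ≤ ν := fun Z hZ =>
    (Cardinal.le_aleph0_iff_set_countable.2 hZ).trans hν
  let Small : Set W → Prop := fun S => ∃ f : W → W, (∀ a ∈ S, f a < a) ∧
    ∀ y, #{a | a ∈ S ∧ f a = y} ≤ ν
  have hIci : ∀ b, ¬ Small (Ici b) := by
    rintro b ⟨f, hf1, hf2⟩
    have hnext : ∀ d, ∃ w, d < w ∧ ∀ a, b ≤ a → f a ≤ d → a < w := by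
      intro d
      have h1 := hUn (Iic d) (fun y => {a | a ∈ Ici b ∧ f a = y}) (hIic d) (fun y _ => hf2 y)
      obtain ⟨w1, hw1⟩ := hbdd _ h1
      obtain ⟨w2, hw2⟩ := hbdd {d} (hfin _ (Set.countable_singleton d))
      refine ⟨max w1 w2, (hw2 d rfl).trans_le (le_max_right _ _), fun a ha hfa => ?_⟩
      refine (hw1 a ?_).trans_le (le_max_left _ _)
      simp only [Set.mem_iUnion]
      exact ⟨f a, hfa, ha, rfl⟩
    choose next hn1 hn2 using hnext
    let δ : ℕ → W := fun n => next^[n] b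
    have hδ : ∀ n, δ (n + 1) = next (δ n) := fun n => Function.iterate_succ_apply' _ _ _
    obtain ⟨w, hw⟩ := hbdd (Set.range δ) (hfin _ (Set.countable_range δ))
    have hne : {w | ∀ n, δ n ≤ w}.Nonempty := ⟨w, fun n => (hw _ ⟨n, rfl⟩).le⟩
    let D := (wellFounded_lt (α := W)).min _ hne
    have hD : ∀ n, δ n ≤ D := (wellFounded_lt (α := W)).min_mem _ hne
    have hbD : b ≤ D := hD 0
    have h1 := hf1 D hbD
    have h2 : ¬ ∀ n, δ n ≤ f D := fun h =>
      (wellFounded_lt (α := W)).not_lt_min {w | ∀ n, δ n ≤ w} h h1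
    push Not at h2
    obtain ⟨n, hn⟩ := h2
    have h3 := hn2 (δ n) D hbD hn.le
    rw [← hδ] at h3
    exact absurd h3 (not_lt.2 (hD _))
  -- a point with exactly ν predecessors
  obtain ⟨b, hb⟩ : ∃ b : W, ν ≤ #(Iio b) := by
    obtain ⟨Z, hZ⟩ := Cardinal.le_mk_iff_exists_set.1 hlt.le
    obtain ⟨w, hw⟩ := hbdd Z hZ.le
    exact ⟨w, hZ ▸ Cardinal.mk_le_mk_of_subset hw⟩
  have hb' : ∀ a, b ≤ a → #(Iio a) = ν := fun a ha =>
    le_antisymm (hI a) (hb.trans (Cardinal.mk_le_mk_of_subset (Set.Iio_subset_Iio ha)))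
  -- Ulam matrix
  let N := ν.out
  have hN : #N = ν := Cardinal.mk_out ν
  have he : ∀ a : W, Nonempty (Iio a ↪ N) := fun a =>
    (Cardinal.le_def _ _).1 ((hI a).trans hN.ge)
  let e : ∀ a : W, Iio a ↪ N := fun a => (he a).some
  let S : W → N → Set W := fun τ n => {a | b ≤ a ∧ ∃ h : τ < a, e a ⟨τ, h⟩ = n}
  have hpos : ∀ τ, ∃ n, ¬ Small (S τ n) := by
    intro τ
    by_contra! hcon
    choose f hf1 hf2 using hcon
    obtain ⟨w, hw⟩ := hbdd {b, τ} (hfin _ ((Set.finite_singleton τ).insert b).countable)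
    have hbw := hw b (by simp)
    have hτw := hw τ (by simp)
    apply hIci w
    let f' : W → W := fun a => if h : τ < a then f (e a ⟨τ, h⟩) a else a
    refine ⟨f', ?_, ?_⟩
    · intro a ha
      have h : τ < a := hτw.trans_le ha
      simp only [f']
      rw [dif_pos h]
      exact hf1 _ a ⟨hbw.le.trans ha, h, rfl⟩
    · intro y
      have hsub : {a | a ∈ Ici w ∧ f' a = y} ⊆ ⋃ n, {a | a ∈ S τ n ∧ f n a = y} := by
        rintro a ⟨ha, hay⟩
        have h : τ < a := hτw.trans_le ha
        simp only [f'] at hay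
        rw [dif_pos h] at hay
        exact Set.mem_iUnion.2 ⟨e a ⟨τ, h⟩, ⟨hbw.le.trans ha, h, rfl⟩, hay⟩
      refine (Cardinal.mk_le_mk_of_subset hsub).trans ((Cardinal.mk_iUnion_le _).trans ?_)
      exact Cardinal.mul_le_of_le hν hN.le (ciSup_le' (fun n => hf2 n y))
  choose n hn using hpos
  obtain ⟨n0, hn0⟩ := Cardinal.infinite_pigeonhole n (hν.trans hlt.le) (by
    rw [hN, hW, (Cardinal.isRegular_succ hν).cof_ord]
    exact Order.lt_succ ν)
  obtain ⟨g⟩ := Cardinal.eq.1 hn0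
  let c : W → W := fun a => if h : ∃ m : n ⁻¹' {n0}, a ∈ S m n0 then g h.choose else a
  have hc : ∀ (m : n ⁻¹' {n0}) a, a ∈ S m n0 → c a = g m := by
    intro m a ha
    have h : ∃ m : n ⁻¹' {n0}, a ∈ S m n0 := ⟨m, ha⟩
    have h1 : c a = g h.choose := by simp only [c]; rw [dif_pos h]
    rw [h1]
    congr 1
    obtain ⟨_, h2, h3⟩ := h.choose_spec
    obtain ⟨_, h4, h5⟩ := ha
    have := (e a).injective (h3.trans h5.symm)
    exact Subtype.ext (Subtype.mk.inj this)
  refine ⟨c, ?_⟩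
  intro τ ι _ B f hinj hreg
  by_contra! hcon
  let m := g.symm τ
  have hm : n m = n0 := m.2
  have hall : ∀ a ∈ S m n0, ∃ i, a ∈ B i := by
    intro a ha
    exact hcon a (hb' a ha.1) (by rw [hc m a ha]; simp [m])
  apply hn m
  rw [hm]
  let f' : W → W := fun a => if h : ∃ i, a ∈ B i then f h.choose a else a
  have hf' : ∀ a (h : ∃ i, a ∈ B i), f' a = f h.choose a := by
    intro a h
    simp only [f']; rw [dif_pos h]
  refine ⟨f', ?_, ?_⟩
  · intro a ha
    rw [hf' a (hall a ha)]
    exact hreg _ a (hall a ha).choose_spec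
  · intro y
    have h1 : #{a | a ∈ S m n0 ∧ f' a = y} ≤ #ι := by
      refine Cardinal.mk_le_of_injective (f := fun a => (hall a.1 a.2.1).choose) ?_
      rintro ⟨a, ha, hay⟩ ⟨a', ha', hay'⟩ h
      simp only at h
      have h2 := (hall a ha).choose_spec
      have h3 := (hall a' ha').choose_spec
      rw [hf' a (hall a ha)] at hay
      rw [hf' a' (hall a' ha')] at hay'
      rw [← h] at h3 hay'
      exact Subtype.ext (hinj _ h2 h3 (hay.trans hay'.symm))
    exact h1.trans ((Cardinal.lt_aleph0_of_finite ι).le.trans hν)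

theorem goodUnc (l : Cardinal.{0}) (hl : ℵ₀ < l) : GoodCol l.ord.ToType := by
  classical
  let Q := l.ord.ToType
  have hQ : #Q = l := by simp [Q]
  have main : ∀ ν : Cardinal.{0}, ∃ cν : Q → Q, ℵ₀ ≤ ν → ν < l → ∀ τ : Q, #(Iio τ) ≤ ν →
      ∀ (ι : Type) [Finite ι] (B : ι → Set Q) (f : ι → Q → Q), (∀ i, InjOn (f i) (B i)) →
      (∀ i, ∀ a ∈ B i, f i a < a) → ∃ a, #(Iio a) = ν ∧ cν a = τ ∧ ∀ i, a ∉ B i := by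
    intro ν
    by_cases hν : ℵ₀ ≤ ν ∧ ν < l
    swap
    · exact ⟨id, fun h1 h2 => (hν ⟨h1, h2⟩).elim⟩
    obtain ⟨hν, hνl⟩ := hν
    let W := (Order.succ ν).ord.ToType
    have hW : #W = Order.succ ν := by simp [W]
    obtain ⟨c, hc⟩ := ulam W ν hν hW (fun a => by
      exact Order.lt_succ_iff.1 (Cardinal.mk_Iio_toType_ord_lt a))
    obtain ⟨em⟩ : Nonempty (InitialSeg ((· < ·) : W → W → Prop) ((· < ·) : Q → Q → Prop)) := by
      rw [← Ordinal.type_le_iff]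
      simp only [W, Q, Ordinal.type_toType]
      exact Cardinal.ord_le_ord.2 (Order.succ_le_of_lt hνl)
    have hmono : ∀ x y, em x < em y ↔ x < y := fun x y => em.map_rel_iff
    have heminj : Function.Injective (em : W → Q) := em.injective
    have hIio : ∀ w, #(Iio (em w)) = #(Iio w) := by
      intro w
      have : Iio (em w) = em '' (Iio w) := by
        ext q
        constructor
        · intro hq
          obtain ⟨x, rfl⟩ := em.mem_range_of_rel hq
          exact ⟨x, (hmono _ _).1 hq, rfl⟩
        · rintro ⟨x, hx, rfl⟩
          exact (hmono _ _).2 hx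
      rw [this, Cardinal.mk_image_eq heminj]
    have hWne : Nonempty W := by
      rw [← Cardinal.mk_ne_zero_iff, hW]
      exact (Order.bot_lt_succ ν).ne'
    let inv : Q → W := Function.invFun em
    have hinv : ∀ w, inv (em w) = w := Function.leftInverse_invFun heminj
    refine ⟨fun q => em (c (inv q)), ?_⟩
    intro _ _ τ hτ ι _ B f hinj hreg
    obtain ⟨t, rfl⟩ : τ ∈ Set.range em := by
      by_contra hnot
      have h1 : ∀ w, em w < τ := by
        intro w
        by_contra! hge
        rcases hge.eq_or_lt with h | h
        · exact hnot ⟨w, h.symm⟩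
        · exact hnot (em.mem_range_of_rel h)
      have h2 : #W ≤ #(Iio τ) := Cardinal.mk_le_of_injective (f := fun w => ⟨em w, h1 w⟩)
        (fun x y h => heminj (Subtype.mk.inj h))
      rw [hW] at h2
      exact absurd (Order.lt_succ ν) (not_lt.2 (h2.trans hτ))
    have hback : ∀ i w, em w ∈ B i → em (inv (f i (em w))) = f i (em w) := by
      intro i w hw
      obtain ⟨x, hx⟩ := em.mem_range_of_rel (hreg i _ hw)
      rw [← hx, hinv]
    obtain ⟨a, ha1, ha2, ha3⟩ := hc t ι (fun i => em ⁻¹' (B i)) (fun i w => inv (f i (em w)))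
      (by
        intro i x hx y hy hxy
        have := congrArg em hxy
        simp only at this
        rw [hback i x hx, hback i y hy] at this
        exact heminj (hinj i hx hy this))
      (by
        intro i x hx
        rw [← hmono, hback i x hx]
        exact hreg i _ hx)
    exact ⟨em a, by rw [hIio, ha1], by simp only [hinv, ha2], ha3⟩
  choose c hc using main
  refine ⟨Q, inferInstance, id, fun a => c (#(Iio a)) a, ?_⟩
  intro τ ι _ B f hinj hreg
  have hτ : #(Iio τ) < l := Cardinal.mk_Iio_toType_ord_lt τ
  obtain ⟨a, h1, h2, h3⟩ := hc (max ℵ₀ #(Iio τ)) (le_max_left _ _) (max_lt hl hτ) τ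
    (le_max_right _ _) ι B f hinj hreg
  refine ⟨a, ?_, h3⟩
  simp only [id]
  rw [h1, h2]

end Aux

/-- For every infinite cardinal `λ` there exists a Hausdorff topological space `X` whose
topology has a basis consisting of clopen sets, with `|X| = 2^(2^λ)`, such that every
closed subset `Y` of `X` with `|Y| < |X|` satisfies `|Y| < λ`. -/
theorem exists_T3_space_omitting_cardinals (l : Cardinal) (hl : Cardinal.aleph0 ≤ l) :
    ∃ (X : Type) (t : TopologicalSpace X),
      @T2Space X t ∧
      (∃ B : Set (Set X),
        @TopologicalSpace.IsTopologicalBasis X t B ∧ ∀ s ∈ B, @IsClopen X t s) ∧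
      Cardinal.mk X = (2 : Cardinal) ^ ((2 : Cardinal) ^ l) ∧
      ∀ Y : Set X, @IsClosed X t Y → Cardinal.mk ↥Y < Cardinal.mk X →
        Cardinal.mk ↥Y < l := by
  obtain ⟨Q, hQ, hG⟩ : ∃ Q : Type, Cardinal.mk Q = l ∧ GoodCol Q := by
    rcases hl.eq_or_lt with h | h
    · exact ⟨ℕ, by rw [Cardinal.mk_nat, h], goodNat⟩
    · exact ⟨l.ord.ToType, by simp, goodUnc l h⟩
  subst hQ
  exact mainOfGood Q hl hG
end

section
/- Let λ be a regular uncountable cardinal, let μ = 2^λ, and let κ be the least cardinal such that 2^κ > μ. Then there exists a Hausdorff topological space X whose topology has a basis consisting of clopen sets, with |X| = 2^κ, such that every closed subset Y of X with |Y| < |X| satisfies |Y| < λ. -/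
open Cardinal Set Filter

structure RegOrd (L : Type) [LinearOrder L] : Prop where
  bd : ∀ (ι : Type) (f : ι → L), #ι < #L → ∃ b, ∀ i, f i < b
  seg : ∀ i : L, #(Set.Iic i) < #L
  unc : ℵ₀ < #L

def Cl {L : Type} [LinearOrder L] (g : L → L) (c : L) : Prop := ∀ d < c, g d < c

section LemB
variable {L : Type} [LinearOrder L]

theorem RegOrd.nat (hL : RegOrd L) (f : ℕ → L) : ∃ b, ∀ n, f n < b :=
  hL.bd ℕ f (by rw [mk_nat]; exact hL.unc)

theorem RegOrd.iic (hL : RegOrd L) (i : L) (f : L → L) : ∃ b, ∀ d ≤ i, f d < b := by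
  obtain ⟨b, hb⟩ := hL.bd (Set.Iic i) (fun x => f x.1) (hL.seg i)
  exact ⟨b, fun d hd => hb ⟨d, hd⟩⟩

theorem RegOrd.iic2 (hL : RegOrd L) (i : L) (f : L → L → L) :
    ∃ b, ∀ d ≤ i, ∀ d' ≤ i, f d d' < b := by
  choose c hc using fun d => hL.iic i (f d)
  obtain ⟨b, hb⟩ := hL.iic i c
  exact ⟨b, fun d hd d' hd' => (hc d d' hd').trans (hb d hd)⟩

theorem RegOrd.gt (hL : RegOrd L) (i j : L) : ∃ b, i < b ∧ j < b := by
  obtain ⟨b, hb⟩ := hL.nat (fun n => if n = 0 then i else j)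
  exact ⟨b, by simpa using hb 0, by simpa using hb 1⟩

def IsLad (x : ℕ → L) (a : L) : Prop := (∀ n, x n < a) ∧ ∀ d < a, ∃ n, d ≤ x n

theorem RegOrd.exE [WellFoundedLT L] (hL : RegOrd L) (g : L → L) (i : L) :
    ∃ a, i < a ∧ Cl g a ∧ ∃ x, IsLad x a := by
  have step : ∀ y, ∃ y', y < y' ∧ ∀ d ≤ y, g d < y' := by
    intro y
    obtain ⟨b, hb⟩ := hL.iic y g
    obtain ⟨c, h1, h2⟩ := hL.gt y b
    exact ⟨c, h1, fun d hd => (hb d hd).trans h2⟩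
  choose S hS1 hS2 using step
  let x : ℕ → L := fun n => S^[n] i
  have hx : ∀ n, x (n+1) = S (x n) := fun n => Function.iterate_succ_apply' S n i
  obtain ⟨b, hb⟩ := hL.nat x
  let A : Set L := {b | ∀ n, x n < b}
  have hA : A.Nonempty := ⟨b, hb⟩
  let a := WellFounded.min (wellFounded_lt : WellFounded ((· < ·) : L → L → Prop)) A hA
  have ha : ∀ n, x n < a := WellFounded.min_mem _ A hA
  have hlim : ∀ d < a, ∃ n, d ≤ x n := by
    intro d hd
    by_contra hcon
    push Not at hcon
    exact WellFounded.not_lt_min _ A hcon hd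
  refine ⟨a, ha 0, ?_, x, ha, hlim⟩
  intro d hd
  obtain ⟨n, hn⟩ := hlim d hd
  have := hS2 (x n) d hn
  rw [← hx] at this
  exact this.trans (ha _)

def St (S : Set L) : Prop := ∀ (g : L → L) (i : L), ∃ c ∈ S, i < c ∧ Cl g c

theorem Cl.mono {g g' : L → L} (h : ∀ d, g d ≤ g' d) {c : L} (hc : Cl g' c) : Cl g c :=
  fun d hd => (h d).trans_lt (hc d hd)

theorem RegOrd.lemB [WellFoundedLT L] (hL : RegOrd L) :
    ∃ s : L → L, ∀ (v : L) (g : L → L) (i : L), ∃ c, i < c ∧ Cl g c ∧ s c = v := by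
  classical
  have hlad : ∀ a : L, ∃ x : ℕ → L, (∃ y, IsLad y a) → IsLad x a := by
    intro a
    by_cases h : ∃ y, IsLad y a
    · obtain ⟨y, hy⟩ := h
      exact ⟨y, fun _ => hy⟩
    · exact ⟨fun _ => a, fun h' => absurd h' h⟩
  choose lad hlad using hlad
  let E : Set L := {a | ∃ y, IsLad y a}
  have claim1 : ∃ n, ∀ e, St {a | a ∈ E ∧ e ≤ lad a n} := by
    by_contra hcon
    simp only [St] at hcon
    push Not at hcon
    choose e g i hbad using hcon
    obtain ⟨e', he'⟩ := hL.nat e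
    obtain ⟨i', hi'⟩ := hL.nat i
    choose g' hg' using fun d => hL.nat (fun n => g n d)
    obtain ⟨j, hj1, hj2⟩ := hL.gt e' i'
    obtain ⟨a, ha1, ha2, ha3⟩ := hL.exE g' j
    obtain ⟨n, hn⟩ := (hlad a ha3).2 e' (hj1.trans ha1)
    refine hbad n a ⟨ha3, (he' n).le.trans hn⟩ ((hi' n).trans (hj2.trans ha1)) ?_
    exact Cl.mono (fun d => (hg' d n).le) ha2
  obtain ⟨n, hn⟩ := claim1
  have claim2 : ∀ e, ∃ v, e ≤ v ∧ St {a | a ∈ E ∧ lad a n = v} := by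
    intro e
    by_contra hcon
    have hcon' : ∀ v, ∃ g : L → L, ∃ i : L, e ≤ v →
        ∀ c, c ∈ E → lad c n = v → i < c → ¬ Cl g c := by
      intro v
      by_cases hv : e ≤ v
      · by_contra hc
        apply hcon
        refine ⟨v, hv, ?_⟩
        intro g i
        by_contra hc2
        apply hc
        refine ⟨g, i, fun _ c hcE hcl hic hCl => hc2 ⟨c, ⟨hcE, hcl⟩, hic, hCl⟩⟩
      · exact ⟨id, e, fun h => absurd h hv⟩
    choose g i hbad using hcon'
    choose g1 hg1 using fun d => hL.iic2 d g
    choose g2 hg2 using fun d => hL.iic d i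
    obtain ⟨c, ⟨hcE, hce⟩, -, hcl⟩ := hn e (fun d => max (g1 d) (g2 d)) e
    have hv : lad c n < c := (hlad c hcE).1 n
    have hi : i (lad c n) < c :=
      ((hg2 _ _ le_rfl).trans_le (le_max_right _ _)).trans (hcl _ hv)
    refine hbad (lad c n) hce c hcE rfl hi ?_
    intro d hd
    rcases le_total d (lad c n) with h | h
    · exact ((hg1 _ _ le_rfl _ h).trans_le (le_max_left _ _)).trans (hcl _ hv)
    · exact ((hg1 _ _ h _ le_rfl).trans_le (le_max_left _ _)).trans (hcl _ hd)
  let V : Set L := {v | St {a | a ∈ E ∧ lad a n = v}}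
  have hV : #L ≤ #V := by
    by_contra hlt
    push Not at hlt
    obtain ⟨b, hb⟩ := hL.bd V Subtype.val hlt
    obtain ⟨v, hv1, hv2⟩ := claim2 b
    exact absurd (hb ⟨v, hv2⟩) (not_lt.2 hv1)
  obtain ⟨f⟩ := Cardinal.le_def _ _ |>.1 hV
  have : Nonempty L := by
    have : #L ≠ 0 := (lt_trans aleph0_pos hL.unc).ne'
    exact mk_ne_zero_iff.1 this
  have hsurj := Function.invFun_surjective f.injective
  refine ⟨fun a => if h : lad a n ∈ V then Function.invFun f ⟨_, h⟩ else a, ?_⟩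
  intro v g i
  obtain ⟨w, hw⟩ := hsurj v
  obtain ⟨c, ⟨-, hc1⟩, hc2, hc3⟩ := w.2 g i
  refine ⟨c, hc2, hc3, ?_⟩
  have hmem : lad c n ∈ V := by rw [hc1]; exact w.2
  simp only [hmem, dif_pos]
  rw [← hw]
  congr 1
  exact Subtype.ext hc1

end LemB

theorem lemEK {P L : Type} [Infinite L] (f : P → Set L) (hf : Function.Injective f) :
    ∃ H : P → L → L, ∀ (t : Finset P) (y : P → L), ∃ v, ∀ p ∈ t, H p v = y p := by
  classical
  let W := Finset L × Finset (Finset L × L)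
  have hW : #W ≤ #L := by
    have h1 : #(Finset L × L) = #L := by
      rw [mk_prod, lift_id, lift_id, mk_finset_of_infinite, mul_eq_self (aleph0_le_mk L)]
    have h2 : #(Finset (Finset L × L)) = #L := by
      rw [mk_finset_of_infinite, h1]
    show #(Finset L × Finset (Finset L × L)) ≤ #L
    rw [mk_prod, lift_id, lift_id, h2, mk_finset_of_infinite, mul_eq_self (aleph0_le_mk L)]
  obtain ⟨e⟩ := Cardinal.le_def _ _ |>.1 hW
  let q : L → W := Function.invFun e
  have hq : Function.Surjective q := Function.invFun_surjective e.injective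
  obtain ⟨l0⟩ : Nonempty L := inferInstance
  let tr : P → Finset L → Finset L := fun p u => u.filter (· ∈ f p)
  refine ⟨fun p v => if h : ∃ b, (tr p (q v).1, b) ∈ (q v).2 then h.choose else l0, ?_⟩
  intro t y
  have hsep : ∀ p p' : P, ∃ c : L, p ≠ p' → ¬ (c ∈ f p ↔ c ∈ f p') := by
    intro p p'
    by_cases h : p = p'
    · exact ⟨l0, fun h' => absurd h h'⟩
    · by_contra hc
      push Not at hc
      exact h (hf (Set.ext fun c => (hc c).2))
  choose c hc using hsep
  let u : Finset L := (t ×ˢ t).image (fun x => c x.1 x.2)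
  have hu : ∀ p ∈ t, ∀ p' ∈ t, tr p u = tr p' u → p = p' := by
    intro p hp p' hp' h
    by_contra hne
    have hcu : c p p' ∈ u := Finset.mem_image.2 ⟨(p, p'), Finset.mem_product.2 ⟨hp, hp'⟩, rfl⟩
    have := Finset.ext_iff.1 h (c p p')
    simp only [tr, Finset.mem_filter, hcu, true_and] at this
    exact hc p p' hne this
  obtain ⟨v, hv⟩ := hq (u, t.image (fun p => (tr p u, y p)))
  refine ⟨v, fun p hp => ?_⟩
  simp only [hv]
  have hex : ∃ b, (tr p u, b) ∈ t.image (fun p => (tr p u, y p)) :=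
    ⟨y p, Finset.mem_image.2 ⟨p, hp, rfl⟩⟩
  rw [dif_pos hex]
  obtain ⟨p', hp', h'⟩ := Finset.mem_image.1 hex.choose_spec
  have h1 := congrArg Prod.fst h'
  have h2 := congrArg Prod.snd h'
  simp only at h1 h2
  rw [hu p' hp' p hp h1] at h2
  exact h2.symm

theorem lemA {L K : Type} [Nonempty K] [LinearOrder L] [WellFoundedLT L] (hL : RegOrd L)
    (hP : #((L → K) × (L → L → Bool)) ≤ #(Set L)) :
    ∃ D : (K → Bool) → Ultrafilter L,
      (∀ z g, ∀ᶠ c in (D z : Filter L), Cl g c) ∧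
      (∀ z i, ∀ᶠ c in (D z : Filter L), i < c) ∧
      ∀ a : L → (K → Bool), ∃ (idx : (K → Bool) → L) (h : L → L),
        (∀ x, ∀ᶠ c in (D x : Filter L), h c = idx x) ∧
        ∀ x ∈ range a, a (idx x) = x := by
  classical
  have hinf : Infinite L := infinite_iff.2 hL.unc.le
  obtain ⟨l0⟩ : Nonempty L := inferInstance
  obtain ⟨f⟩ := Cardinal.le_def _ _ |>.1 hP
  obtain ⟨H, hH⟩ := lemEK f f.injective
  obtain ⟨s, hs⟩ := hL.lemB
  let y : (K → Bool) → ((L → K) × (L → L → Bool)) → L := fun z p =>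
    if h : ∃ i, p.2 i = z ∘ p.1 then h.choose else l0
  have hy : ∀ (z : K → Bool) (p : (L → K) × (L → L → Bool)), (∃ i, p.2 i = z ∘ p.1) → p.2 (y z p) = z ∘ p.1 := by
    intro z p h
    simp only [y, dif_pos h]
    exact h.choose_spec
  have hD : ∀ z : K → Bool, ∃ D : Ultrafilter L, (∀ g, ∀ᶠ c in (D : Filter L), Cl g c) ∧
      (∀ i, ∀ᶠ c in (D : Filter L), i < c) ∧
      ∀ p, ∀ᶠ c in (D : Filter L), H p (s c) = y z p := by
    intro z
    let S : ((L → L) × L) × Finset ((L → K) × (L → L → Bool)) → Set L := fun x =>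
      {c | x.1.2 < c ∧ Cl x.1.1 c ∧ ∀ p ∈ x.2, H p (s c) = y z p}
    have hne : (⨅ x, 𝓟 (S x)).NeBot := by
      apply iInf_neBot_of_directed
      · intro x x'
        refine ⟨((fun d => max (x.1.1 d) (x'.1.1 d), max x.1.2 x'.1.2), x.2 ∪ x'.2), ?_, ?_⟩
        · simp only [ge_iff_le, le_principal_iff, mem_principal]
          rintro c ⟨h1, h2, h3⟩
          exact ⟨(le_max_left _ _).trans_lt h1, Cl.mono (fun d => le_max_left _ _) h2,
            fun p hp => h3 p (Finset.mem_union_left _ hp)⟩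
        · simp only [ge_iff_le, le_principal_iff, mem_principal]
          rintro c ⟨h1, h2, h3⟩
          exact ⟨(le_max_right _ _).trans_lt h1, Cl.mono (fun d => le_max_right _ _) h2,
            fun p hp => h3 p (Finset.mem_union_right _ hp)⟩
      · intro x
        rw [principal_neBot_iff]
        obtain ⟨v, hv⟩ := hH x.2 (y z)
        obtain ⟨c, h1, h2, h3⟩ := hs v x.1.1 x.1.2
        exact ⟨c, h1, h2, fun p hp => by rw [h3]; exact hv p hp⟩
    have key : ∀ x, S x ∈ (Ultrafilter.of (⨅ x, 𝓟 (S x)) : Filter L) := fun x =>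
      Ultrafilter.of_le _ (mem_iInf_of_mem x (mem_principal_self _))
    refine ⟨Ultrafilter.of (⨅ x, 𝓟 (S x)), fun g => ?_, fun i => ?_, fun p => ?_⟩
    · exact mem_of_superset (key ((g, l0), ∅)) fun c hc => hc.2.1
    · exact mem_of_superset (key ((id, i), ∅)) fun c hc => hc.1
    · exact mem_of_superset (key ((id, l0), {p})) fun c hc => hc.2.2 p (by simp)
  choose D hD1 hD2 hD3 using hD
  refine ⟨D, hD1, hD2, ?_⟩
  intro a
  have hsep : ∀ i j : L, ∃ c : K, a i ≠ a j → a i c ≠ a j c := by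
    intro i j
    by_cases h : a i = a j
    · exact ⟨Classical.arbitrary K, fun h' => absurd h h'⟩
    · exact (Function.ne_iff.1 h).imp fun c hc _ => hc
  choose c hc using hsep
  have hLL : #L = #(L × L) := by
    rw [mk_prod, lift_id, mul_eq_self (aleph0_le_mk L)]
  obtain ⟨pr⟩ := Cardinal.eq.1 hLL
  let s0 : L → K := fun i => c (pr i).1 (pr i).2
  let p : (L → K) × (L → L → Bool) := (s0, fun i => a i ∘ s0)
  refine ⟨fun x => y x p, fun v => H p (s v), fun x => hD3 x p, ?_⟩
  rintro _ ⟨i, rfl⟩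
  have h1 := hy (a i) p ⟨i, rfl⟩
  by_contra hne
  have h2 := congrFun h1 (pr.symm (y (a i) p, i))
  simp only [p, s0, Function.comp, Equiv.apply_symm_apply] at h2
  exact hc _ _ hne h2

section Space
variable {L Z : Type} [LinearOrder L] [LinearOrder Z]

def IsLim (e : Z → L → Z) (z : Z) : Prop := Function.Injective (e z) ∧ ∀ c, e z c < z

def Alg (D : Z → Ultrafilter L) (e : Z → L → Z) : Set (Set Z) :=
  {U | ∀ z, IsLim e z → (z ∈ U ↔ ∀ᶠ c in (D z : Filter L), e z c ∈ U)}

inductive Desc (e : Z → L → Z) (C : Z → L → Prop) (z : Z) : Z → Prop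
  | base : Desc e C z z
  | step (x : Z) (c : L) : Desc e C z x → IsLim e x → C x c → Desc e C z (e x c)

inductive VSet (D : Z → Ultrafilter L) (e : Z → L → Z) (A : Set Z) (B : Z → Prop) : Z → Prop
  | base (x : Z) : x ∈ A → B x → VSet D e A B x
  | step (x : Z) (S : Set L) : x ∉ A → IsLim e x → S ∈ D x →
      (∀ c ∈ S, VSet D e A B (e x c)) → VSet D e A B x

def Good (a : L → Z) (e : Z → L → Z) (idx : Z → L) (h : L → L) (x : Z) (c : L) : Prop :=
  idx x < c ∧ h c = idx x ∧ ∀ j < c, ∀ d < c, e (a j) d ≠ e x c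

theorem enum_closed [Infinite L] (e : Z → L → Z) (z w : Z) :
    ∃ a : L → Z, z ∈ range a ∧ w ∈ range a ∧ ∀ x ∈ range a, ∀ c, e x c ∈ range a := by
  have hW : #(Bool × List L) ≤ #L := by
    rw [mk_prod, lift_id, lift_id, mk_list_eq_mk]
    refine (mul_le_mul_left ?_ _).trans (mul_eq_self (aleph0_le_mk L)).le
    simpa using (natCast_lt_aleph0 (n := 2)).le.trans (aleph0_le_mk L)
  obtain ⟨i⟩ := Cardinal.le_def _ _ |>.1 hW
  have hq := Function.invFun_surjective i.injective
  let q := Function.invFun i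
  let val : Bool × List L → Z := fun x => x.2.foldr (fun c y => e y c) (if x.1 then z else w)
  refine ⟨fun l => val (q l), ?_, ?_, ?_⟩
  · obtain ⟨l, hl⟩ := hq (true, [])
    exact ⟨l, by simp only [q, hl]; simp [val]⟩
  · obtain ⟨l, hl⟩ := hq (false, [])
    exact ⟨l, by simp only [q, hl]; simp [val]⟩
  · rintro _ ⟨l, rfl⟩ c
    obtain ⟨l', hl'⟩ := hq ((q l).1, c :: (q l).2)
    exact ⟨l', by simp only [q, hl']; simp [val]⟩

theorem sep_lt (hL : RegOrd L) (D : Z → Ultrafilter L) (e : Z → L → Z)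
    (h1 : ∀ z g, ∀ᶠ c in (D z : Filter L), Cl g c)
    (h2 : ∀ z i, ∀ᶠ c in (D z : Filter L), i < c)
    (h3 : ∀ a : L → Z, ∃ (idx : Z → L) (h : L → L),
        (∀ x, ∀ᶠ c in (D x : Filter L), h c = idx x) ∧ ∀ x ∈ range a, a (idx x) = x)
    (z w : Z) (hzw : z < w) : ∃ U ∈ Alg D e, z ∈ U ∧ w ∉ U := by
  classical
  have hinf : Infinite L := infinite_iff.2 hL.unc.le
  obtain ⟨l0⟩ : Nonempty L := inferInstance
  obtain ⟨a, haz, haw, hae⟩ := enum_closed e z w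
  obtain ⟨idx, h, hh, hidx⟩ := h3 a
  let C := Good a e idx h
  have hC : ∀ x, IsLim e x → ∀ᶠ c in (D x : Filter L), C x c := by
    intro x hx
    have : Nonempty L := ⟨l0⟩
    choose g hg using fun d => hL.iic2 d (fun j d' => Function.invFun (e x) (e (a j) d'))
    filter_upwards [h1 x g, h2 x (idx x), hh x] with c hc1 hc2 hc3
    refine ⟨hc2, hc3, ?_⟩
    intro j hj d hd heq
    have := hg (max j d) j (le_max_left _ _) d (le_max_right _ _)
    simp only [heq, Function.leftInverse_invFun hx.1 c] at this
    exact lt_asymm this (hc1 _ (max_lt hj hd))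
  have hdisj : ∀ x ∈ range a, ∀ x' ∈ range a, ∀ c c', C x c → C x' c' → e x c = e x' c' →
      x = x' := by
    intro x hx x' hx' c c' hc hc' heq
    rcases lt_trichotomy c c' with hlt | rfl | hlt
    · exfalso
      refine hc'.2.2 (idx x) (hc.1.trans hlt) c hlt ?_
      rw [hidx x hx, heq]
    · rw [← hidx x hx, ← hidx x' hx', ← hc.2.1, ← hc'.2.1]
    · exfalso
      refine hc.2.2 (idx x') (hc'.1.trans hlt) c' hlt ?_
      rw [hidx x' hx', heq]
  have hdesc : ∀ x, Desc e C z x → x ≤ z ∧ x ∈ range a := by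
    intro x hx
    induction hx with
    | base => exact ⟨le_rfl, haz⟩
    | step x c _ hl _ ih => exact ⟨(hl.2 c).le.trans ih.1, hae x ih.2 c⟩
  have hVA : ∀ x ∈ range a, (VSet D e (range a) (Desc e C z) x ↔ Desc e C z x) := by
    intro x hx
    constructor
    · intro hv
      cases hv with
      | base _ _ hb => exact hb
      | step _ S hn _ _ _ => exact absurd hx hn
    · exact fun hd => VSet.base x hx hd
  refine ⟨{x | VSet D e (range a) (Desc e C z) x}, ?_, ?_, ?_⟩
  · intro x hx
    simp only [mem_ofPred_eq]
    by_cases hxA : x ∈ range a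
    · simp only [hVA x hxA, hVA _ (hae x hxA _)]
      constructor
      · intro hd
        filter_upwards [hC x hx] with c hc
        exact Desc.step x c hd hx hc
      · intro hev
        by_contra hnd
        have hz : ∀ᶠ c in (D x : Filter L), e x c ≠ z := by
          by_cases hex : ∃ c0, e x c0 = z
          · obtain ⟨c0, hc0⟩ := hex
            filter_upwards [h2 x c0] with c hc heq
            exact hc.ne (hx.1 (hc0.trans heq.symm))
          · push Not at hex
            exact Eventually.of_forall hex
        obtain ⟨c, hc1, hc2, hc3⟩ := (hev.and (hz.and (hC x hx))).exists
        generalize hy : e x c = y at hc1 hc2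
        cases hc1 with
        | base => exact hc2 rfl
        | step x' c' hd' hl' hC' =>
          have := hdisj x hxA x' (hdesc x' hd').2 c c' hc3 hC' hy
          exact hnd (this ▸ hd')
    · constructor
      · intro hv
        cases hv with
        | base _ hA _ => exact absurd hA hxA
        | step _ S _ _ hS hall => exact mem_of_superset hS hall
      · intro hev
        exact VSet.step x _ hxA hx hev fun c hc => hc
  · exact (hVA z haz).2 Desc.base
  · intro hw
    exact absurd (hdesc w ((hVA w haw).1 hw)).1 (not_le.2 hzw)

theorem alg_compl (D : Z → Ultrafilter L) (e : Z → L → Z) {U : Set Z} (hU : U ∈ Alg D e) :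
    Uᶜ ∈ Alg D e := by
  intro z hz
  simp only [mem_compl_iff]
  rw [Ultrafilter.eventually_not, hU z hz]

theorem alg_inter (D : Z → Ultrafilter L) (e : Z → L → Z) {U V : Set Z} (hU : U ∈ Alg D e)
    (hV : V ∈ Alg D e) : U ∩ V ∈ Alg D e := by
  intro z hz
  simp only [mem_inter_iff, eventually_and]
  rw [hU z hz, hV z hz]

theorem alg_univ (D : Z → Ultrafilter L) (e : Z → L → Z) : Set.univ ∈ Alg D e := by
  intro z hz
  simp

theorem alg_basis (D : Z → Ultrafilter L) (e : Z → L → Z) :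
    @TopologicalSpace.IsTopologicalBasis Z (TopologicalSpace.generateFrom (Alg D e))
      (Alg D e) := by
  let := TopologicalSpace.generateFrom (Alg D e)
  refine ⟨?_, ?_, rfl⟩
  · intro U hU V hV x hx
    exact ⟨U ∩ V, alg_inter D e hU hV, hx, subset_rfl⟩
  · exact sUnion_eq_univ_iff.2 fun x => ⟨_, alg_univ D e, trivial⟩

theorem space (hL : RegOrd L) (D : Z → Ultrafilter L) (e : Z → L → Z)
    (h1 : ∀ z g, ∀ᶠ c in (D z : Filter L), Cl g c)
    (h2 : ∀ z i, ∀ᶠ c in (D z : Filter L), i < c)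
    (h3 : ∀ a : L → Z, ∃ (idx : Z → L) (h : L → L),
        (∀ x, ∀ᶠ c in (D x : Filter L), h c = idx x) ∧ ∀ x ∈ range a, a (idx x) = x)
    (he : ∀ e0 : L → Z, Function.Injective e0 → #Z ≤ #{z | e z = e0 ∧ IsLim e z}) :
    ∃ t : TopologicalSpace Z, @T2Space Z t ∧
      (∃ B : Set (Set Z),
        @TopologicalSpace.IsTopologicalBasis Z t B ∧ ∀ s ∈ B, @IsClopen Z t s) ∧
      ∀ Y : Set Z, @IsClosed Z t Y → #Y < #Z → #Y < #L := by
  let t := TopologicalSpace.generateFrom (Alg D e)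
  have hB : TopologicalSpace.IsTopologicalBasis (Alg D e) := alg_basis D e
  refine ⟨t, ?_, ⟨Alg D e, hB, ?_⟩, ?_⟩
  · refine ⟨fun x y hxy => ?_⟩
    rcases lt_or_gt_of_ne hxy with h | h
    · obtain ⟨U, hU, hx, hy⟩ := sep_lt hL D e h1 h2 h3 x y h
      exact ⟨U, Uᶜ, hB.isOpen hU, hB.isOpen (alg_compl D e hU), hx, hy, disjoint_compl_right⟩
    · obtain ⟨U, hU, hx, hy⟩ := sep_lt hL D e h1 h2 h3 y x h
      exact ⟨Uᶜ, U, hB.isOpen (alg_compl D e hU), hB.isOpen hU, hy, hx, disjoint_compl_left⟩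
  · intro s hs
    exact ⟨⟨hB.isOpen (alg_compl D e hs)⟩, hB.isOpen hs⟩
  · intro Y hY hlt
    by_contra hge
    push Not at hge
    obtain ⟨e0⟩ := Cardinal.le_def _ _ |>.1 hge
    have := he (fun c => (e0 c : Z)) (Subtype.val_injective.comp e0.injective)
    refine absurd hlt (not_lt.2 (this.trans (mk_le_mk_of_subset ?_)))
    rintro z ⟨hz1, hz2⟩
    rw [← hY.closure_eq, hB.mem_closure_iff]
    intro U hU hzU
    obtain ⟨c, hc⟩ := ((hU z hz2).1 hzU).exists
    exact ⟨e z c, hc, by rw [hz1]; exact (e0 c).2⟩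

end Space

theorem bd_of_lt_cof {X ι : Type} [LinearOrder X] (f : ι → X) (h : #ι < Order.cof X) :
    ∃ b, ∀ i, f i < b := by
  by_contra hcon
  push Not at hcon
  have hc : IsCofinal (range f) := by
    intro b
    obtain ⟨i, hi⟩ := hcon b
    exact ⟨f i, ⟨i, rfl⟩, hi⟩
  exact absurd ((Order.cof_le hc).trans mk_range_le) (not_le.2 h)

theorem iic_lt {X : Type} [LinearOrder X] [WellFoundedLT X] (hX : ℵ₀ ≤ #X)
    (h : (#X).ord = Ordinal.type ((· < ·) : X → X → Prop)) (i : X) : #(Set.Iic i) < #X := by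
  have h1 := mk_Iio_lt i h
  have h2 : Set.Iic i = insert i (Set.Iio i) := by
    ext x; simp [le_iff_eq_or_lt]
  rw [h2]
  refine mk_insert_le.trans_lt (add_lt_of_lt hX h1 (one_lt_aleph0.trans_le hX))

theorem exists_regOrd (l : Cardinal.{0}) (hreg : l.IsRegular) (hunc : ℵ₀ < l) :
    ∃ (L : Type) (_ : LinearOrder L) (_ : WellFoundedLT L), #L = l ∧ RegOrd L := by
  obtain ⟨o, w, h⟩ := exists_ord_eq_type_lt l.out
  have hl : #l.out = l := mk_out l
  refine ⟨l.out, o, w, hl, ?_, ?_, ?_⟩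
  · intro ι f hf
    refine bd_of_lt_cof f ?_
    rwa [← Ordinal.cof_type, ← h, hl, hreg.cof_ord, ← hl]
  · exact iic_lt (by rw [hl]; exact hunc.le) h
  · rw [hl]; exact hunc

theorem exists_e {L Z : Type} [LinearOrder L] [LinearOrder Z] [WellFoundedLT Z]
    (hZ : ℵ₀ ≤ #Z) (h : (#Z).ord = Ordinal.type ((· < ·) : Z → Z → Prop))
    (hcof : #L < Order.cof Z) (hpow : #Z ^ #L ≤ #Z) :
    ∃ e : Z → L → Z, ∀ e0 : L → Z, Function.Injective e0 →
      #Z ≤ #{z | e z = e0 ∧ IsLim e z} := by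
  have hq : #((L → Z) × Z) ≤ #Z := by
    rw [mk_prod, lift_id, lift_id, ← power_def]
    exact (mul_le_mul_left hpow _).trans (mul_eq_self hZ).le
  have hne : Nonempty Z := by
    exact mk_ne_zero_iff.1 (lt_of_lt_of_le aleph0_pos hZ).ne'
  obtain ⟨i⟩ := Cardinal.le_def _ _ |>.1 hq
  have hs : Function.LeftInverse (Function.invFun i) i := Function.leftInverse_invFun i.injective
  refine ⟨fun z => (Function.invFun i z).1, fun e0 he0 => ?_⟩
  obtain ⟨b, hb⟩ := bd_of_lt_cof e0 hcof
  set e : Z → L → Z := fun z => (Function.invFun i z).1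
  let T : Set Z := range fun y => i (e0, y)
  have hT : #Z ≤ #T := by
    refine (mk_range_eq (fun y => i (e0, y)) ?_).ge
    intro y y' hy
    exact congrArg Prod.snd (i.injective hy)
  have hTe : ∀ z ∈ T, e z = e0 := by
    rintro _ ⟨y, rfl⟩
    simp only [e, hs (e0, y)]
  by_contra hlt
  push Not at hlt
  have hsub : T ⊆ {z | e z = e0 ∧ IsLim e z} ∪ Set.Iic b := by
    intro z hz
    by_cases hzb : z ≤ b
    · exact Or.inr hzb
    · refine Or.inl ⟨hTe z hz, ?_, ?_⟩
      · rw [hTe z hz]; exact he0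
      · intro c
        rw [hTe z hz]
        exact (hb c).trans (not_le.1 hzb)
  have h1 := hT.trans ((mk_le_mk_of_subset hsub).trans (mk_union_le _ _))
  exact absurd h1 (not_le.2 (add_lt_of_lt hZ hlt (iic_lt hZ h b)))

/-- Let `λ` be a regular uncountable cardinal, `μ = 2^λ`, and `κ` least with `2^κ > μ`.
Then there is a Hausdorff space `X` with a clopen basis, `|X| = 2^κ`, such that every
closed subset `Y` with `|Y| < |X|` satisfies `|Y| < λ`. -/
theorem exists_space_regular_case (l m k : Cardinal)
    (hreg : l.IsRegular) (hunc : Cardinal.aleph0 < l)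
    (hm : m = (2 : Cardinal) ^ l)
    (hk1 : m < (2 : Cardinal) ^ k)
    (hk2 : ∀ k' : Cardinal, k' < k → (2 : Cardinal) ^ k' ≤ m) :
    ∃ (X : Type) (t : TopologicalSpace X),
      @T2Space X t ∧
      (∃ B : Set (Set X),
        @TopologicalSpace.IsTopologicalBasis X t B ∧ ∀ s ∈ B, @IsClopen X t s) ∧
      Cardinal.mk X = (2 : Cardinal) ^ k ∧
      ∀ Y : Set X, @IsClosed X t Y → Cardinal.mk ↥Y < Cardinal.mk X →
        Cardinal.mk ↥Y < l := by
  have hlk : l < k := by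
    by_contra hcon
    push Not at hcon
    rw [hm] at hk1
    exact absurd (power_le_power_left two_ne_zero hcon) (not_le.2 hk1)
  have hkm : k ≤ m := by
    by_contra hcon
    push Not at hcon
    exact absurd (hk2 m hcon) (not_le.2 (cantor m))
  have hk0 : ℵ₀ ≤ k := (hunc.trans hlk).le
  obtain ⟨L, oL, wL, hLl, hL⟩ := exists_regOrd l hreg hunc
  let K : Type := k.out
  have hK : #K = k := mk_out k
  have hKne : Nonempty K := mk_ne_zero_iff.1 (by rw [hK]; exact (aleph0_pos.trans_le hk0).ne')
  have hll : (2 ^ l : Cardinal) ^ l = 2 ^ l := by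
    rw [← power_mul, mul_eq_self hunc.le]
  have hP : #((L → K) × (L → L → Bool)) ≤ #(Set L) := by
    have h1 : #(L → K) = k ^ l := by rw [← power_def, hK, hLl]
    have h2 : #(L → L → Bool) = 2 ^ l := by
      rw [← power_def, ← power_def, hLl, mk_bool, hll]
    rw [mk_prod, lift_id, lift_id, mk_set, hLl, h1, h2]
    have h3 : k ^ l ≤ 2 ^ l := by
      rw [hm] at hkm
      exact (power_le_power_right hkm).trans hll.le
    refine (mul_le_mul_left h3 _).trans (mul_eq_self ?_).le
    exact hunc.le.trans (cantor l).le
  obtain ⟨D, h1, h2, h3⟩ := lemA hL hP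
  obtain ⟨oZ, wZ, hZ⟩ := exists_ord_eq_type_lt (K → Bool)
  have hZk : #(K → Bool) = 2 ^ k := by rw [← power_def, hK, mk_bool]
  have hZ0 : ℵ₀ ≤ #(K → Bool) := by rw [hZk]; exact hk0.trans (cantor k).le
  obtain ⟨e, he⟩ := exists_e (L := L) (Z := K → Bool) hZ0 hZ
    (by
      rw [← Ordinal.cof_type, ← hZ, hZk, hLl]
      exact hlk.trans (lt_cof_ord_power hk0 one_lt_two))
    (by rw [hZk, hLl, ← power_mul, mul_eq_left hk0 hlk.le (aleph0_pos.trans hunc).ne'])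
  obtain ⟨t, ht1, ht2, ht3⟩ := space hL D e h1 h2 h3 he
  refine ⟨K → Bool, t, ht1, ht2, hZk, ?_⟩
  rw [hLl] at ht3
  exact ht3
end

section
/- Let λ be a singular cardinal (i.e. an infinite cardinal with cf(λ) < λ), let μ = 2^λ, and let κ be the least cardinal such that 2^κ > μ. Then there exists a Hausdorff topological space X whose topology has a basis consisting of clopen sets, with |X| = 2^κ, such that every closed subset Y of X with |Y| < |X| satisfies |Y| < λ. -/
open Cardinal Set

namespace SingCase

local notation "Ω" τ => Cardinal.ord (Order.succ τ)

lemma cof_succ {τ : Cardinal.{0}} (hτ : ℵ₀ ≤ τ) : (Ω τ).cof = Order.succ τ :=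
  (isRegular_succ hτ).cof_ord

lemma add_one_lt {τ : Cardinal.{0}} (hτ : ℵ₀ ≤ τ) {o : Ordinal.{0}} (h : o < Ω τ) : o + 1 < Ω τ := by
  have := (isSuccLimit_ord (hτ.trans (Order.le_succ τ))).succ_lt h
  simpa using this

lemma sup_bd {τ : Cardinal.{0}} (hτ : ℵ₀ ≤ τ) {ι : Type} (hι : #ι ≤ τ) (f : ι → Ordinal.{0})
    (hf : ∀ i, f i < Ω τ) : ∃ b < Ω τ, ∀ i, f i < b := by
  refine ⟨(⨆ i, f i) + 1, add_one_lt hτ ?_, ?_⟩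
  · apply Ordinal.iSup_lt_of_lt_cof _ hf
    rw [cof_succ hτ]
    exact Order.lt_succ_of_le hι
  · intro i
    exact lt_of_le_of_lt (Ordinal.le_iSup f i) (by simp)

lemma card_le_of_lt {τ : Cardinal.{0}} {o : Ordinal.{0}} (h : o < Ω τ) : o.card ≤ τ :=
  Order.lt_succ_iff.1 (Cardinal.lt_ord.1 h)

/-- bound over an initial segment -/
lemma sup_bd_Iio {τ : Cardinal.{0}} (hτ : ℵ₀ ≤ τ) {o : Ordinal.{0}} (ho : o < Ω τ)
    (f : Ordinal.{0} → Ordinal.{0})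
    (hf : ∀ i < o, f i < Ω τ) : ∃ b < Ω τ, ∀ i < o, f i < b := by
  obtain ⟨b, hb, h⟩ := sup_bd hτ (ι := o.ToType) (by rw [mk_toType]; exact card_le_of_lt ho)
    (fun i => f (Ordinal.ToType.toOrd i)) (fun i => hf _ (Ordinal.ToType.toOrd i).2)
  refine ⟨b, hb, fun i hi => ?_⟩
  simpa using h (Ordinal.ToType.mk ⟨i, hi⟩)

def Cl (f : Ordinal.{0} → Ordinal.{0}) (γ : Ordinal.{0}) : Prop := ∀ ε < γ, f ε < γ

lemma exists_closed {τ : Cardinal.{0}} (hτ : ℵ₀ ≤ τ) (f : Ordinal.{0} → Ordinal.{0})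
    (hf : ∀ ε < Ω τ, f ε < Ω τ) {b : Ordinal.{0}} (hb : b < Ω τ) :
    ∃ γ, b ≤ γ ∧ γ < (Ω τ) ∧ Cl f γ := by
  have h1 : ∀ β : Iio (Ω τ), ∃ β' : Iio (Ω τ), β.1 ≤ β'.1 ∧ ∀ ε < β.1, f ε < β'.1 := by
    rintro ⟨β, hβ⟩
    obtain ⟨c, hc, h⟩ := sup_bd_Iio hτ hβ f (fun i hi => hf _ (hi.trans hβ))
    refine ⟨⟨max β c, max_lt hβ hc⟩, le_max_left _ _, fun ε hε => ?_⟩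
    exact (h ε hε).trans_le (le_max_right _ _)
  choose G hG1 hG2 using h1
  let s : ℕ → Iio (Ω τ) := fun n => Nat.rec ⟨b, hb⟩ (fun _ x => G x) n
  have hs : ∀ n, s (n+1) = G (s n) := fun n => rfl
  refine ⟨⨆ n, (s n).1, Ordinal.le_iSup (fun n => (s n).1) 0, ?_, ?_⟩
  · apply Ordinal.iSup_lt_of_lt_cof _ (fun n => (s n).2)
    rw [cof_succ hτ]
    simpa using Order.lt_succ_of_le hτ
  · intro ε hε
    obtain ⟨n, hn⟩ := (Ordinal.lt_iSup_iff).1 hε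
    have := hG2 (s n) ε hn
    rw [← hs] at this
    exact this.trans_le (Ordinal.le_iSup (fun n => (s n).1) (n+1))

def Stat (τ : Cardinal.{0}) (A : Set Ordinal.{0}) : Prop :=
  ∀ f : Ordinal.{0} → Ordinal.{0}, (∀ ε < Ω τ, f ε < Ω τ) → ∀ b < Ω τ,
    ∃ γ ∈ A, b ≤ γ ∧ γ < (Ω τ) ∧ Cl f γ

lemma ulam {τ : Cardinal.{0}} (hτ : ℵ₀ ≤ τ) (E : Type) [Nonempty E] (hE : #E ≤ τ) :
    ∃ h : Ordinal.{0} → E, ∀ q, Stat τ {γ | h γ = q} := by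
  classical
  have hinj : ∀ γ : Ordinal.{0}, ∃ e : Ordinal.{0} → τ.out, γ < (Ω τ) → InjOn e (Iio γ) := by
    intro γ
    by_cases hγ : γ < Ω τ
    · have : #γ.ToType ≤ #τ.out := by
        rw [mk_toType, mk_out]; exact card_le_of_lt hγ
      obtain ⟨g⟩ := this
      have hne : Nonempty τ.out := by
        rw [← mk_ne_zero_iff, mk_out]
        exact (aleph0_pos.trans_le hτ).ne'
      refine ⟨fun o => if h : o < γ then g (Ordinal.ToType.mk ⟨o, h⟩) else Classical.arbitrary _,
        fun _ a ha b hb hab => ?_⟩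
      simp only [mem_Iio] at ha hb
      have hab' := hab
      simp only [ha, hb, dif_pos] at hab'
      have h3 := Ordinal.ToType.mk.injective (g.injective hab')
      exact congrArg Subtype.val h3
    · have hne : Nonempty τ.out := by
        rw [← mk_ne_zero_iff, mk_out]
        exact (aleph0_pos.trans_le hτ).ne'
      exact ⟨fun _ => Classical.arbitrary _, fun h => absurd h hγ⟩
  choose e he using hinj
  have hst : ∀ α : (Ω τ).ToType, ∃ ξ : τ.out,
      Stat τ {γ | (Ordinal.ToType.toOrd α).1 < γ ∧ e γ (Ordinal.ToType.toOrd α).1 = ξ} := by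
    intro α
    by_contra hcon
    push Not at hcon
    simp only [Stat, not_forall] at hcon
    choose f hf b hb hno using hcon
    have h2 : ∀ ε : Ordinal.{0}, ∃ c, ε < (Ω τ) → c < (Ω τ) ∧ ∀ ξ, f ξ ε < c := by
      intro ε
      by_cases h : ε < Ω τ
      · obtain ⟨c, hc, h'⟩ := sup_bd hτ (ι := τ.out) (by simp) (fun ξ => f ξ ε)
          (fun ξ => hf ξ ε h)
        exact ⟨c, fun _ => ⟨hc, h'⟩⟩
      · exact ⟨0, fun h' => absurd h' h⟩
    choose F hF using h2
    obtain ⟨B, hB, hB'⟩ := sup_bd hτ (ι := τ.out) (by simp) b hb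
    have hα : (Ordinal.ToType.toOrd α).1 < Ω τ := (Ordinal.ToType.toOrd α).2
    obtain ⟨γ, hγ1, hγ2, hγ3⟩ := exists_closed hτ F (fun ε h => (hF ε h).1)
      (max_lt hB (add_one_lt hτ hα))
    apply hno (e γ (Ordinal.ToType.toOrd α).1)
    refine ⟨γ, ⟨?_, rfl⟩, ?_, hγ2, ?_⟩
    · exact lt_of_lt_of_le (by simp) ((le_max_right _ _).trans hγ1)
    · exact (hB' _).le.trans ((le_max_left _ _).trans hγ1)
    · intro ε hε
      exact ((hF ε (hε.trans hγ2)).2 _).trans (hγ3 ε hε)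
  choose ξ hξ using hst
  obtain ⟨x, hx⟩ := infinite_pigeonhole_card ξ (Order.succ τ) (by simp)
    (hτ.trans (Order.le_succ τ)) (by rw [cof_succ hτ, mk_out]; exact Order.lt_succ τ)
  obtain ⟨j⟩ : #E ≤ #(ξ ⁻¹' {x}) := hE.trans ((Order.le_succ τ).trans hx)
  let J : E → Ordinal.{0} := fun q => (Ordinal.ToType.toOrd (j q).1).1
  have hJ : Function.Injective J := by
    intro a b hab
    have h3 : Ordinal.ToType.toOrd (j a).1 = Ordinal.ToType.toOrd (j b).1 := Subtype.ext hab
    exact j.injective (Subtype.ext (by simpa using h3))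
  refine ⟨fun γ => if h : ∃ q, J q < γ ∧ e γ (J q) = x then h.choose else Classical.arbitrary _, ?_⟩
  intro q f hf b hb
  obtain ⟨γ, ⟨h1, h2⟩, h3, h4, h5⟩ := hξ (j q).1 f hf b hb
  refine ⟨γ, ?_, h3, h4, h5⟩
  have h2' : e γ (J q) = x := h2.trans (j q).2
  have hex : ∃ q, J q < γ ∧ e γ (J q) = x := ⟨q, h1, h2'⟩
  simp only [mem_ofPred_eq, hex, dif_pos]
  obtain ⟨h6, h7⟩ := hex.choose_spec
  exact hJ (he γ h4 h6 h1 (h7.trans h2'.symm))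

lemma stationary {τ : Cardinal.{0}} (hτ : ℵ₀ ≤ τ) :
    ∃ H : Set Ordinal.{0} → Ordinal.{0} → Ordinal.{0}, ∀ (ι : Type) (J : Finset ι)
      (t : ι → Set Ordinal.{0}) (val : ι → Ordinal.{0}),
      (∀ i ∈ J, ∀ i' ∈ J, i ≠ i' → ∃ c < τ.ord, ¬ (c ∈ t i ↔ c ∈ t i')) →
      (∀ i ∈ J, val i < τ.ord) →
      Stat τ {γ | ∀ i ∈ J, H (t i) γ = val i} := by
  classical
  let L := τ.ord.ToType
  have hL : #L = τ := by simp [L]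
  have : Infinite L := by rw [infinite_iff, hL]; exact hτ
  let E := Finset L × Finset (Finset L × L)
  have hE : #E ≤ τ := by
    simp only [E, mk_prod, lift_id, mk_finset_of_infinite, hL, mul_eq_self hτ, le_refl]
  obtain ⟨h, hh⟩ := ulam hτ E hE
  let tr : Set Ordinal.{0} → Finset L → Finset L := fun t F =>
    F.filter (fun a => (Ordinal.ToType.toOrd a).1 ∈ t)
  refine ⟨fun t γ => if hx : ∃ v, (tr t (h γ).1, v) ∈ (h γ).2 then
    (Ordinal.ToType.toOrd hx.choose).1 else 0, ?_⟩
  intro ι J t val hd hv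
  choose! c hc1 hc2 using hd
  let F : Finset L := (J ×ˢ J).image (fun p : ι × ι =>
    if hp : c p.1 p.2 < τ.ord then Ordinal.ToType.mk ⟨c p.1 p.2, hp⟩ else Classical.arbitrary L)
  let V : ι → L := fun i =>
    if hp : val i < τ.ord then Ordinal.ToType.mk ⟨val i, hp⟩ else Classical.arbitrary L
  have hF : ∀ i ∈ J, ∀ i' ∈ J, tr (t i) F = tr (t i') F → i = i' := by
    intro i hi i' hi' heq
    by_contra hne
    have h1 := hc1 i hi i' hi' hne
    have h2 := hc2 i hi i' hi' hne
    have hm : Ordinal.ToType.mk ⟨c i i', h1⟩ ∈ F := by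
      simp only [F, Finset.mem_image, Finset.mem_product]
      exact ⟨(i, i'), ⟨hi, hi'⟩, by simp [h1]⟩
    have := Finset.ext_iff.1 heq (Ordinal.ToType.mk ⟨c i i', h1⟩)
    simp only [tr, Finset.mem_filter, hm, true_and] at this
    apply h2
    simpa using this
  have := hh (F, J.image (fun i => (tr (t i) F, V i)))
  intro f hf b hb
  obtain ⟨γ, h1, h2⟩ := this f hf b hb
  refine ⟨γ, ?_, h2⟩
  simp only [mem_ofPred_eq] at h1 ⊢
  intro i hi
  rw [h1]
  have hex : ∃ v, (tr (t i) F, v) ∈ J.image (fun i => (tr (t i) F, V i)) :=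
    ⟨V i, Finset.mem_image_of_mem _ hi⟩
  rw [dif_pos hex]
  have hs := hex.choose_spec
  obtain ⟨i', hi', heq⟩ := Finset.mem_image.1 hs
  rw [Prod.ext_iff] at heq
  simp only at heq
  have := hF i' hi' i hi heq.1
  subst this
  rw [← heq.2]
  simp [V, hv i' hi]



lemma exists_surj {A B : Type} [Nonempty A] (h : #A ≤ #B) : ∃ f : B → A, Function.Surjective f := by
  obtain ⟨g⟩ := h
  exact ⟨Function.invFun g, Function.invFun_surjective g.injective⟩

lemma codes (l : Cardinal.{0}) (hl : ℵ₀ ≤ l) (K : Type) [Nonempty K] (hK : #K ≤ 2 ^ l) :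
    ∃ (I : Type) (FI : I → Cardinal.{0} → Ordinal.{0} → Ordinal.{0}) (code : I → Set Ordinal.{0})
      (v : (K → Bool) → I → Ordinal.{0}),
      (∀ x i, v x i < l.ord) ∧
      (∀ i i', i ≠ i' → ∃ c < l.ord, ¬ (c ∈ code i ↔ c ∈ code i')) ∧
      ∀ u : Set (K → Bool), #u ≤ l → ∃ w : (K → Bool) → Ordinal.{0}, InjOn w u ∧
        (∀ x, w x < l.ord) ∧
        ∀ F : Cardinal.{0} → Ordinal.{0} → Ordinal.{0},
          (∀ τ < l, ∀ ε < Ω τ, F τ ε < l.ord) →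
          ∃ i, (∀ x, v x i = w x) ∧ ∀ τ < l, ∀ ε < Ω τ, FI i τ ε = F τ ε := by
  classical
  let L := l.ord.ToType
  have hL : #L = l := by simp [L]
  have : Infinite L := by rw [infinite_iff, hL]; exact hl
  have h0 : 0 < l.ord := by
    rw [Cardinal.lt_ord]; simpa using aleph0_pos.trans_le hl
  have hll : l * l = l := mul_eq_self hl
  let I := (L → K) × (L → L → Bool) × (L → L → L)
  have hI : #I ≤ #(Set L) := by
    have h2 : (2 ^ l : Cardinal.{0}) ^ l = 2 ^ l := by rw [← power_mul, hll]
    have e1 : #(L → K) ≤ 2 ^ l := by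
      rw [← power_def, hL, ← h2]
      exact power_le_power_right hK
    have e2 : #(L → L → Bool) ≤ 2 ^ l := by
      rw [← power_def, ← power_def, hL, mk_bool, h2]
    have e3 : #(L → L → L) ≤ 2 ^ l := by
      rw [← power_def, ← power_def, hL, ← power_mul, hll]
      exact (power_le_power_right (cantor l).le).trans h2.le
    rw [mk_set, hL]
    simp only [I, mk_prod, lift_id]
    have hinf : ℵ₀ ≤ (2 : Cardinal.{0}) ^ l := hl.trans (cantor l).le
    calc _ ≤ (2 ^ l : Cardinal.{0}) * (2 ^ l * 2 ^ l) := by gcongr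
      _ = 2 ^ l := by rw [mul_eq_self hinf, mul_eq_self hinf]
  obtain ⟨inj⟩ := hI
  refine ⟨I, fun i τ ε => if h : τ.ord < l.ord ∧ ε < l.ord then
      (Ordinal.ToType.toOrd (i.2.2 (Ordinal.ToType.mk ⟨τ.ord, h.1⟩) (Ordinal.ToType.mk ⟨ε, h.2⟩))).1
      else 0,
    fun i => (fun a => (Ordinal.ToType.toOrd a).1) '' (inj i),
    fun x i => if h : ∃ j, i.2.1 j = x ∘ i.1 then (Ordinal.ToType.toOrd h.choose).1 else 0, ?_, ?_, ?_⟩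
  · intro x i
    dsimp only
    split_ifs with h
    · exact (Ordinal.ToType.toOrd h.choose).2
    · exact h0
  · intro i i' hne
    have : inj i ≠ inj i' := fun h => hne (inj.injective h)
    have : ∃ a, ¬ (a ∈ inj i ↔ a ∈ inj i') := by
      by_contra hcon
      push Not at hcon
      exact this (Set.ext (fun a => hcon a))
    obtain ⟨a, ha⟩ := this
    have hto : Function.Injective (fun a : L => (Ordinal.ToType.toOrd a).1) := by
      intro a b hab
      have h3 : Ordinal.ToType.toOrd a = Ordinal.ToType.toOrd b := Subtype.ext hab
      simpa using h3
    refine ⟨(Ordinal.ToType.toOrd a).1, (Ordinal.ToType.toOrd a).2, ?_⟩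
    rw [hto.mem_set_image (s := inj i) (a := a), hto.mem_set_image (s := inj i') (a := a)]
    exact ha
  · intro u hu
    have hd : ∀ p : u × u, ∃ a : K, p.1 ≠ p.2 → p.1.1 a ≠ p.2.1 a := by
      rintro ⟨⟨x, hx⟩, ⟨y, hy⟩⟩
      by_cases h : x = y
      · exact ⟨Classical.arbitrary K, fun h' => absurd (Subtype.ext h) h'⟩
      · obtain ⟨a, ha⟩ := Function.ne_iff.1 h
        exact ⟨a, fun _ => ha⟩
    choose d hd using hd
    have c1 : #(Option (u × u)) ≤ #L := by
      rw [mk_option, mk_prod, lift_id, hL]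
      calc #u * #u + 1 ≤ l * l + 1 := by gcongr
        _ ≤ l := by rw [hll]; exact (add_one_eq hl).le
    have c2 : #(Option u) ≤ #L := by
      rw [mk_option, hL]
      calc #u + 1 ≤ l + 1 := by gcongr
        _ ≤ l := (add_one_eq hl).le
    obtain ⟨s1, hs1⟩ := exists_surj c1
    obtain ⟨s2, hs2⟩ := exists_surj c2
    let c : L → K := fun j => (s1 j).elim (Classical.arbitrary K) d
    let g : L → L → Bool := fun j => (s2 j).elim (fun _ => true) (fun x => x.1 ∘ c)
    refine ⟨fun x => if h : ∃ j, g j = x ∘ c then (Ordinal.ToType.toOrd h.choose).1 else 0,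
      ?_, ?_, ?_⟩
    · intro x hx y hy hxy
      have ex : ∀ x ∈ u, ∃ j, g j = x ∘ c := by
        intro x hx
        obtain ⟨j, hj⟩ := hs2 (some ⟨x, hx⟩)
        exact ⟨j, by simp [g, hj]⟩
      simp only [ex x hx, ex y hy, dif_pos] at hxy
      have h3 : (ex x hx).choose = (ex y hy).choose := by
        have := Subtype.ext hxy
        simpa using this
      have h4 : x ∘ c = y ∘ c := by
        rw [← (ex x hx).choose_spec, ← (ex y hy).choose_spec, h3]
      by_contra hne
      obtain ⟨j, hj⟩ := hs1 (some (⟨x, hx⟩, ⟨y, hy⟩))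
      have h5 := hd (⟨x, hx⟩, ⟨y, hy⟩) (fun h => hne (congrArg Subtype.val h))
      apply h5
      have := congrFun h4 j
      simpa [c, hj] using this
    · intro x
      dsimp only
      split_ifs with h
      · exact (Ordinal.ToType.toOrd h.choose).2
      · exact h0
    · intro F hF
      have hlt : ∀ τ < l, ∀ ε < Ω τ, ε < l.ord := by
        intro τ hτ ε hε
        exact hε.trans_le (ord_le_ord.2 (Order.succ_le_of_lt hτ))
      let G : L → L → L := fun a b =>
        if h : F (Ordinal.ToType.toOrd a).1.card (Ordinal.ToType.toOrd b).1 < l.ord then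
          Ordinal.ToType.mk ⟨_, h⟩ else Classical.arbitrary L
      refine ⟨(c, g, G), fun x => rfl, ?_⟩
      intro τ hτ ε hε
      have h1 : τ.ord < l.ord := ord_lt_ord.2 hτ
      have h2 := hlt τ hτ ε hε
      have h3 := hF τ hτ ε hε
      simp [h1, h2, h3, G]



structure Dat where
  X : Type
  l : Cardinal.{0}
  hl : ℵ₀ < l
  lim : ∀ τ < l, Order.succ τ < l
  rk : X → Ordinal.{0}
  I : Type
  FI : I → Cardinal.{0} → Ordinal.{0} → Ordinal.{0}
  code : I → Set Ordinal.{0}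
  v : X → I → Ordinal.{0}
  hv : ∀ x i, v x i < l.ord
  hcode : ∀ i i', i ≠ i' → ∃ c < l.ord, ¬ (c ∈ code i ↔ c ∈ code i')
  hcodes : ∀ u : Set X, #u ≤ l → ∃ w : X → Ordinal.{0}, InjOn w u ∧
        (∀ x, w x < l.ord) ∧
        ∀ F : Cardinal.{0} → Ordinal.{0} → Ordinal.{0},
          (∀ τ < l, ∀ ε < Ω τ, F τ ε < l.ord) →
          ∃ i, (∀ x, v x i = w x) ∧ ∀ τ < l, ∀ ε < Ω τ, FI i τ ε = F τ ε
  H : Cardinal.{0} → Set Ordinal.{0} → Ordinal.{0} → Ordinal.{0}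
  hH : ∀ τ, ℵ₀ ≤ τ → ∀ (ι : Type) (J : Finset ι)
      (t : ι → Set Ordinal.{0}) (val : ι → Ordinal.{0}),
      (∀ i ∈ J, ∀ i' ∈ J, i ≠ i' → ∃ c < τ.ord, ¬ (c ∈ t i ↔ c ∈ t i')) →
      (∀ i ∈ J, val i < τ.ord) →
      Stat τ {γ | ∀ i ∈ J, H τ (t i) γ = val i}

namespace Dat

def Good (d : Dat) (e : Ordinal.{0} → d.X) : Prop :=
  ∀ a b, a < b → b < d.l.ord → d.rk (e a) < d.rk (e b)

lemma Om_lt (d : Dat) {τ : Cardinal.{0}} (h : τ < d.l) : (Ω τ) < d.l.ord :=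
  ord_lt_ord.2 (d.lim τ h)

noncomputable def del (d : Dat) (e : Ordinal.{0} → d.X) (τ : Cardinal.{0}) : Ordinal.{0} :=
  sInf {δ | ∀ ε < Ω τ, d.rk (e ε) < δ}

variable {d : Dat} {e : Ordinal.{0} → d.X} {τ : Cardinal.{0}}

lemma rk_lt_del (he : d.Good e) (hτ : τ < d.l) {ε : Ordinal.{0}} (hε : ε < Ω τ) :
    d.rk (e ε) < d.del e τ := by
  have hne : {δ | ∀ ε < Ω τ, d.rk (e ε) < δ}.Nonempty :=
    ⟨d.rk (e (Ω τ)), fun ε h => he _ _ h (d.Om_lt hτ)⟩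
  exact csInf_mem hne ε hε

lemma lt_del {z : Ordinal.{0}} (h : z < d.del e τ) : ∃ ε < Ω τ, z ≤ d.rk (e ε) := by
  have := notMem_of_lt_csInf h (OrderBot.bddBelow _)
  by_contra hcon
  push Not at hcon
  exact this hcon

def IsPos (τ : Cardinal.{0}) (δ : Ordinal.{0}) (p : Ordinal.{0} → Ordinal.{0}) : Prop :=
  (∀ z < δ, p z < Ω τ) ∧ (∀ z z', z ≤ z' → z' < δ → p z ≤ p z') ∧ ∀ ε < Ω τ, ∃ z < δ, ε ≤ p z

open Classical in
noncomputable def pos (τ : Cardinal.{0}) (δ : Ordinal.{0}) : Ordinal.{0} → Ordinal.{0} :=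
  if h : ∃ p, IsPos τ δ p then h.choose else fun _ => 0

lemma isPos (he : d.Good e) (hτ : τ < d.l) : IsPos τ (d.del e τ) (pos τ (d.del e τ)) := by
  have h : ∃ p, IsPos τ (d.del e τ) p := by
    refine ⟨fun z => sInf {ε | z ≤ d.rk (e ε)}, ?_, ?_, ?_⟩
    · intro z hz
      obtain ⟨ε, h1, h2⟩ := lt_del hz
      exact (csInf_le' (show ε ∈ {ε | z ≤ d.rk (e ε)} from h2)).trans_lt h1
    · intro z z' hzz hz
      obtain ⟨ε, h1, h2⟩ := lt_del hz
      exact csInf_le_csInf (OrderBot.bddBelow _) ⟨ε, h2⟩ (fun a ha => hzz.trans ha)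
    · intro ε hε
      refine ⟨d.rk (e ε), rk_lt_del he hτ hε, ?_⟩
      have hm : sInf {ε' | d.rk (e ε) ≤ d.rk (e ε')} ∈ {ε' | d.rk (e ε) ≤ d.rk (e ε')} :=
        csInf_mem ⟨ε, (le_refl (d.rk (e ε)) : d.rk (e ε) ≤ d.rk (e ε))⟩
      by_contra hcon
      push Not at hcon
      exact absurd (he _ _ hcon (hε.trans (d.Om_lt hτ))) (not_lt.2 hm)
  rw [pos, dif_pos h]
  exact h.choose_spec

/-- position of a point -/
noncomputable def pp (d : Dat) (e : Ordinal.{0} → d.X) (τ : Cardinal.{0}) (y : d.X) : Ordinal.{0} :=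
  pos τ (d.del e τ) (d.rk y)

noncomputable def fe (d : Dat) (e : Ordinal.{0} → d.X) (τ : Cardinal.{0}) (γ : Ordinal.{0}) :
    Ordinal.{0} :=
  sInf {o | ∃ ε' < Ω τ, γ ≤ d.pp e τ (e ε') ∧ o = d.pp e τ (e ε')}

lemma fe_spec (he : d.Good e) (hτ : τ < d.l) {γ : Ordinal.{0}} (hγ : γ < Ω τ) :
    ∃ ε' < Ω τ, γ ≤ d.pp e τ (e ε') ∧ d.fe e τ γ = d.pp e τ (e ε') := by
  have hp := isPos he hτ
  have hne : {o | ∃ ε' < Ω τ, γ ≤ d.pp e τ (e ε') ∧ o = d.pp e τ (e ε')}.Nonempty := by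
    obtain ⟨z, hz, h⟩ := hp.2.2 γ hγ
    obtain ⟨ε', h1, h2⟩ := lt_del hz
    exact ⟨_, ε', h1, h.trans (hp.2.1 _ _ h2 (rk_lt_del he hτ h1)), rfl⟩
  exact csInf_mem hne

lemma pp_lt (he : d.Good e) (hτ : τ < d.l) {ε : Ordinal.{0}} (hε : ε < Ω τ) :
    d.pp e τ (e ε) < Ω τ := (isPos he hτ).1 _ (rk_lt_del he hτ hε)

lemma pp_mono (he : d.Good e) (hτ : τ < d.l) {ε ε' : Ordinal.{0}} (h : ε < ε') (hε : ε' < Ω τ) :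
    d.pp e τ (e ε) ≤ d.pp e τ (e ε') :=
  (isPos he hτ).2.1 _ _ (he _ _ h (hε.trans (d.Om_lt hτ))).le (rk_lt_del he hτ hε)

lemma fe_lt (he : d.Good e) (hτ : τ < d.l) {γ : Ordinal.{0}} (hγ : γ < Ω τ) :
    d.fe e τ γ < Ω τ := by
  obtain ⟨ε', h1, h2, h3⟩ := fe_spec he hτ hγ
  rw [h3]
  exact pp_lt he hτ h1

noncomputable def clo (f : Ordinal.{0} → Ordinal.{0}) (z : Ordinal.{0}) : Ordinal.{0} :=
  sSup {γ | γ ≤ z ∧ Cl f γ}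

lemma clo_eq {f : Ordinal.{0} → Ordinal.{0}} {γ z : Ordinal.{0}} (h1 : γ ≤ z) (h2 : z ≤ f γ)
    (h3 : Cl f γ) : clo f z = γ := by
  apply IsGreatest.csSup_eq
  refine ⟨⟨h1, h3⟩, ?_⟩
  rintro γ' ⟨h4, h5⟩
  by_contra hcon
  push Not at hcon
  exact absurd ((h5 γ hcon).trans_le h4) (not_lt.2 h2)

def cond (d : Dat) (e : Ordinal.{0} → d.X) (x : d.X) (τ : Cardinal.{0}) (i : d.I) (y : d.X) : Prop :=
  d.H τ (d.code i) (clo (d.FI i τ) (d.pp e τ y)) = d.v x i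

def rel (d : Dat) (e : Ordinal.{0} → d.X) (i : d.I) : Prop :=
  ∃ τ0 < d.l, ∀ τ, τ0 ≤ τ → τ < d.l → ℵ₀ ≤ τ → ∀ ε < Ω τ,
    d.fe e τ ε ≤ d.FI i τ ε ∧ d.FI i τ ε < Ω τ

def bas (d : Dat) (e : Ordinal.{0} → d.X) (x : d.X) (τ0 : Cardinal.{0})
    (g : Cardinal.{0} → Ordinal.{0}) (J : Finset d.I) : Set d.X :=
  {y | ∃ τ ε, ℵ₀ ≤ τ ∧ τ0 ≤ τ ∧ τ < d.l ∧ g τ ≤ ε ∧ ε < (Ω τ) ∧ y = e ε ∧ ∀ i ∈ J, d.cond e x τ i y}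

lemma fin_bd {l : Cardinal.{0}} (hl : ℵ₀ ≤ l) {ι : Type} (J : Finset ι) (P : ι → Cardinal.{0} → Prop)
    (h : ∀ i ∈ J, ∃ τ0 < l, ∀ τ, τ0 ≤ τ → τ < l → P i τ) :
    ∃ τ0 < l, ∀ τ, τ0 ≤ τ → τ < l → ∀ i ∈ J, P i τ := by
  classical
  induction J using Finset.induction_on with
  | empty => exact ⟨0, aleph0_pos.trans_le hl, by simp⟩
  | insert a s ha ih =>
    obtain ⟨t1, h1, h2⟩ := ih (fun i hi => h i (Finset.mem_insert_of_mem hi))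
    obtain ⟨t2, h3, h4⟩ := h a (Finset.mem_insert_self _ _)
    refine ⟨max t1 t2, max_lt h1 h3, fun τ hτ hτ' i hi => ?_⟩
    rcases Finset.mem_insert.1 hi with rfl | hi
    · exact h4 τ ((le_max_right _ _).trans hτ) hτ'
    · exact h2 τ ((le_max_left _ _).trans hτ) hτ' i hi

lemma ord_bd {l : Cardinal.{0}} {o : Ordinal.{0}} (ho : o < l.ord)
    (lim : ∀ τ < l, Order.succ τ < l) :
    ∃ τ0 < l, ∀ τ, τ0 ≤ τ → τ < l → o < τ.ord := by
  refine ⟨Order.succ o.card, lim _ (Cardinal.lt_ord.1 ho), fun τ h _ => ?_⟩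
  rw [Cardinal.lt_ord]
  exact (Order.lt_succ _).trans_le h

lemma bas_nonempty (he : d.Good e) (x : d.X) {τ0 : Cardinal.{0}} (h0 : τ0 < d.l)
    {g : Cardinal.{0} → Ordinal.{0}} (hg : ∀ τ, g τ < Ω τ) {J : Finset d.I}
    (hJ : ∀ i ∈ J, d.rel e i) : (d.bas e x τ0 g J).Nonempty := by
  obtain ⟨t1, h1, h1'⟩ := fin_bd d.hl.le J (fun i τ => ℵ₀ ≤ τ → ∀ ε < Ω τ,
    d.fe e τ ε ≤ d.FI i τ ε ∧ d.FI i τ ε < Ω τ) hJ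
  obtain ⟨t2, h2, h2'⟩ := fin_bd d.hl.le J (fun i τ => d.v x i < τ.ord)
    (fun i _ => ord_bd (d.hv x i) d.lim)
  obtain ⟨t3, h3, h3'⟩ := fin_bd d.hl.le J (fun i τ => ∀ i' ∈ J, i ≠ i' →
      ∃ c < τ.ord, ¬ (c ∈ d.code i ↔ c ∈ d.code i'))
    (fun i _ => fin_bd d.hl.le J (fun i' τ => i ≠ i' →
      ∃ c < τ.ord, ¬ (c ∈ d.code i ↔ c ∈ d.code i')) (fun i' _ => by
        by_cases h : i = i'
        · exact ⟨0, aleph0_pos.trans d.hl, fun _ _ _ h' => absurd h h'⟩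
        · obtain ⟨c, hc, hc'⟩ := d.hcode i i' h
          obtain ⟨t, ht, ht'⟩ := ord_bd hc d.lim
          exact ⟨t, ht, fun τ a b _ => ⟨c, ht' τ a b, hc'⟩⟩))
  obtain ⟨τ, hτ, hτ0, hτ1, hτ2, hτ3, hτ4⟩ : ∃ τ < d.l, ℵ₀ ≤ τ ∧ τ0 ≤ τ ∧ t1 ≤ τ ∧ t2 ≤ τ ∧ t3 ≤ τ :=
    ⟨max ℵ₀ (max τ0 (max t1 (max t2 t3))), by simp [d.hl, h0, h1, h2, h3], by simp, by simp,
      by simp, by simp, by simp⟩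
  have h1' := fun i hi => h1' τ hτ2 hτ i hi hτ0
  have h2' := h2' τ hτ3 hτ
  have h3' := h3' τ hτ4 hτ
  have hpos : (⊥ : Ordinal.{0}) < Ω τ := bot_le.trans_lt (hg τ)
  obtain ⟨γ, hγ1, hγ2, hγ3, hγ4⟩ := d.hH τ hτ0 d.I J d.code (d.v x) h3' h2'
    (fun ε => J.sup (fun i => d.FI i τ ε))
    (fun ε hε => (Finset.sup_lt_iff hpos).2 (fun i hi => (h1' i hi ε hε).2))
    (d.pp e τ (e (g τ)) + 1) (add_one_lt hτ0 (pp_lt he hτ (hg τ)))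
  obtain ⟨ε', hε1, hε2, hε3⟩ := fe_spec he hτ hγ3
  refine ⟨e ε', τ, ε', hτ0, hτ1, hτ, ?_, hε1, rfl, fun i hi => ?_⟩
  · by_contra hcon
    push Not at hcon
    have h4 := pp_mono he hτ hcon (hg τ)
    have h5 := (hγ2.trans hε2).trans h4
    exact absurd h5 (by simp)
  · have hcl : Cl (d.FI i τ) γ := fun ε hε =>
      (Finset.le_sup (f := fun i => d.FI i τ ε) hi).trans_lt (hγ4 ε hε)
    have := clo_eq hε2 (hε3 ▸ (h1' i hi γ hγ3).1) hcl
    rw [cond, this]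
    exact hγ1 i hi

def filt (d : Dat) (e : Ordinal.{0} → d.X) (x : d.X) : Filter d.X where
  sets := {S | ∃ τ0 < d.l, ∃ g : Cardinal.{0} → Ordinal.{0}, (∀ τ, g τ < Ω τ) ∧ ∃ J : Finset d.I,
    (∀ i ∈ J, d.rel e i) ∧ d.bas e x τ0 g J ⊆ S}
  univ_sets := ⟨0, aleph0_pos.trans d.hl, fun _ => 0, fun τ => by
    rw [Cardinal.lt_ord]; simp, ∅, by simp, subset_univ _⟩
  sets_of_superset := by
    rintro S T ⟨t, ht, g, hg, J, hJ, h⟩ hST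
    exact ⟨t, ht, g, hg, J, hJ, h.trans hST⟩
  inter_sets := by
    classical
    rintro S T ⟨t, ht, g, hg, J, hJ, h⟩ ⟨t', ht', g', hg', J', hJ', h'⟩
    refine ⟨max t t', max_lt ht ht', fun τ => max (g τ) (g' τ), fun τ => max_lt (hg τ) (hg' τ),
      J ∪ J', ?_, ?_⟩
    · intro i hi
      rcases Finset.mem_union.1 hi with hi | hi
      · exact hJ i hi
      · exact hJ' i hi
    · rintro y ⟨τ, ε, h1, h2, h3, h4, h5, h6, h7⟩
      refine ⟨h ⟨τ, ε, h1, (le_max_left _ _).trans h2, h3, (le_max_left _ _).trans h4, h5, h6,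
        fun i hi => h7 i (Finset.mem_union_left _ hi)⟩, h' ⟨τ, ε, h1, (le_max_right _ _).trans h2,
          h3, (le_max_right _ _).trans h4, h5, h6, fun i hi => h7 i (Finset.mem_union_right _ hi)⟩⟩

lemma mem_filt {S : Set d.X} {x : d.X} : S ∈ d.filt e x ↔
    ∃ τ0 < d.l, ∃ g : Cardinal.{0} → Ordinal.{0}, (∀ τ, g τ < Ω τ) ∧ ∃ J : Finset d.I,
    (∀ i ∈ J, d.rel e i) ∧ d.bas e x τ0 g J ⊆ S := Iff.rfl

open Classical in
noncomputable def D (d : Dat) (e : Ordinal.{0} → d.X) (x : d.X) : Ultrafilter d.X :=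
  if h : (d.filt e x).NeBot then @Ultrafilter.of _ (d.filt e x) h else pure x

lemma D_le (he : d.Good e) (x : d.X) : (d.D e x : Filter d.X) ≤ d.filt e x := by
  have h : (d.filt e x).NeBot := by
    rw [← Filter.forall_mem_nonempty_iff_neBot]
    rintro S ⟨t, ht, g, hg, J, hJ, h⟩
    exact (bas_nonempty he x ht hg hJ).mono h
  rw [D, dif_pos h]
  exact Ultrafilter.of_le _

lemma zero_lt_Om (τ : Cardinal.{0}) : 0 < Ω τ := by
  rw [Cardinal.lt_ord]; simp

lemma range_mem (he : d.Good e) (x : d.X) : e '' Iio d.l.ord ∈ d.D e x := by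
  apply D_le he x
  refine ⟨0, aleph0_pos.trans d.hl, fun _ => 0, zero_lt_Om, ∅, by simp, ?_⟩
  rintro y ⟨τ, ε, h1, h2, h3, h4, h5, h6, h7⟩
  exact ⟨ε, h5.trans (d.Om_lt h3), h6.symm⟩

lemma Good.inj (he : d.Good e) {a b : Ordinal.{0}} (ha : a < d.l.ord) (hb : b < d.l.ord)
    (h : e a = e b) : a = b := by
  rcases lt_trichotomy a b with h1 | h1 | h1
  · exact absurd (he _ _ h1 hb) (by rw [h]; exact lt_irrefl _)
  · exact h1
  · exact absurd (he _ _ h1 ha) (by rw [h]; exact lt_irrefl _)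

lemma avoid (he : d.Good e) (hτ0 : ℵ₀ ≤ τ) (hτ : τ < d.l) (a : d.X) :
    ∃ g < Ω τ, ∀ ε, g ≤ ε → ε < (Ω τ) → e ε ≠ a := by
  by_cases h : ∃ ε < Ω τ, e ε = a
  · obtain ⟨ε, h1, h2⟩ := h
    refine ⟨ε + 1, add_one_lt hτ0 h1, fun ε' h3 h4 h5 => ?_⟩
    have := he.inj (h4.trans (d.Om_lt hτ)) (h1.trans (d.Om_lt hτ)) (h5.trans h2.symm)
    subst this
    exact absurd h3 (by simp)
  · push Not at h
    exact ⟨0, zero_lt_Om τ, fun ε _ h' => h ε h'⟩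

lemma singleton_notMem (he : d.Good e) (x a : d.X) : {a} ∉ d.D e x := by
  rw [← Ultrafilter.compl_mem_iff_notMem]
  apply D_le he x
  have hg : ∀ τ : Cardinal.{0}, ∃ g < Ω τ, ℵ₀ ≤ τ → τ < d.l → ∀ ε, g ≤ ε → ε < (Ω τ) → e ε ≠ a := by
    intro τ
    by_cases h : ℵ₀ ≤ τ ∧ τ < d.l
    · obtain ⟨g, h1, h2⟩ := avoid he h.1 h.2 a
      exact ⟨g, h1, fun _ _ => h2⟩
    · exact ⟨0, zero_lt_Om τ, fun h1 h2 => absurd ⟨h1, h2⟩ h⟩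
  choose g hg1 hg2 using hg
  refine ⟨0, aleph0_pos.trans d.hl, g, hg1, ∅, by simp, ?_⟩
  rintro y ⟨τ, ε, h1, h2, h3, h4, h5, h6, h7⟩
  rw [h6]
  exact hg2 τ h1 h3 ε h4 h5

lemma core (u : Set d.X) (hu : #u ≤ d.l) (e : d.X → Ordinal.{0} → d.X)
    (he : ∀ η ∈ u, d.Good (e η)) :
    ∃ B : d.X → Set d.X, (∀ η ∈ u, B η ∈ d.D (e η) η ∧ B η ⊆ e η '' Iio d.l.ord) ∧
      ∀ η ∈ u, ∀ η' ∈ u, η ≠ η' → ∀ y, y ∈ B η → y ∈ B η' → False := by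
  obtain ⟨w, hw1, hw2, hw3⟩ := d.hcodes u hu
  -- few points of small value
  have hT : ∀ τ : Cardinal.{0}, #{η // η ∈ u ∧ w η < τ.ord} ≤ τ := by
    intro τ
    have : Function.Injective (fun η : {η // η ∈ u ∧ w η < τ.ord} =>
        (Ordinal.ToType.mk ⟨w η.1, η.2.2⟩ : τ.ord.ToType)) := by
      intro a b hab
      have h3 := Ordinal.ToType.mk.injective hab
      exact Subtype.ext (hw1 a.2.1 b.2.1 (congrArg Subtype.val h3))
    simpa using mk_le_of_injective this
  have hF : ∀ (τ : Cardinal.{0}) (ε : Ordinal.{0}), ∃ c, (τ < d.l → c < d.l.ord) ∧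
      (ℵ₀ ≤ τ → τ < d.l → ε < (Ω τ) → c < (Ω τ) ∧
        ∀ η ∈ u, w η < τ.ord → d.fe (e η) τ ε < c) := by
    intro τ ε
    by_cases h : ℵ₀ ≤ τ ∧ τ < d.l ∧ ε < Ω τ
    · obtain ⟨c, hc, hc'⟩ := sup_bd h.1 (hT τ) (fun η => d.fe (e η.1) τ ε)
        (fun η => fe_lt (he _ η.2.1) h.2.1 h.2.2)
      exact ⟨c, fun h' => hc.trans (d.Om_lt h'), fun _ _ _ => ⟨hc, fun η h1 h2 => hc' ⟨η, h1, h2⟩⟩⟩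
    · exact ⟨0, fun h' => (zero_lt_Om τ).trans (d.Om_lt h'), fun h1 h2 h3 => absurd ⟨h1, h2, h3⟩ h⟩
  choose F hF1 hF2 using hF
  obtain ⟨i, hi1, hi2⟩ := hw3 F (fun τ h ε _ => hF1 τ ε h)
  have hg : ∀ (η : d.X) (τ : Cardinal.{0}), ∃ g < Ω τ, η ∈ u → ℵ₀ ≤ τ → τ < d.l →
      ∀ ε, g ≤ ε → ε < (Ω τ) → ∀ η' ∈ u, w η' < τ.ord →
        (d.del (e η') τ < d.del (e η) τ → d.del (e η') τ ≤ d.rk (e η ε)) ∧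
        ∀ ε' < τ.ord, e η ε ≠ e η' ε' := by
    intro η τ
    by_cases h : η ∈ u ∧ ℵ₀ ≤ τ ∧ τ < d.l
    · obtain ⟨h1, h2, h3⟩ := h
      have ha : ∀ η' : d.X, ∃ g < Ω τ, ∀ ε, g ≤ ε → ε < (Ω τ) →
          d.del (e η') τ < d.del (e η) τ → d.del (e η') τ ≤ d.rk (e η ε) := by
        intro η'
        by_cases h4 : d.del (e η') τ < d.del (e η) τ
        · obtain ⟨ε, h5, h6⟩ := lt_del h4
          refine ⟨ε, h5, fun ε' h7 h8 _ => h6.trans ?_⟩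
          rcases h7.lt_or_eq with h9 | h9
          · exact (he η h1 _ _ h9 (h8.trans (d.Om_lt h3))).le
          · rw [h9]
        · exact ⟨0, zero_lt_Om τ, fun _ _ _ h => absurd h h4⟩
      choose g1 hg1 hg1' using ha
      choose g2 hg2 hg2' using fun a => avoid (he η h1) h2 h3 a
      obtain ⟨b1, hb1, hb1'⟩ := sup_bd h2 (hT τ) (fun η' => g1 η'.1) (fun η' => hg1 η'.1)
      have hcard : #({η // η ∈ u ∧ w η < τ.ord} × τ.ord.ToType) ≤ τ := by
        rw [mk_prod, lift_id, lift_id, mk_toType, card_ord]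
        calc _ ≤ τ * τ := by gcongr; exact hT τ
          _ = τ := mul_eq_self h2
      obtain ⟨b2, hb2, hb2'⟩ := sup_bd h2 hcard
        (fun q => g2 (e q.1.1 (Ordinal.ToType.toOrd q.2).1)) (fun q => hg2 _)
      refine ⟨max b1 b2, max_lt hb1 hb2, fun _ _ _ ε hε hε' η' hη' hwη' => ⟨?_, ?_⟩⟩
      · exact hg1' η' ε ((hb1' ⟨η', hη', hwη'⟩).le.trans ((le_max_left _ _).trans hε)) hε'
      · intro ε' hε1
        have h7 : g2 (e η' ε') < b2 := by
          simpa using hb2' (⟨η', hη', hwη'⟩, Ordinal.ToType.mk ⟨ε', hε1⟩)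
        exact hg2' _ ε (h7.le.trans ((le_max_right _ _).trans hε)) hε'
    · exact ⟨0, zero_lt_Om τ, fun h1 h2 h3 => absurd ⟨h1, h2, h3⟩ h⟩
  choose g hg1 hg2 using hg
  let B : d.X → Set d.X := fun η => {y | ∃ τ ε, ℵ₀ ≤ τ ∧ w η < τ.ord ∧ τ < d.l ∧ g η τ ≤ ε ∧
    ε < (Ω τ) ∧ y = e η ε ∧ d.cond (e η) η τ i y}
  refine ⟨B, ?_, ?_⟩
  · intro η hη
    refine ⟨?_, ?_⟩
    · apply D_le (he η hη) η
      obtain ⟨t, ht, ht'⟩ := ord_bd (hw2 η) d.lim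
      refine ⟨t, ht, g η, hg1 η, {i}, ?_, ?_⟩
      · intro j hj
        rw [Finset.mem_singleton.1 hj]
        refine ⟨t, ht, fun τ h1 h2 h3 ε h4 => ?_⟩
        rw [hi2 τ h2 ε h4]
        have := hF2 τ ε h3 h2 h4
        exact ⟨(this.2 η hη (ht' τ h1 h2)).le, this.1⟩
      · rintro y ⟨τ, ε, h1, h2, h3, h4, h5, h6, h7⟩
        exact ⟨τ, ε, h1, ht' τ h2 h3, h3, h4, h5, h6, h7 i (by simp)⟩
    · rintro y ⟨τ, ε, h1, h2, h3, h4, h5, h6, h7⟩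
      exact ⟨ε, h5.trans (d.Om_lt h3), h6.symm⟩
  · have key : ∀ η ∈ u, ∀ η' ∈ u, η ≠ η' → ∀ y τ ε τ' ε', ℵ₀ ≤ τ → w η < τ.ord → τ < d.l →
        g η τ ≤ ε → ε < (Ω τ) → y = e η ε → d.cond (e η) η τ i y →
        ℵ₀ ≤ τ' → w η' < τ'.ord → τ' < d.l →
        g η' τ' ≤ ε' → ε' < (Ω τ') → y = e η' ε' → d.cond (e η') η' τ' i y → τ < τ' ∨
          (τ = τ' ∧ d.del (e η) τ ≤ d.del (e η') τ) → False := by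
      intro η hη η' hη' hne y τ ε τ' ε' a1 a2 a3 a4 a5 a6 a7 b1 b2 b3 b4 b5 b6 b7 hcase
      rcases hcase with hlt | ⟨rfl, hle⟩
      · refine (hg2 η' τ' hη' b1 b3 ε' b4 b5 η hη (a2.trans (ord_lt_ord.2 hlt))).2 ε ?_
          (b6.symm.trans a6)
        exact a5.trans_le (ord_le_ord.2 (Order.succ_le_of_lt hlt))
      · rcases hle.lt_or_eq with hlt | heq
        · have h1 := (hg2 η' τ hη' b1 b3 ε' b4 b5 η hη a2).1 hlt
          rw [← b6, a6] at h1
          exact absurd (rk_lt_del (he η hη) a3 a5) (not_lt.2 h1)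
        · have h1 : d.v η i = d.v η' i := by
            rw [← show _ = d.v η i from a7, ← show _ = d.v η' i from b7]
            simp only [pp, heq]
          rw [hi1, hi1] at h1
          exact hne (hw1 hη hη' h1)
    rintro η hη η' hη' hne y ⟨τ, ε, a1, a2, a3, a4, a5, a6, a7⟩ ⟨τ', ε', b1, b2, b3, b4, b5, b6, b7⟩
    rcases lt_trichotomy τ τ' with h | h | h
    · exact key η hη η' hη' hne y τ ε τ' ε' a1 a2 a3 a4 a5 a6 a7 b1 b2 b3 b4 b5 b6 b7 (Or.inl h)
    · subst h
      rcases le_total (d.del (e η) τ) (d.del (e η') τ) with h | h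
      · exact key η hη η' hη' hne y τ ε τ ε' a1 a2 a3 a4 a5 a6 a7 b1 b2 b3 b4 b5 b6 b7
          (Or.inr ⟨rfl, h⟩)
      · exact key η' hη' η hη hne.symm y τ ε' τ ε b1 b2 b3 b4 b5 b6 b7 a1 a2 a3 a4 a5 a6 a7
          (Or.inr ⟨rfl, h⟩)
    · exact key η' hη' η hη hne.symm y τ' ε' τ ε b1 b2 b3 b4 b5 b6 b7 a1 a2 a3 a4 a5 a6 a7
        (Or.inl h)

end Dat


namespace Dat

inductive Gen {X : Type} (u : Set X) (B : X → Set X) (a : X) : X → Prop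
  | base : Gen u B a a
  | step (η y : X) : Gen u B a η → η ∈ u → y ∈ B η → Gen u B a y

def IsLim (d : Dat) (E : d.X → Ordinal.{0} → d.X) (ξ : d.X) : Prop :=
  d.Good (E ξ) ∧ ∀ ε < d.l.ord, d.rk (E ξ ε) < d.rk ξ

def alg (d : Dat) (E : d.X → Ordinal.{0} → d.X) : Set (Set d.X) :=
  {U | ∀ ξ, d.IsLim E ξ → (ξ ∈ U ↔ U ∈ d.D (E ξ) ξ)}

lemma mem_congr {X : Type} {D : Ultrafilter X} {A P Q : Set X} (hA : A ∈ D)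
    (h : ∀ y ∈ A, (y ∈ P ↔ y ∈ Q)) : P ∈ D ↔ Q ∈ D := by
  constructor
  · intro hP
    filter_upwards [hA, hP] with y h1 h2 using (h y h1).1 h2
  · intro hP
    filter_upwards [hA, hP] with y h1 h2 using (h y h1).2 h2

lemma exists_closure (d : Dat) (E : d.X → Ordinal.{0} → d.X) (a b : d.X) :
    ∃ u : Set d.X, #u ≤ d.l ∧ a ∈ u ∧ b ∈ u ∧ ∀ x ∈ u, ∀ ε < d.l.ord, E x ε ∈ u := by
  let L := d.l.ord.ToType
  have hL : #L = d.l := by simp [L]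
  have : Infinite L := by rw [infinite_iff, hL]; exact d.hl.le
  let f : Bool × List L → d.X := fun p =>
    p.2.foldr (fun j y => E y (Ordinal.ToType.toOrd j).1) (if p.1 then a else b)
  refine ⟨range f, ?_, ⟨(true, []), by simp [f]⟩, ⟨(false, []), by simp [f]⟩, ?_⟩
  · refine mk_range_le.trans ?_
    rw [mk_prod, lift_id, lift_id, mk_list_eq_mk, hL, mk_bool]
    exact (mul_le_mul_left (ofNat_lt_aleph0.le.trans d.hl.le) _).trans (mul_eq_self d.hl.le).le
  · rintro x ⟨⟨c, s⟩, rfl⟩ ε hε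
    exact ⟨(c, Ordinal.ToType.mk ⟨ε, hε⟩ :: s), by simp [f]⟩

lemma sep (d : Dat) (E : d.X → Ordinal.{0} → d.X) {a b : d.X} (hab : d.rk a < d.rk b) :
    ∃ U ∈ d.alg E, a ∈ U ∧ b ∉ U := by
  classical
  obtain ⟨u, hu, hau, hbu, hcl⟩ := d.exists_closure E a b
  let u' : Set d.X := {η | η ∈ u ∧ d.IsLim E η}
  have hu' : #u' ≤ d.l := (mk_le_mk_of_subset (fun x hx => hx.1)).trans hu
  obtain ⟨B, hB, hdis⟩ := core u' hu' E (fun η hη => hη.2.1)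
  let S : Set d.X := {x | Gen u' B a x}
  have hS1 : ∀ x ∈ S, x ∈ u ∧ d.rk x ≤ d.rk a := by
    intro x hx
    induction hx with
    | base => exact ⟨hau, le_rfl⟩
    | step η y h1 h2 h3 ih =>
      obtain ⟨ε, hε, rfl⟩ := (hB η h2).2 h3
      exact ⟨hcl η h2.1 ε hε, (h2.2.2 ε hε).le.trans ih.2⟩
  have hS2 : ∀ η ∈ u', (η ∈ S ↔ S ∈ d.D (E η) η) := by
    intro η hη
    constructor
    · intro h
      exact Filter.mem_of_superset (hB η hη).1 (fun y hy => Gen.step η y h hη hy)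
    · intro h
      by_contra hcon
      apply singleton_notMem hη.2.1 η a
      filter_upwards [h, (hB η hη).1] with y h1 h2
      cases h1 with
      | base => rfl
      | step η' _ h3 h4 h5 =>
        exfalso
        refine hdis η hη η' h4 ?_ y h2 h5
        rintro rfl
        exact hcon h3
  have wf : WellFounded (fun x y : d.X => d.rk x < d.rk y) := InvImage.wf d.rk wellFounded_lt
  let G : (η : d.X) → ((y : d.X) → d.rk y < d.rk η → Prop) → Prop := fun η IH =>
    if η ∈ u then η ∈ S else {y | ∃ h : d.rk y < d.rk η, IH y h} ∈ d.D (E η) η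
  let U : Set d.X := {η | wf.fix G η}
  have hU : ∀ η, η ∈ U ↔
      if η ∈ u then η ∈ S else {y | ∃ _ : d.rk y < d.rk η, y ∈ U} ∈ d.D (E η) η := by
    intro η
    change wf.fix G η ↔ _
    rw [wf.fix_eq]
    rfl
  refine ⟨U, ?_, ?_, ?_⟩
  · intro ξ hξ
    by_cases h : ξ ∈ u
    · have h1 : ξ ∈ U ↔ ξ ∈ S := by rw [hU, if_pos h]
      rw [h1, hS2 ξ ⟨h, hξ⟩]
      refine mem_congr (range_mem hξ.1 ξ) ?_
      rintro y ⟨ε, hε, rfl⟩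
      rw [hU, if_pos (hcl ξ h ε hε)]
    · rw [hU, if_neg h]
      refine mem_congr (range_mem hξ.1 ξ) ?_
      rintro y ⟨ε, hε, rfl⟩
      exact ⟨fun h => h.2, fun h => ⟨hξ.2 ε hε, h⟩⟩
  · rw [hU, if_pos hau]
    exact Gen.base
  · rw [hU, if_pos hbu]
    intro h
    exact absurd (hS1 b h).2 (not_le.2 hab)

lemma alg_compl {d : Dat} {E : d.X → Ordinal.{0} → d.X} {U : Set d.X} (h : U ∈ d.alg E) :
    Uᶜ ∈ d.alg E := by
  intro ξ hξ
  rw [Ultrafilter.compl_mem_iff_notMem, mem_compl_iff, h ξ hξ]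

lemma alg_inter {d : Dat} {E : d.X → Ordinal.{0} → d.X} {U V : Set d.X} (h : U ∈ d.alg E)
    (h' : V ∈ d.alg E) : U ∩ V ∈ d.alg E := by
  intro ξ hξ
  rw [mem_inter_iff, h ξ hξ, h' ξ hξ]
  exact Filter.inter_mem_iff.symm

lemma alg_univ {d : Dat} {E : d.X → Ordinal.{0} → d.X} : Set.univ ∈ d.alg E := by
  intro ξ hξ
  exact ⟨fun _ => Filter.univ_mem, fun _ => Set.mem_univ ξ⟩

lemma enumerate (d : Dat) (hinj : Function.Injective d.rk) (Y : Set d.X) (hY : d.l ≤ #Y) :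
    ∃ a : Ordinal.{0} → d.X, d.Good a ∧ ∀ ε < d.l.ord, a ε ∈ Y := by
  classical
  let r : Y → Y → Prop := fun p q => d.rk p < d.rk q
  have emb : r ↪r ((· < ·) : Ordinal.{0} → Ordinal.{0} → Prop) :=
    ⟨⟨fun p => d.rk p, fun p q h => Subtype.ext (hinj h)⟩, Iff.rfl⟩
  have : IsWellOrder Y r := emb.isWellOrder
  have hty : d.l.ord ≤ Ordinal.type r := by
    rw [Cardinal.ord_le, Ordinal.card_type]
    exact hY
  have hne : Nonempty Y := by
    rw [← mk_ne_zero_iff]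
    exact ((aleph0_pos.trans d.hl).trans_le hY).ne'
  refine ⟨fun ε => if h : ε < Ordinal.type r then (Ordinal.enum r ⟨ε, h⟩).1
    else (Classical.arbitrary Y).1, ?_, ?_⟩
  · intro x y hxy hy
    have h2 := hy.trans_le hty
    have h1 := hxy.trans h2
    simp only [h1, h2, dif_pos]
    have : r (Ordinal.enum r ⟨x, h1⟩) (Ordinal.enum r ⟨y, h2⟩) :=
      (Ordinal.enum_lt_enum (r := r)).2 hxy
    exact this
  · intro ε hε
    have h2 := hε.trans_le hty
    simp only [h2, dif_pos]
    exact (Ordinal.enum r ⟨ε, h2⟩).2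

theorem final (d : Dat) (hinj : Function.Injective d.rk) (χ : Cardinal.{0})
    (hrk : ∀ x, d.rk x < χ.ord) (hcof : d.l < χ.ord.cof)
    (E : d.X → Ordinal.{0} → d.X)
    (hE : ∀ a : Ordinal.{0} → d.X, ∃ S : Set d.X, χ ≤ #S ∧ ∀ ξ ∈ S, ∀ ε < d.l.ord, E ξ ε = a ε) :
    ∃ (t : TopologicalSpace d.X),
      @T2Space d.X t ∧
      (∃ B : Set (Set d.X),
        @TopologicalSpace.IsTopologicalBasis d.X t B ∧ ∀ s ∈ B, @IsClopen d.X t s) ∧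
      ∀ Y : Set d.X, @IsClosed d.X t Y → Cardinal.mk ↥Y < χ →
        Cardinal.mk ↥Y < d.l := by
  classical
  let t : TopologicalSpace d.X := TopologicalSpace.generateFrom (d.alg E)
  have hbas : TopologicalSpace.IsTopologicalBasis (d.alg E) := by
    refine ⟨?_, ?_, rfl⟩
    · intro U hU V hV x hx
      exact ⟨U ∩ V, alg_inter hU hV, hx, subset_rfl⟩
    · exact eq_univ_of_forall (fun x => ⟨univ, alg_univ, mem_univ x⟩)
  refine ⟨t, ?_, ⟨d.alg E, hbas, ?_⟩, ?_⟩
  · constructor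
    intro x y hxy
    rcases lt_or_gt_of_ne (fun h => hxy (hinj h)) with h | h
    · obtain ⟨U, hU, h1, h2⟩ := d.sep E h
      exact ⟨U, Uᶜ, hbas.isOpen hU, hbas.isOpen (alg_compl hU), h1, h2, disjoint_compl_right⟩
    · obtain ⟨U, hU, h1, h2⟩ := d.sep E h
      exact ⟨Uᶜ, U, hbas.isOpen (alg_compl hU), hbas.isOpen hU, h2, h1, disjoint_compl_left⟩
  · intro U hU
    exact ⟨⟨hbas.isOpen (alg_compl hU)⟩, hbas.isOpen hU⟩
  · intro Y hYc hY
    by_contra hcon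
    push Not at hcon
    obtain ⟨a, ha1, ha2⟩ := d.enumerate hinj Y hcon
    obtain ⟨S, hS1, hS2⟩ := hE a
    let L := d.l.ord.ToType
    have hβ : (⨆ j : L, d.rk (a (Ordinal.ToType.toOrd j).1) + 1) < χ.ord := by
      apply Ordinal.iSup_add_one_lt_of_lt_cof _ (fun j => hrk _)
      simpa [L] using hcof
    set β := (⨆ j : L, d.rk (a (Ordinal.ToType.toOrd j).1) + 1) with hβd
    have hβ2 : ∀ ε < d.l.ord, d.rk (a ε) < β := by
      intro ε hε
      have := Ordinal.lt_iSup_add_one (fun j : L => d.rk (a (Ordinal.ToType.toOrd j).1))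
        (Ordinal.ToType.mk ⟨ε, hε⟩)
      have h9 : (Ordinal.ToType.toOrd (Ordinal.ToType.mk ⟨ε, hε⟩ : L)).1 = ε := by simp
      rw [h9] at this
      exact this
    have hlow : #{x // d.rk x < β} < χ := by
      have hi : Function.Injective (fun x : {x // d.rk x < β} =>
          (Ordinal.ToType.mk ⟨d.rk x.1, x.2⟩ : β.ToType)) := by
        intro x y hxy
        exact Subtype.ext (hinj (congrArg Subtype.val (Ordinal.ToType.mk.injective hxy)))
      refine (mk_le_of_injective hi).trans_lt ?_
      rw [mk_toType]
      exact Cardinal.lt_ord.1 hβ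
    have hsub : S ⊆ Y ∪ {x | d.rk x < β} := by
      intro ξ hξ
      by_cases h : d.rk ξ < β
      · exact Or.inr h
      · left
        have hlim : d.IsLim E ξ := by
          constructor
          · intro x y hxy hy
            rw [hS2 ξ hξ x (hxy.trans hy), hS2 ξ hξ y hy]
            exact ha1 x y hxy hy
          · intro ε hε
            rw [hS2 ξ hξ ε hε]
            exact (hβ2 ε hε).trans_le (not_lt.1 h)
        by_contra hξY
        obtain ⟨U, hU, h1, h2⟩ := hbas.exists_subset_of_mem_open (show ξ ∈ Yᶜ from hξY)
          hYc.isOpen_compl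
        have h3 := (hU ξ hlim).1 h1
        have h4 := range_mem hlim.1 ξ
        obtain ⟨y, hy1, ε, hε, rfl⟩ := Ultrafilter.nonempty_of_mem (Filter.inter_mem h3 h4)
        apply h2 hy1
        rw [hS2 ξ hξ ε hε]
        exact ha2 ε hε
    have hχ : ℵ₀ ≤ χ := by
      have := hcof.le.trans (Ordinal.cof_ord_le χ)
      exact d.hl.le.trans this
    have := (hS1.trans (mk_le_mk_of_subset hsub)).trans (mk_union_le _ _)
    exact absurd (add_lt_of_lt hχ hY hlow) (not_lt.2 this)

end Dat
end SingCase

/-- Let `λ` be a singular cardinal, `μ = 2^λ`, and `κ` least with `2^κ > μ`.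
Then there is a Hausdorff space `X` with a clopen basis, `|X| = 2^κ`, such that every
closed subset `Y` with `|Y| < |X|` satisfies `|Y| < λ`. -/
theorem exists_space_singular_case (l m k : Cardinal)
    (hinf : Cardinal.aleph0 ≤ l) (hsing : l.ord.cof < l)
    (hm : m = (2 : Cardinal) ^ l)
    (hk1 : m < (2 : Cardinal) ^ k)
    (hk2 : ∀ k' : Cardinal, k' < k → (2 : Cardinal) ^ k' ≤ m) :
    ∃ (X : Type) (t : TopologicalSpace X),
      @T2Space X t ∧
      (∃ B : Set (Set X),
        @TopologicalSpace.IsTopologicalBasis X t B ∧ ∀ s ∈ B, @IsClopen X t s) ∧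
      Cardinal.mk X = (2 : Cardinal) ^ k ∧
      ∀ Y : Set X, @IsClosed X t Y → Cardinal.mk ↥Y < Cardinal.mk X →
        Cardinal.mk ↥Y < l := by
  have hkm : k ≤ 2 ^ l := by
    by_contra h
    push Not at h
    have := hk2 (2 ^ l) h
    rw [hm] at this
    exact absurd (cantor (2 ^ l)) (not_lt.2 this)
  have hlk : l ≤ k := by
    by_contra h
    push Not at h
    have : (2 : Cardinal) ^ k ≤ 2 ^ l := power_le_power_left two_ne_zero h.le
    rw [hm] at hk1
    exact absurd hk1 (not_lt.2 this)
  have hS : l.IsSingular := IsSingular.of_not_isRegular hinf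
    (fun h => absurd h.cof_ord hsing.ne)
  have hlim := hS.isSuccLimit
  have hl : ℵ₀ < l := by
    refine lt_of_le_of_ne hinf ?_
    rintro rfl
    simp at hsing
  have hkinf : ℵ₀ ≤ k := hinf.trans hlk
  let K := k.out
  have hK : #K = k := mk_out k
  have : Nonempty K := by
    rw [← mk_ne_zero_iff, hK]
    exact (aleph0_pos.trans_le hkinf).ne'
  obtain ⟨I, FI, code, v, hv, hcode, hcodes⟩ := SingCase.codes l hinf K (hK.le.trans hkm)
  have hst : ∀ τ : Cardinal.{0}, ∃ H : Set Ordinal.{0} → Ordinal.{0} → Ordinal.{0},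
      ℵ₀ ≤ τ → ∀ (ι : Type) (J : Finset ι)
      (t : ι → Set Ordinal.{0}) (val : ι → Ordinal.{0}),
      (∀ i ∈ J, ∀ i' ∈ J, i ≠ i' → ∃ c < τ.ord, ¬ (c ∈ t i ↔ c ∈ t i')) →
      (∀ i ∈ J, val i < τ.ord) →
      SingCase.Stat τ {γ | ∀ i ∈ J, H (t i) γ = val i} := by
    intro τ
    by_cases h : ℵ₀ ≤ τ
    · obtain ⟨H, hH⟩ := SingCase.stationary h
      exact ⟨H, fun _ => hH⟩
    · exact ⟨fun _ _ => 0, fun h' => absurd h' h⟩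
  choose H hH using hst
  have hX : #(K → Bool) = 2 ^ k := by
    rw [← power_def, hK, mk_bool]
  obtain ⟨r, wo, hr⟩ := Cardinal.exists_ord_eq (K → Bool)
  let d : SingCase.Dat :=
    { X := K → Bool, l := l, hl := hl, lim := fun τ h => hlim.succ_lt h,
      rk := fun x => Ordinal.typein r x, I := I, FI := FI, code := code, v := v, hv := hv,
      hcode := hcode, hcodes := hcodes, H := H, hH := hH }
  let L := l.ord.ToType
  have hL : #L = l := by simp [L]
  have hXinf : ℵ₀ ≤ (2 : Cardinal) ^ k := hkinf.trans (cantor k).le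
  have heq : #(K → Bool) = #((L → (K → Bool)) × (K → Bool)) := by
    rw [mk_prod, lift_id, lift_id, ← power_def (K → Bool) L, hX, hL, ← power_mul,
      mul_eq_left hkinf hlk (aleph0_pos.trans_le hinf).ne', mul_eq_self hXinf]
  obtain ⟨φ⟩ := Cardinal.eq.1 heq
  have hLne : Nonempty L := by
    rw [← mk_ne_zero_iff, hL]
    exact (aleph0_pos.trans_le hinf).ne'
  classical
  let E : (K → Bool) → Ordinal.{0} → (K → Bool) := fun ξ ε =>
    (φ ξ).1 (if h : ε < l.ord then Ordinal.ToType.mk ⟨ε, h⟩ else Classical.arbitrary L)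
  obtain ⟨t, h1, h2, h3⟩ := d.final (fun x y h => Ordinal.typein_injective r h) (#(K → Bool))
    (fun x => by rw [hr]; exact Ordinal.typein_lt_type r x)
    (by rw [hX]; exact hlk.trans_lt (lt_cof_ord_power hkinf one_lt_two)) E (by
      intro a
      refine ⟨range (fun y => φ.symm (fun j => a (Ordinal.ToType.toOrd j).1, y)), ?_, ?_⟩
      · rw [mk_range_eq]
        · intro x y hxy
          have := φ.symm.injective hxy
          exact (Prod.ext_iff.1 this).2
      · rintro ξ ⟨y, rfl⟩ ε hε
        have hε' : ε < l.ord := hε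
        simp [E, hε'])
  exact ⟨K → Bool, t, h1, h2, hX, h3⟩
end

section
/- Let λ be an infinite cardinal and let κ be the least cardinal such that 2^κ > 2^λ. Then there exists a Hausdorff topological space X whose topology has a basis consisting of clopen sets, with |X| = 2^κ, which has no closed subset whose cardinality lies in the interval [λ, 2^κ); that is, every closed subset Y of X satisfies either |Y| < λ or |Y| = 2^κ. -/
open Set Filter Function Cardinal

/-- The combinatorial filter property used in the construction. -/
def GoodFilter (W : Type) (C : Filter W) (q : W → W) : Prop :=
  C ≤ cofinite ∧ (∀ y, ∃ᶠ w in C, q w = y) ∧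
  ∀ (D S : Type) (e : D → W), Injective e → ∀ f : D → W → S, (∀ d, Injective (f d)) →
    ∃ E : D → Set W, (∀ d, E d ∈ C) ∧
      ∀ d d', d ≠ d' → ∀ i ∈ E d, ∀ i' ∈ E d', f d i = f d' i' → q i = q i'

namespace OmegaCase

def P (n : ℕ) : ℕ := ∏ j ∈ Finset.range n, (j ^ 2 + 2)
def w (n : ℕ) : ℕ := (n ^ 2 + 1) * P n
abbrev W := Σ n : ℕ, Fin (w n)

lemma P_pos (n : ℕ) : 0 < P n := Finset.prod_pos (fun _ _ => by positivity)

lemma sum_w (n : ℕ) : ∑ j ∈ Finset.range n, w j + 1 = P n := by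
  induction n with
  | zero => simp [P]
  | succ n ih =>
    rw [Finset.sum_range_succ, P, Finset.prod_range_succ, ← P, w, ← ih]; ring

def bad (E : Set W) (n : ℕ) : Set (Fin (w n)) := {x | (⟨n, x⟩ : W) ∉ E}

def C : Filter W where
  sets := {E | ∃ k : ℕ, ∀ n ≥ k, (bad E n).ncard ≤ k * n * P n}
  univ_sets := ⟨0, fun n _ => by simp [bad]⟩
  sets_of_superset := by
    rintro E F ⟨k, hk⟩ h
    refine ⟨k, fun n hn => le_trans (Set.ncard_le_ncard ?_ (Set.toFinite _)) (hk n hn)⟩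
    intro x hx hE; exact hx (h hE)
  inter_sets := by
    rintro E F ⟨k, hk⟩ ⟨m, hm⟩
    refine ⟨k + m, fun n hn => ?_⟩
    have : bad (E ∩ F) n ⊆ bad E n ∪ bad F n := by
      intro x hx; simp only [bad, mem_union, mem_ofPred_eq, mem_inter_iff] at *; tauto
    calc _ ≤ _ := Set.ncard_le_ncard this (Set.toFinite _)
      _ ≤ _ := Set.ncard_union_le _ _
      _ ≤ k * n * P n + m * n * P n := add_le_add (hk n (by omega)) (hm n (by omega))
      _ = _ := by ring

lemma mem_C (E : Set W) : E ∈ C ↔ ∃ k : ℕ, ∀ n ≥ k, (bad E n).ncard ≤ k * n * P n := Iff.rfl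

lemma card_lower (n : ℕ) : Nat.card {y : W // y.1 < n} ≤ P n := by
  have e : {y : W // y.1 < n} ≃ Σ j : Fin n, Fin (w j) :=
    { toFun := fun y => ⟨⟨y.1.1, y.2⟩, y.1.2⟩
      invFun := fun z => ⟨⟨z.1.1, z.2⟩, z.1.2⟩
      left_inv := fun _ => rfl
      right_inv := fun _ => rfl }
  rw [Nat.card_congr e, ← sum_w n]
  simp [Finset.sum_range]

instance (n : ℕ) : Finite {y : W // y.1 < n} := by
  have e : {y : W // y.1 < n} ≃ Σ j : Fin n, Fin (w j) :=
    { toFun := fun y => ⟨⟨y.1.1, y.2⟩, y.1.2⟩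
      invFun := fun z => ⟨⟨z.1.1, z.2⟩, z.1.2⟩
      left_inv := fun _ => rfl
      right_inv := fun _ => rfl }
  exact Finite.of_equiv _ e.symm

lemma w_pos (n : ℕ) : 0 < w n := Nat.mul_pos (by positivity) (P_pos n)

instance : Infinite W := Infinite.of_injective (fun n : ℕ => (⟨n, ⟨0, w_pos n⟩⟩ : W))
  (fun a b h => congrArg Sigma.fst h)

theorem main : #W = ℵ₀ ∧ ∃ q : W → W, GoodFilter W C q := by
  refine ⟨by simp, ?_⟩
  obtain ⟨t, ht⟩ := exists_surjective_nat W
  refine ⟨fun x => t (Nat.unpair x.1).1, ?_, ?_, ?_⟩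
  · rw [le_cofinite_iff_compl_singleton_mem]
    rintro a
    refine ⟨a.1 + 1, fun n hn => ?_⟩
    have : bad {a}ᶜ n = ∅ := by
      ext x
      simp only [bad, mem_compl_iff, mem_singleton_iff, not_not, mem_ofPred_eq, mem_empty_iff_false, iff_false]
      rintro rfl; simp at hn
    rw [this]; simp
  · intro y hy
    obtain ⟨m, rfl⟩ := ht y
    obtain ⟨k, hk⟩ := hy
    have h1 := hk (Nat.pair m k) (Nat.right_le_pair m k)
    have h2 : k ≤ Nat.pair m k := (Nat.right_le_pair m k)
    set n := Nat.pair m k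
    have : bad {x : W | ¬ t (Nat.unpair x.1).1 = t m} n = Set.univ := by
      ext x; simp [bad, n]
    erw [this] at h1
    rw [Set.ncard_univ, Nat.card_fin, w] at h1
    have : k * n * P n ≤ n ^ 2 * P n := by rw [pow_two]; gcongr
    have := P_pos n
    nlinarith
  · intro D S e he f hf
    obtain ⟨g, hg⟩ := exists_injective_nat W
    set e' : D → ℕ := fun d => g (e d)
    have he' : Injective e' := hg.comp he
    refine ⟨fun d => {x | e' d < x.1 ∧ ¬ ∃ d' y, e' d' < x.1 ∧ y.1 < x.1 ∧ f d x = f d' y}, ?_, ?_⟩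
    · intro d
      refine ⟨e' d + 1, fun n hn => ?_⟩
      have hfin : Finite {d' : D // e' d' < n} :=
        Finite.of_injective (fun d' => (⟨e' d'.1, d'.2⟩ : Fin n)) (by
          rintro ⟨a, _⟩ ⟨b, _⟩ h; simp at h; exact Subtype.ext (he' h))
      have hc : Nat.card {d' : D // e' d' < n} ≤ n := by
        have := Nat.card_le_card_of_injective (fun d' : {d' : D // e' d' < n} => (⟨e' d'.1, d'.2⟩ : Fin n)) (by
          rintro ⟨a, _⟩ ⟨b, _⟩ h; simp at h; exact Subtype.ext (he' h))
        simpa using this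
      have key : ∀ x : bad {x | e' d < x.1 ∧ ¬ ∃ d' y, e' d' < x.1 ∧ y.1 < x.1 ∧ f d x = f d' y} n,
          ∃ z : {d' : D // e' d' < n} × {y : W // y.1 < n}, f d ⟨n, x.1⟩ = f z.1 z.2 := by
        rintro ⟨x, hx⟩
        simp only [bad, mem_ofPred_eq, not_and, not_not] at hx
        obtain ⟨d', y, h1, h2, h3⟩ := hx (by omega)
        exact ⟨⟨⟨d', h1⟩, ⟨y, h2⟩⟩, h3⟩
      choose z hz using key
      have hzi : Injective z := by
        intro a b hab
        have := (hz a).trans ((hab ▸ rfl : _ = _).trans (hz b).symm)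
        have := hf d this
        simp at this
        exact Subtype.ext this
      calc _ = Nat.card _ := rfl
        _ ≤ _ := Nat.card_le_card_of_injective z hzi
        _ = _ := Nat.card_prod _ _
        _ ≤ n * P n := Nat.mul_le_mul hc (card_lower n)
        _ ≤ _ := by rw [mul_assoc]; exact Nat.le_mul_of_pos_left _ (by omega)
    · rintro d d' hdd ⟨n, x⟩ ⟨h1, h2⟩ ⟨n', x'⟩ ⟨h1', h2'⟩ h
      rcases lt_trichotomy n n' with hlt | rfl | hlt
      · exact absurd ⟨d, ⟨n, x⟩, lt_trans h1 hlt, hlt, h.symm⟩ h2'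
      · rfl
      · exact absurd ⟨d', ⟨n', x'⟩, lt_trans h1' hlt, hlt, h⟩ h2

end OmegaCase
namespace UncCase

variable {l : Cardinal.{0}}

abbrev W (l : Cardinal.{0}) : Type := l.ord.ToType

def sz (i : W l) : Cardinal.{0} := #(Iio i)

lemma sz_mono {i j : W l} (h : i ≤ j) : sz i ≤ sz j := mk_le_mk_of_subset (Iio_subset_Iio h)

lemma sz_lt (i : W l) : sz i < l := by
  have := Cardinal.mk_Iio_lt i (by simp)
  rwa [mk_ord_toType] at this

lemma mk_Iic_le (i : W l) : #(Iic i) ≤ max (sz i) ℵ₀ := by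
  have : Iic i = Iio i ∪ {i} := by ext; simp [le_iff_lt_or_eq]
  rw [this]
  refine (mk_union_le _ _).trans ?_
  rw [mk_singleton]
  exact add_le_of_le (le_max_right _ _) (le_max_left _ _) (one_le_aleph0.trans (le_max_right _ _))

def H (l v : Cardinal.{0}) : Set (W l) := {x | sz x ≤ v}

lemma F0 {v : Cardinal.{0}} (hv : v < l) : v < #(H l v) := by
  by_contra! hc
  have hne : (H l v)ᶜ.Nonempty := by
    rw [Set.nonempty_compl]
    intro h
    rw [h, mk_univ, mk_ord_toType] at hc
    exact absurd hv (not_lt.2 hc)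
  obtain ⟨m, hm, hmin⟩ := WellFounded.has_min (wellFounded_lt (α := W l)) _ hne
  apply hm
  refine (mk_le_mk_of_subset ?_).trans hc
  intro x hx
  by_contra hx'
  exact hmin x hx' hx

lemma unb_card {v t : Cardinal.{0}} (hv : ℵ₀ ≤ v) (ht : v ≤ t) (A : Set (W l)) (hA : A ⊆ H l v)
    (hAc : #A ≤ t) (hH : t < #(H l v)) : ∃ b ∈ H l v, ∀ a ∈ A, a < b := by
  by_contra! hc
  have hsub : H l v ⊆ ⋃ a ∈ A, Iic a := by
    intro b hb
    obtain ⟨a, ha, hab⟩ := hc b hb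
    exact mem_biUnion ha hab
  have h1 := (mk_le_mk_of_subset hsub).trans (mk_biUnion_le _ _)
  have h2 : (⨆ x : A, #(Iic (x : W l))) ≤ t := by
    apply ciSup_le'
    intro x
    exact (mk_Iic_le _).trans (max_le ((hA x.2).trans ht) (hv.trans ht))
  have h3 : #A * (⨆ x : A, #(Iic (x : W l))) ≤ t :=
    (mul_le_mul' hAc h2).trans (mul_eq_self (hv.trans ht)).le
  exact absurd hH (not_lt.2 (h1.trans h3))

lemma F1 {v : Cardinal.{0}} (hv : ℵ₀ ≤ v) (hvl : v < l) (A : Set (W l)) (hA : A ⊆ H l v)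
    (hAc : #A ≤ v) : ∃ b ∈ H l v, ∀ a ∈ A, a < b := unb_card hv le_rfl A hA hAc (F0 hvl)

lemma H_le {v : Cardinal.{0}} (hv : ℵ₀ ≤ v) : #(H l v) ≤ Order.succ v := by
  by_contra! hc
  obtain ⟨A, hA, hAc⟩ := le_mk_iff_exists_subset.1 hc.le
  obtain ⟨b, hb, hAb⟩ := unb_card hv (Order.le_succ v) A hA hAc.le hc
  have : Order.succ v ≤ v := by
    rw [← hAc]
    exact (mk_le_mk_of_subset (fun a ha => hAb a ha)).trans hb
  exact absurd (Order.lt_succ v) (not_lt.2 this)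

def Cl (G : W l → Set (W l)) : Set (W l) :=
  {i | ℵ₀ ≤ sz i ∧ (∃ a < i, sz a = sz i) ∧
    ∀ a < i, sz a = sz i → ∀ b ∈ G a, sz b ≤ sz i → b < i}

lemma Cl_anti {G G' : W l → Set (W l)} (h : ∀ a, G a ⊆ G' a) : Cl G' ⊆ Cl G :=
  fun _ hi => ⟨hi.1, hi.2.1, fun a ha hs b hb => hi.2.2 a ha hs b (h a hb)⟩

def Ok (v : Cardinal.{0}) (G : W l → Set (W l)) : Prop := ∀ a, sz a = v → #(G a) ≤ v

lemma exists_Cl {v : Cardinal.{0}} (hv : ℵ₀ ≤ v) (hvl : v < l) (G : W l → Set (W l))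
    (hG : Ok v G) : ∃ i, sz i = v ∧ i ∈ Cl G := by
  obtain ⟨A, hA, hAc⟩ := le_mk_iff_exists_subset.1 (F0 hvl).le
  obtain ⟨b, hb, hAb⟩ := F1 hv hvl A hA hAc.le
  have hbv : v ≤ sz b := by
    rw [← hAc]
    exact mk_le_mk_of_subset (fun a ha => hAb a ha)
  have step : ∀ x : H l v, ∃ x' : H l v, x < x' ∧
      ∀ a ≤ x.1, sz a = v → ∀ c ∈ G a, sz c ≤ v → c < x'.1 := by
    rintro ⟨x, hx⟩
    obtain ⟨x', hx', hb'⟩ := F1 hv hvl ({x} ∪ ⋃ a ∈ Iic x, {c | sz a = v ∧ c ∈ G a ∧ sz c ≤ v})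
      (by
        rintro c (rfl | hc)
        · exact hx
        · simp only [mem_iUnion] at hc
          obtain ⟨a, _, hc⟩ := hc
          exact hc.2.2)
      (by
        refine (mk_union_le _ _).trans (add_le_of_le hv ?_ ?_)
        · rw [mk_singleton]; exact one_le_aleph0.trans hv
        · refine (mk_biUnion_le _ _).trans ((mul_le_mul' ((mk_Iic_le _).trans (max_le hx hv)) (ciSup_le' ?_)).trans (mul_eq_self hv).le)
          intro a
          by_cases ha : sz a.1 = v
          · exact (mk_le_mk_of_subset (fun c hc => hc.2.1)).trans (hG a.1 ha)
          · simp [ha])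
    refine ⟨⟨x', hx'⟩, hb' x (by simp), fun a ha hs c hc hsc => hb' c (Or.inr ?_)⟩
    exact mem_biUnion ha ⟨hs, hc, hsc⟩
  choose s hs1 hs2 using step
  set a : ℕ → H l v := fun n => s^[n] ⟨b, hb⟩
  have ha : ∀ n, a (n + 1) = s (a n) := fun n => iterate_succ_apply' s n _
  have hne : {i : W l | i ∈ H l v ∧ ∀ n, (a n).1 < i}.Nonempty := by
    obtain ⟨i, hi, hi'⟩ := F1 hv hvl (range fun n => (a n).1) (by
      rintro _ ⟨n, rfl⟩; exact (a n).2) (mk_range_le.trans (by simpa using hv))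
    exact ⟨i, hi, fun n => hi' _ ⟨n, rfl⟩⟩
  obtain ⟨i, ⟨hi1, hi2⟩, hmin⟩ := WellFounded.has_min (wellFounded_lt (α := W l)) _ hne
  have hbi : b < i := hi2 0
  have hsi : sz i = v := le_antisymm hi1 (hbv.trans (sz_mono hbi.le))
  refine ⟨i, hsi, hsi ▸ hv, ⟨b, hbi, ?_⟩, ?_⟩
  · rw [hsi]; exact le_antisymm hb hbv
  · intro c hc hsc d hd hsd
    rw [hsi] at hsc hsd
    have : ∃ n, c ≤ (a n).1 := by
      by_contra! hcc
      exact hmin c ⟨hsc.le, hcc⟩ hc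
    obtain ⟨n, hn⟩ := this
    have := hs2 (a n) c hn hsc d hd hsd
    rw [← ha] at this
    exact this.trans (hi2 _)

lemma block {v : Cardinal.{0}} (hv : ℵ₀ ≤ v) (hvl : v < l) :
    ∃ q : W l → W l, ∀ y ∈ H l v, ∀ G, Ok v G → ∃ i, sz i = v ∧ i ∈ Cl G ∧ q i = y := by
  classical
  have hne : Nonempty v.out := by
    rw [← mk_ne_zero_iff, mk_out]; exact (aleph0_pos.trans_le hv).ne'
  have he : ∀ i : W l, ∃ e : W l → v.out, sz i = v → InjOn e (Iio i) := by
    intro i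
    by_cases hi : sz i = v
    · have : #(Iio i) ≤ #v.out := by rw [mk_out]; exact hi.le
      obtain ⟨g⟩ := this
      refine ⟨fun x => if hx : x ∈ Iio i then g ⟨x, hx⟩ else Classical.arbitrary _, fun _ => ?_⟩
      intro x hx y hy hxy
      simp only [hx, hy, dif_pos] at hxy
      exact congrArg Subtype.val (g.injective hxy)
    · exact ⟨fun _ => Classical.arbitrary _, fun h => absurd h hi⟩
  choose e he using he
  have key : ∀ x : H l v, ∃ n, ∀ G, Ok v G → ∃ i ∈ Cl G, sz i = v ∧ x.1 < i ∧ e i x.1 = n := by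
    rintro ⟨x, hx⟩
    by_contra! hc
    choose G hG hGc using hc
    obtain ⟨i, hi, hiC⟩ := exists_Cl hv hvl (fun a => {x} ∪ ⋃ n, G n a) (by
      intro a ha
      refine (mk_union_le _ _).trans (add_le_of_le hv ?_ ?_)
      · rw [mk_singleton]; exact one_le_aleph0.trans hv
      · refine (mk_iUnion_le _).trans ((mul_le_mul' (mk_out v).le (ciSup_le' ?_)).trans (mul_eq_self hv).le)
        intro n
        exact hG n a ha)
    obtain ⟨a, hai, has⟩ := hiC.2.1
    have hxi : x < i := hiC.2.2 a hai has x (Or.inl rfl) (by rw [hi]; exact hx)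
    exact hGc (e i x) i (Cl_anti (fun a => (subset_iUnion (fun n => G n a) (e i x)).trans subset_union_right) hiC) hi hxi rfl
  choose n hn using key
  obtain ⟨n0, hn0⟩ := infinite_pigeonhole_card n (Order.succ v) (Order.succ_le_of_lt (F0 hvl))
    (hv.trans (Order.le_succ v)) (by
      rw [(isRegular_succ hv).cof_ord, mk_out]; exact Order.lt_succ v)
  obtain ⟨t⟩ := (H_le hv).trans hn0
  refine ⟨fun i => if h : ∃ y : H l v, (t y).1.1 < i ∧ e i (t y).1.1 = n0 then (h.choose).1 else i, ?_⟩
  intro y hy G hG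
  obtain ⟨i, hi, hs, hlt, hei⟩ := hn (t ⟨y, hy⟩).1 G hG
  have hnt : n (t ⟨y, hy⟩).1 = n0 := (t ⟨y, hy⟩).2
  refine ⟨i, hs, hi, ?_⟩
  have h : ∃ y : H l v, (t y).1.1 < i ∧ e i (t y).1.1 = n0 := ⟨⟨y, hy⟩, hlt, hei.trans hnt⟩
  refine (dif_pos h).trans ?_
  have h2 := h.choose_spec
  have h3 := he i hs h2.1 hlt (h2.2.trans (hei.trans hnt).symm)
  have h4 := t.injective (Subtype.ext (Subtype.ext h3))
  rw [h4]

def Tame (G : W l → Set (W l)) : Prop := ∀ a, #(G a) ≤ max (sz a) ℵ₀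

def C (l : Cardinal.{0}) [Nonempty (W l)] : Filter (W l) where
  sets := {E | ∃ G c, Tame G ∧ Cl G ∩ Ioi c ⊆ E}
  univ_sets := ⟨fun _ => ∅, Classical.arbitrary _, fun a => by simp, fun _ _ => trivial⟩
  sets_of_superset := by
    rintro E F ⟨G, c, hG, h⟩ h'
    exact ⟨G, c, hG, h.trans h'⟩
  inter_sets := by
    rintro E F ⟨G, c, hG, h⟩ ⟨G', c', hG', h'⟩
    refine ⟨fun a => G a ∪ G' a, max c c', fun a => ?_, ?_⟩
    · exact (mk_union_le _ _).trans (add_le_of_le (le_max_right _ _) (hG a) (hG' a))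
    · rintro i ⟨h1, h2⟩
      exact ⟨h ⟨Cl_anti (fun a => subset_union_left) h1, (le_max_left c c').trans_lt (mem_Ioi.1 h2)⟩,
        h' ⟨Cl_anti (fun a => subset_union_right) h1, (le_max_right c c').trans_lt (mem_Ioi.1 h2)⟩⟩

theorem main (hl : ℵ₀ < l) : ∃ (C : Filter (W l)) (q : W l → W l), GoodFilter (W l) C q := by
  classical
  have : Nonempty (W l) := by
    rw [← mk_ne_zero_iff, mk_ord_toType]; exact (aleph0_pos.trans hl).ne'
  have hb : ∀ v : Cardinal.{0}, ∃ q : W l → W l, ℵ₀ ≤ v → v < l → ∀ y ∈ H l v, ∀ G, Ok v G →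
      ∃ i, sz i = v ∧ i ∈ Cl G ∧ q i = y := by
    intro v
    by_cases h : ℵ₀ ≤ v ∧ v < l
    · obtain ⟨q, hq⟩ := block h.1 h.2
      exact ⟨q, fun _ _ => hq⟩
    · exact ⟨id, fun h1 h2 => absurd ⟨h1, h2⟩ h⟩
  choose q hq using hb
  refine ⟨C l, fun i => q (sz i) i, ?_, ?_, ?_⟩
  · rw [le_cofinite_iff_compl_singleton_mem]
    intro a
    refine ⟨fun _ => ∅, a, fun a => by simp, ?_⟩
    rintro i ⟨_, hi⟩
    exact (show a < i from hi).ne'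
  · rintro y ⟨G, c, hG, hsub⟩
    set v : Cardinal.{0} := max (max (sz c) (sz y)) ℵ₀
    have hv : ℵ₀ ≤ v := le_max_right _ _
    have hvl : v < l := max_lt (max_lt (sz_lt c) (sz_lt y)) hl
    obtain ⟨i, hi, hiC, hqi⟩ := hq v hv hvl y (show sz y ≤ v from (le_max_right _ _).trans (le_max_left _ _))
      (fun a => {c} ∪ G a) (by
        intro a ha
        refine (mk_union_le _ _).trans (add_le_of_le hv ?_ ?_)
        · rw [mk_singleton]; exact one_le_aleph0.trans hv
        · exact (hG a).trans (max_le ha.le hv))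
    obtain ⟨a, hai, has⟩ := hiC.2.1
    have hci : c < i := hiC.2.2 a hai has c (Or.inl rfl) (by
      rw [hi]; exact (le_max_left _ _).trans (le_max_left _ _))
    exact hsub ⟨Cl_anti (fun a => subset_union_right) hiC, hci⟩ (by simpa [hi] using hqi)
  · intro D S e he f hf
    set G : W l → Set (W l) := fun a => {i | ∃ d d' j, e d ≤ a ∧ e d' ≤ a ∧ j ≤ a ∧ f d i = f d' j}
      with hGdef
    have hG : Tame G := by
      intro a
      have : ∀ i : G a, ∃ z : Iic a × Iic a × Iic a, ∃ d d', e d = z.1 ∧ e d' = z.2.1 ∧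
          f d i = f d' z.2.2 := by
        rintro ⟨i, d, d', j, h1, h2, h3, h4⟩
        exact ⟨⟨⟨_, h1⟩, ⟨_, h2⟩, ⟨_, h3⟩⟩, d, d', rfl, rfl, h4⟩
      choose z d d' h1 h2 h3 using this
      have hz : Injective z := by
        intro i j hij
        have e1 : d i = d j := he (by rw [h1, h1, hij])
        have e2 : d' i = d' j := he (by rw [h2, h2, hij])
        have := h3 j
        rw [← e1, ← e2, ← hij, ← h3 i] at this
        exact Subtype.ext (hf _ this).symm
      refine (mk_le_of_injective hz).trans ?_
      have hm := mk_Iic_le a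
      have hal : ℵ₀ ≤ max (sz a) ℵ₀ := le_max_right _ _
      simp only [mk_prod, lift_id]
      calc _ ≤ _ := mul_le_mul' hm (mul_le_mul' hm hm)
        _ = _ := by rw [mul_eq_self hal, mul_eq_self hal]
    have main : ∀ d d' i i', i ∈ Ioi (e d) ∩ Cl G → i' ∈ Ioi (e d') ∩ Cl G → f d i = f d' i' →
        ¬ i' < i := by
      rintro d d' i i' ⟨h1, h2⟩ ⟨h1', h2'⟩ h hlt
      obtain ⟨a0, ha0, has⟩ := h2.2.1
      set a := max (max (e d) (e d')) (max i' a0)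
      have hai : a < i := max_lt (max_lt h1 (lt_trans h1' hlt)) (max_lt hlt ha0)
      have hsa : sz a = sz i := le_antisymm (sz_mono hai.le) (by
        rw [← has]; exact sz_mono ((le_max_right _ _).trans (le_max_right _ _)))
      have : i ∈ G a := ⟨d, d', i', (le_max_left _ _).trans (le_max_left _ _),
        (le_max_right _ _).trans (le_max_left _ _), (le_max_left _ _).trans (le_max_right _ _), h⟩
      exact lt_irrefl _ (h2.2.2 a hai hsa i this le_rfl)
    refine ⟨fun d => Ioi (e d) ∩ Cl G, fun d => ⟨G, e d, hG, fun i hi => ⟨hi.2, hi.1⟩⟩, ?_⟩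
    intro d d' _ i hi i' hi' h
    have := le_antisymm (not_lt.1 (main d d' i i' hi hi' h)) (not_lt.1 (main d' d i' i hi' hi h.symm))
    rw [this]

end UncCase
/-- The ultrafilter separation property used in the construction. -/
def SepUF (W : Type) (p : ((W → Bool) → Bool) → Ultrafilter W) : Prop :=
  (∀ z, (p z : Filter W) ≤ cofinite) ∧
  ∀ (D S : Type) (e : D → W), Injective e → ∀ z : D → ((W → Bool) → Bool), Injective z →
    ∀ f : D → W → S, (∀ d, Injective (f d)) →
    ∃ U : D → Set W, (∀ d, U d ∈ p (z d)) ∧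
      ∀ d d', d ≠ d' → ∀ i ∈ U d, ∀ i' ∈ U d', f d i ≠ f d' i'

namespace LemM

variable {W : Type}

abbrev I (W : Type) : Type := Σ F : Finset W, ((F → Bool) → W)
abbrev J (W : Type) : Type := (W × W → (W → Bool)) × (W → Option (W × W → Bool))

lemma card_I [Infinite W] : #(I W) ≤ #W := by
  have hW := aleph0_le_mk W
  rw [mk_sigma]
  refine (sum_le_mk_mul_iSup _).trans ?_
  rw [mk_finset_of_infinite]
  refine (mul_le_mul' le_rfl (ciSup_le' (a := #W) ?_)).trans (mul_eq_self hW).le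
  intro F
  rw [← Cardinal.power_def]
  obtain ⟨n, hn⟩ := lt_aleph0.1 (lt_aleph0_of_finite (F → Bool))
  rw [hn, Cardinal.power_natCast]
  exact power_nat_le hW

lemma card_J [Infinite W] : #(J W) ≤ #(W → Bool) := by
  have hW := aleph0_le_mk W
  have e2 : #(W × W → Bool) = 2 ^ #W := by
    rw [← Cardinal.power_def, mk_prod]; simp [mul_eq_self hW]
  have h2 : ℵ₀ ≤ (2 : Cardinal) ^ #W := hW.trans (cantor _).le
  have e3 : #(Option (W × W → Bool)) ≤ 2 ^ #W := by
    rw [mk_option, e2]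
    exact add_le_of_le h2 le_rfl (one_le_aleph0.trans h2)
  have e4 : ((2 : Cardinal) ^ #W) ^ #W = 2 ^ #W := by rw [← power_mul, mul_eq_self hW]
  have e5 : #(W → Option (W × W → Bool)) ≤ 2 ^ #W := by
    rw [← Cardinal.power_def, ← e4]
    exact power_le_power_right e3
  have e6 : #(W × W → (W → Bool)) = 2 ^ #W := by
    rw [← Cardinal.power_def, mk_prod]; simp [mul_eq_self hW, e4]
  rw [mk_prod, lift_id, lift_id, e6]
  refine (mul_le_mul' le_rfl e5).trans ?_
  rw [mul_eq_self h2]; simp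

def h (b : W → Bool) (x : I W) : W := x.2 (fun c => b c.1)

lemma indep [Nonempty W] (T : Finset (W → Bool)) (v : (W → Bool) → W) :
    ∃ x : I W, ∀ b ∈ T, h b x = v b := by
  classical
  have hs : ∀ z : (W → Bool) × (W → Bool), ∃ c : W, z.1 ≠ z.2 → z.1 c ≠ z.2 c := by
    rintro ⟨b, b'⟩
    by_cases hb : b = b'
    · exact ⟨Classical.arbitrary _, fun h => absurd hb h⟩
    · obtain ⟨c, hc⟩ := Function.ne_iff.1 hb
      exact ⟨c, fun _ => hc⟩
  choose c hc using hs
  set F : Finset W := (T ×ˢ T).image c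
  have hF : ∀ b ∈ T, ∀ b' ∈ T, (fun x : F => b x.1) = (fun x : F => b' x.1) → b = b' := by
    intro b hb b' hb' heq
    by_contra hne
    have hm : c (b, b') ∈ F := Finset.mem_image_of_mem _ (Finset.mk_mem_product hb hb')
    exact hc (b, b') hne (congrFun heq ⟨_, hm⟩)
  refine ⟨⟨F, fun u => if hu : ∃ b ∈ T, (fun x : F => b x.1) = u then v hu.choose
    else Classical.arbitrary _⟩, ?_⟩
  intro b hb
  have hu : ∃ b' ∈ T, (fun x : F => b' x.1) = (fun x : F => b x.1) := ⟨b, hb, rfl⟩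
  refine (dif_pos hu).trans ?_
  rw [hF _ hu.choose_spec.1 _ hb hu.choose_spec.2]

open Classical in
noncomputable def val [Nonempty W] (j : J W) (z : (W → Bool) → Bool) : W :=
  if hc : ∃ c, j.2 c = some (fun x => z (j.1 x)) then hc.choose else Classical.arbitrary _

def A [Nonempty W] (g : J W → (W → Bool)) (z : (W → Bool) → Bool) (j : J W) : Set (I W) :=
  {x | h (g j) x = val j z}

lemma gen_neBot [Nonempty W] (g : J W → (W → Bool)) (hg : Injective g) (z : (W → Bool) → Bool) :
    NeBot (generate (range (A g z))) := by
  classical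
  rw [generate_neBot_iff]
  intro t ht hfin
  have ht' : ∀ s ∈ t, ∃ j, A g z j = s := ht
  choose! j hj using ht'
  obtain ⟨x, hx⟩ := indep (hfin.toFinset.image (fun s => g (j s)))
    (Function.extend g (fun j => val j z) (fun _ => Classical.arbitrary _))
  refine ⟨x, fun s hs => ?_⟩
  have := hx (g (j s)) (Finset.mem_image_of_mem _ (by simpa using hs))
  rw [hg.extend_apply] at this
  rw [← hj s hs]
  exact this

theorem main [Infinite W] (C : Filter W) (q : W → W) (hC : GoodFilter W C q) :
    ∃ p, SepUF W p := by
  classical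
  obtain ⟨hcof, hpos, hsep⟩ := hC
  obtain ⟨g, hg⟩ : Nonempty (J W ↪ (W → Bool)) := card_J
  obtain ⟨r⟩ : Nonempty (I W ↪ W) := card_I
  have : Nonempty (I W) := ⟨⟨∅, fun _ => Classical.arbitrary _⟩⟩
  set th : W → I W := invFun r
  have hth : Surjective th := invFun_surjective r.injective
  set Q : ((W → Bool) → Bool) → Filter W :=
    fun z => C ⊓ comap (fun w => th (q w)) (generate (range (A g z)))
  have hQ : ∀ z, NeBot (Q z) := by
    intro z
    have := gen_neBot g hg z
    rw [inf_neBot_iff]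
    rintro s hs t ⟨u, hu, hut⟩
    obtain ⟨x, hx⟩ := this.nonempty_of_mem hu
    obtain ⟨y, rfl⟩ := hth x
    obtain ⟨w, hw, hws⟩ := ((hpos y).and_eventually hs).exists
    refine ⟨w, hws, hut ?_⟩
    simpa [hw] using hx
  refine ⟨fun z => Ultrafilter.of (Q z), ?_, ?_⟩
  · intro z
    exact (Ultrafilter.of_le _).trans (inf_le_left.trans hcof)
  · intro D S e he z hz f hf
    obtain ⟨E, hE, hEs⟩ := hsep D S e he f hf
    have hk : ∀ ab : W × W, ∃ x : W → Bool, ∀ d d', e d = ab.1 → e d' = ab.2 → d ≠ d' →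
        z d x ≠ z d' x := by
      rintro ⟨a, b⟩
      by_cases hab : ∃ d d', e d = a ∧ e d' = b ∧ d ≠ d'
      · obtain ⟨d, d', h1, h2, h3⟩ := hab
        obtain ⟨x, hx⟩ := Function.ne_iff.1 (hz.ne h3)
        refine ⟨x, fun d1 d1' h4 h5 _ => ?_⟩
        rw [he (h4.trans h1.symm), he (h5.trans h2.symm)]
        exact hx
      · exact ⟨fun _ => true, fun d d' h1 h2 h3 => absurd ⟨d, d', h1, h2, h3⟩ hab⟩
    choose k hk using hk
    have hs : ∀ c : W, ∃ o : Option (W × W → Bool), (∀ d, e d = c → o = some (fun x => z d (k x))) ∧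
        ∀ u, o = some u → ∃ d, e d = c ∧ u = fun x => z d (k x) := by
      intro c
      by_cases hc : ∃ d, e d = c
      · obtain ⟨d, rfl⟩ := hc
        refine ⟨some (fun x => z d (k x)), ?_, ?_⟩
        · intro d' hd
          rw [he hd]
        · intro u hu
          exact ⟨d, rfl, (Option.some_injective _ hu).symm⟩
      · exact ⟨none, fun d hd => absurd ⟨d, hd⟩ hc, fun u hu => by simp at hu⟩
    choose s hs1 hs2 using hs
    set j : J W := (k, s)
    have hval : ∀ d, val j (z d) = e d := by
      intro d
      have hc : ∃ c, j.2 c = some (fun x => z d (j.1 x)) := ⟨e d, hs1 _ d rfl⟩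
      refine (dif_pos hc).trans ?_
      obtain ⟨d', hd', hu⟩ := hs2 _ _ hc.choose_spec
      rw [← hd']
      by_contra hne
      have hdd : d ≠ d' := fun hh => hne (by rw [hh])
      exact hk (e d, e d') d d' rfl rfl hdd (congrFun hu (e d, e d'))
    refine ⟨fun d => E d ∩ {w | h (g j) (th (q w)) = e d}, ?_, ?_⟩
    · intro d
      apply Ultrafilter.of_le (Q (z d))
      refine inter_mem_inf (hE d) ?_
      refine ⟨A g (z d) j, mem_generate_of_mem ⟨j, rfl⟩, ?_⟩
      intro w hw
      exact (show h (g j) (th (q w)) = val j (z d) from hw).trans (hval d)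
    · rintro d d' hdd i ⟨hi, hi2⟩ i' ⟨hi', hi2'⟩ heq
      have := hEs d d' hdd i hi i' hi' heq
      apply hdd
      apply he
      rw [← show h (g j) (th (q i)) = e d from hi2, ← show h (g j) (th (q i')) = e d' from hi2', this]

end LemM

theorem exists_sepUF (l : Cardinal.{0}) (hl : ℵ₀ ≤ l) :
    ∃ (W : Type) (p : ((W → Bool) → Bool) → Ultrafilter W), #W = l ∧ SepUF W p := by
  rcases hl.eq_or_lt with rfl | hl'
  · obtain ⟨h1, q, hq⟩ := OmegaCase.main
    obtain ⟨p, hp⟩ := LemM.main _ q hq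
    exact ⟨_, p, h1, hp⟩
  · obtain ⟨C, q, hq⟩ := UncCase.main hl'
    have : Infinite (UncCase.W l) := by rw [infinite_iff, mk_ord_toType]; exact hl
    obtain ⟨p, hp⟩ := LemM.main C q hq
    exact ⟨_, p, mk_ord_toType l, hp⟩
namespace TermSpace

/-- Well-founded terms: the points of the space. -/
inductive T (Z W : Type) : Type
  | leaf : T Z W
  | node (a : Z) (f : W → T Z W) : T Z W

variable {Z W : Type}

def ch : T Z W → W → T Z W
  | .leaf => fun _ => .leaf
  | .node _ f => f

def lim : T Z W → Prop
  | .leaf => False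
  | .node _ f => Injective f

lemma lim_inj {x : T Z W} (h : lim x) : Injective (ch x) := by
  cases x with
  | leaf => exact h.elim
  | node a f => exact h

def sub : T Z W → Set (T Z W)
  | .leaf => {.leaf}
  | .node a f => {.node a f} ∪ ⋃ w, sub (f w)

lemma self_mem_sub (x : T Z W) : x ∈ sub x := by
  cases x with
  | leaf => simp [sub]
  | node a f => simp [sub]

lemma ch_mem_sub (y : T Z W) : ∀ x ∈ sub y, ∀ w, ch x w ∈ sub y := by
  induction y with
  | leaf =>
    intro x hx w
    simp only [sub, mem_singleton_iff] at hx
    subst hx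
    simp [ch, sub]
  | node a f ih =>
    intro x hx w
    rcases hx with hx | hx
    · rw [mem_singleton_iff] at hx
      subst hx
      exact Or.inr (mem_iUnion.2 ⟨w, self_mem_sub _⟩)
    · obtain ⟨v, hv⟩ := mem_iUnion.1 hx
      exact Or.inr (mem_iUnion.2 ⟨v, ih v x hv w⟩)

lemma mk_sub_le [Infinite W] (y : T Z W) : #(sub y) ≤ #W := by
  have hW := aleph0_le_mk W
  induction y with
  | leaf =>
    rw [sub, mk_singleton]; exact one_le_aleph0.trans hW
  | node a f ih =>
    rw [sub]
    refine (mk_union_le _ _).trans (add_le_of_le hW ?_ ?_)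
    · rw [mk_singleton]; exact one_le_aleph0.trans hW
    · exact (mk_iUnion_le _).trans ((mul_le_mul' le_rfl (ciSup_le' ih)).trans (mul_eq_self hW).le)

def toW : T Z W → WType (fun o : Option Z => {_w : W // o.isSome = true})
  | .leaf => WType.mk none (fun w => absurd w.2 (by simp))
  | .node a f => WType.mk (some a) (fun w => toW (f w.1))

lemma toW_inj : Injective (toW : T Z W → _) := by
  intro x
  induction x with
  | leaf =>
    intro y h
    cases y with
    | leaf => rfl
    | node b g => simp [toW] at h
  | node a f ih =>
    intro y h
    cases y with
    | leaf => simp [toW] at h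
    | node b g =>
      simp only [toW, WType.mk.injEq, Option.some.injEq] at h
      obtain ⟨rfl, h⟩ := h
      have h := eq_of_heq h
      congr 1
      funext w
      exact ih w (congrFun h ⟨w, rfl⟩)

lemma mk_T [Infinite W] {k : Cardinal.{0}} (hk : #W ≤ k) (hZ : #Z = 2 ^ k) :
    #(T Z W) = 2 ^ k := by
  have hk0 := (aleph0_le_mk W).trans hk
  have h2 : ℵ₀ ≤ (2 : Cardinal) ^ k := hk0.trans (cantor _).le
  apply le_antisymm
  · refine (mk_le_of_injective toW_inj).trans (WType.cardinalMk_le_of_le' ?_)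
    refine (sum_le_mk_mul_iSup _).trans ?_
    rw [mk_option, hZ]
    refine (mul_le_mul' (add_le_of_le h2 le_rfl (one_le_aleph0.trans h2)) (ciSup_le' (a := 2 ^ k) ?_)).trans
      (mul_eq_self h2).le
    intro o
    rw [lift_id, ← power_mul]
    refine power_le_power_left two_ne_zero ?_
    refine (mul_le_mul' le_rfl ((mk_subtype_le _).trans hk)).trans (mul_eq_self hk0).le
  · rw [← hZ]
    exact mk_le_of_injective (f := fun a => T.node a (fun _ => T.leaf)) (fun a b h => by
      simpa using h)

section
variable (p : ((W → Bool) → Bool) → Ultrafilter W) (code : T Z W → ((W → Bool) → Bool))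

def Good (V : Set (T Z W)) : Prop :=
  ∀ x, lim x → (x ∈ V ↔ ∀ᶠ w in (p (code x) : Filter W), ch x w ∈ V)

lemma Good.compl {V : Set (T Z W)} (h : Good p code V) : Good p code Vᶜ := by
  intro x hx
  have := h x hx
  simp only [mem_compl_iff]
  rw [this, Ultrafilter.eventually_not]

lemma Good.inter {V V' : Set (T Z W)} (h : Good p code V) (h' : Good p code V') :
    Good p code (V ∩ V') := by
  intro x hx
  simp only [mem_inter_iff, eventually_and]
  rw [h x hx, h' x hx]

lemma Good.univ : Good p code (Set.univ : Set (T Z W)) := by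
  intro x hx; simp

open Classical in
def inV (C V0 : Set (T Z W)) : T Z W → Prop
  | .leaf => T.leaf ∈ C ∧ T.leaf ∈ V0
  | .node a f => (T.node a f ∈ C ∧ T.node a f ∈ V0) ∨
      (T.node a f ∉ C ∧ ∀ᶠ w in (p (code (T.node a f)) : Filter W), inV C V0 (f w))

lemma inV_C (C V0 : Set (T Z W)) (x : T Z W) (hx : x ∈ C) : inV p code C V0 x ↔ x ∈ V0 := by
  cases x with
  | leaf => simp [inV, hx]
  | node a f => simp [inV, hx]

lemma inV_notC (C V0 : Set (T Z W)) (x : T Z W) (hx : x ∉ C) (hl : lim x) :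
    inV p code C V0 x ↔ ∀ᶠ w in (p (code x) : Filter W), inV p code C V0 (ch x w) := by
  cases x with
  | leaf => exact hl.elim
  | node a f => simp [inV, hx, ch]

lemma separate [Infinite W] (hp : SepUF W p) (hcode : Injective code) (x0 y0 : T Z W)
    (hne : x0 ≠ y0) : ∃ V, Good p code V ∧ x0 ∈ V ∧ y0 ∉ V := by
  classical
  set C : Set (T Z W) := sub x0 ∪ sub y0 with hCdef
  have hCch : ∀ x ∈ C, ∀ w, ch x w ∈ C := by
    rintro x (hx | hx) w
    · exact Or.inl (ch_mem_sub _ x hx w)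
    · exact Or.inr (ch_mem_sub _ x hx w)
  have hx0 : x0 ∈ C := Or.inl (self_mem_sub _)
  have hy0 : y0 ∈ C := Or.inr (self_mem_sub _)
  have hCc : #C ≤ #W := (mk_union_le _ _).trans
    (add_le_of_le (aleph0_le_mk W) (mk_sub_le _) (mk_sub_le _))
  obtain ⟨e⟩ := hCc
  obtain ⟨U, hU, hUd⟩ := hp.2 {x : T Z W // x ∈ C ∧ lim x} (T Z W)
    (fun d => e ⟨d.1, d.2.1⟩)
    (fun a b h => by
      have h2 := e.injective h
      rw [Subtype.mk.injEq] at h2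
      exact Subtype.ext h2)
    (fun d => code d.1) (fun a b h => Subtype.ext (hcode h))
    (fun d => ch d.1) (fun d => lim_inj d.2.2)
  set child : T Z W → T Z W → Prop := fun u x =>
    u ≠ x0 ∧ u ≠ y0 ∧ ∃ h : x ∈ C ∧ lim x, ∃ w ∈ U ⟨x, h⟩, ch x w = u with hchild
  have huniq : ∀ u x x', child u x → child u x' → x = x' := by
    rintro u x x' ⟨_, _, h, w, hw, hu⟩ ⟨_, _, h', w', hw', hu'⟩
    by_contra hxx
    exact hUd ⟨x, h⟩ ⟨x', h'⟩ (fun hh => hxx (congrArg Subtype.val hh)) w hw w' hw'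
      (hu.trans hu'.symm)
  set V0 : Set (T Z W) := {u | Relation.ReflTransGen child u x0}
  have hyV : y0 ∉ V0 := by
    intro h
    rcases Relation.ReflTransGen.cases_head h with h | ⟨c, hc, _⟩
    · exact hne h.symm
    · exact hc.2.1 rfl
  have hcV : ∀ u x, child u x → (u ∈ V0 ↔ x ∈ V0) := by
    intro u x hux
    constructor
    · intro h
      rcases Relation.ReflTransGen.cases_head h with h | ⟨c, hc, hcx⟩
      · exact absurd h hux.1
      · rw [huniq u x c hux hc]; exact hcx
    · intro h
      exact Relation.ReflTransGen.head hux h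
  refine ⟨{x | inV p code C V0 x}, ?_, ?_, ?_⟩
  · intro x hx
    by_cases hxC : x ∈ C
    · have hev : ∀ᶠ w in (p (code x) : Filter W), (inV p code C V0 (ch x w) ↔ inV p code C V0 x) := by
        have h1 : ∀ u, ∀ᶠ w in (p (code x) : Filter W), ch x w ≠ u := by
          intro u
          apply hp.1 (code x)
          have : {w | ch x w = u}.Finite := by
            apply Set.Subsingleton.finite
            intro a ha b hb
            exact lim_inj hx (Eq.trans ha (Eq.symm hb))
          filter_upwards [this.compl_mem_cofinite] with w hw
          exact hw
        filter_upwards [hU ⟨x, hxC, hx⟩, h1 x0, h1 y0] with w hw h2 h3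
        rw [inV_C p code C V0 x hxC, inV_C p code C V0 _ (hCch x hxC w)]
        exact hcV _ _ ⟨h2, h3, ⟨hxC, hx⟩, w, hw, rfl⟩
      constructor
      · intro h
        filter_upwards [hev] with w hw
        exact hw.2 h
      · intro h
        obtain ⟨w, h1, h2⟩ := (hev.and h).exists
        exact h1.1 h2
    · exact inV_notC p code C V0 x hxC hx
  · exact (inV_C p code C V0 x0 hx0).2 Relation.ReflTransGen.refl
  · exact fun h => hyV ((inV_C p code C V0 y0 hy0).1 h)

end

end TermSpace

theorem exists_space_no_closed_in_interval (l k : Cardinal)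
    (hl : Cardinal.aleph0 ≤ l)
    (hk1 : (2 : Cardinal) ^ l < (2 : Cardinal) ^ k)
    (hk2 : ∀ k' : Cardinal, k' < k → (2 : Cardinal) ^ k' ≤ (2 : Cardinal) ^ l) :
    ∃ (X : Type) (t : TopologicalSpace X),
      @T2Space X t ∧
      (∃ B : Set (Set X),
        @TopologicalSpace.IsTopologicalBasis X t B ∧ ∀ s ∈ B, @IsClopen X t s) ∧
      Cardinal.mk X = (2 : Cardinal) ^ k ∧
      ∀ Y : Set X, @IsClosed X t Y →
        Cardinal.mk ↥Y < l ∨ Cardinal.mk ↥Y = (2 : Cardinal) ^ k := by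
  classical
  obtain ⟨W, p, hW, hp⟩ := exists_sepUF l hl
  have hinf : Infinite W := by rw [infinite_iff, hW]; exact hl
  have hlk : #W ≤ k := by
    rw [hW]
    by_contra! h
    exact absurd hk1 (not_lt.2 (power_le_power_left two_ne_zero h.le))
  have hkl : k ≤ 2 ^ l := by
    by_contra! h
    exact absurd (cantor ((2 : Cardinal) ^ l)) (not_lt.2 (hk2 _ h))
  set Z : Type := k.out → Bool
  have hZ : #Z = 2 ^ k := by
    rw [← Cardinal.power_def]; simp
  have hX := TermSpace.mk_T (Z := Z) hlk hZ
  have hcode : Nonempty (TermSpace.T Z W ↪ ((W → Bool) → Bool)) := by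
    rw [← Cardinal.le_def, hX, ← Cardinal.power_def, ← Cardinal.power_def, hW]
    simpa using power_le_power_left two_ne_zero hkl
  obtain ⟨code⟩ := hcode
  set B : Set (Set (TermSpace.T Z W)) := {V | TermSpace.Good p code V}
  let t : TopologicalSpace (TermSpace.T Z W) := TopologicalSpace.generateFrom B
  have hB : TopologicalSpace.IsTopologicalBasis B :=
    { exists_subset_inter := fun V hV V' hV' x hx =>
        ⟨V ∩ V', TermSpace.Good.inter p code hV hV', hx, subset_rfl⟩
      sUnion_eq := eq_univ_of_forall fun x => ⟨Set.univ, TermSpace.Good.univ p code, trivial⟩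
      eq_generateFrom := rfl }
  have hclopen : ∀ s ∈ B, IsClopen s := fun s hs =>
    ⟨⟨hB.isOpen (TermSpace.Good.compl p code hs)⟩, hB.isOpen hs⟩
  refine ⟨TermSpace.T Z W, t, ?_, ⟨B, hB, hclopen⟩, hX, ?_⟩
  · refine ⟨fun x y hxy => ?_⟩
    obtain ⟨V, hV, hx, hy⟩ := TermSpace.separate p code hp code.injective x y hxy
    exact ⟨V, Vᶜ, hB.isOpen hV, hB.isOpen (TermSpace.Good.compl p code hV), hx, hy,
      disjoint_compl_right⟩
  · intro Y hY
    rcases lt_or_ge (#Y) l with h | h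
    · exact Or.inl h
    right
    apply le_antisymm
    · rw [← hX]; exact mk_set_le Y
    · rw [← hW] at h
      obtain ⟨f⟩ := h
      have hmem : ∀ a : Z, TermSpace.T.node a (fun w => (f w).1) ∈ Y := by
        intro a
        apply hY.closure_subset
        rw [hB.mem_closure_iff]
        intro V hV ha
        have hlim : TermSpace.lim (TermSpace.T.node a (fun w => (f w).1)) :=
          Subtype.val_injective.comp f.injective
        obtain ⟨w, hw⟩ := ((hV _ hlim).1 ha).exists
        exact ⟨(f w).1, hw, (f w).2⟩
      rw [← hZ]
      exact mk_le_of_injective (f := fun a => (⟨_, hmem a⟩ : Y)) (fun a b h => by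
        simpa using h)
end
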